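/- Let R be a commutative Noetherian ring of dimension n and M a Φ-simplicial monoid in the class C(Φ). Then every finitely generated projective R[M]-module of constant rank > n contains a unimodular element. -/

import Mathlib

set_option synthInstance.maxHeartbeats 1000000
set_option maxHeartbeats 1000000

open MvPolynomial

/-- The coordinatewise cast `ℕ^r → ℤ^r` as an additive monoid hom. -/
def natCast (r : ℕ) : (Fin r → ℕ) →+ (Fin r → ℤ) where
  toFun x i := (x i : ℤ)
  map_zero' := by funext i; simp
  map_add' x y := by funext i; simp

/-- A `Φ`-simplicial monoid of rank `r`: a finitely generated submonoid `M ⊆ ℤ₊^r`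
such that the extension `M ⊆ ℤ₊^r` is integral. -/
def PhiSimplicial {r : ℕ} (M : AddSubmonoid (Fin r → ℕ)) : Prop :=
  M.FG ∧ ∀ x : Fin r → ℕ, ∃ n : ℕ, 0 < n ∧ n • x ∈ M

/-- Seminormality of a submonoid `M ⊆ ℤ₊^r`: if `x ∈ gp(M)` and `2x, 3x ∈ M`,
then `x ∈ M`. -/
def MonoidSeminormal {r : ℕ} (M : AddSubmonoid (Fin r → ℕ)) : Prop :=
  ∀ x : Fin r → ℤ, x ∈ AddSubgroup.closure (M.map (natCast r) : Set (Fin r → ℤ)) →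
    2 • x ∈ M.map (natCast r) → 3 • x ∈ M.map (natCast r) → x ∈ M.map (natCast r)

/-- The truncation `M_m` of `M`: elements supported on the coordinates `≤ m`. -/
def truncMonoid {r : ℕ} (M : AddSubmonoid (Fin r → ℕ)) (m : Fin r) :
    Set (Fin r → ℕ) := {x | x ∈ M ∧ ∀ i : Fin r, m < i → x i = 0}

/-- The monomial of `MvPolynomial (Fin r) R` with exponent vector `x`. -/
noncomputable def monomialOf {r : ℕ} (R : Type*) [CommRing R] (x : Fin r → ℕ) :
    MvPolynomial (Fin r) R :=
  MvPolynomial.monomial (Finsupp.equivFunOnFinite.symm x) 1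

/-- The subalgebra `R[M_m]` of `R[t₁,…,t_r]` spanned by the monomials of the
truncation `M_m`. -/
noncomputable def truncAlgebra {r : ℕ} (M : AddSubmonoid (Fin r → ℕ)) (m : Fin r)
    (R : Type*) [CommRing R] : Subalgebra R (MvPolynomial (Fin r) R) :=
  Algebra.adjoin R (monomialOf R '' truncMonoid M m)

/-- The substitution `t_i ↦ t_i + t_m^{c_i}` for `i < m`, fixing the other variables. -/
noncomputable def subst {r : ℕ} (m : Fin r) (cs : Fin r → ℕ) (R : Type*) [CommRing R] :
    MvPolynomial (Fin r) R →ₐ[R] MvPolynomial (Fin r) R :=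
  MvPolynomial.aeval (fun i => if i < m then X i + X m ^ cs i else X i)

/-- The class `C(Φ)`: `M` is seminormal and each truncation `M_m` satisfies the
automorphism condition: for every `c` there are `c_i > c` such that for every
commutative ring `R` the substitution `t_i ↦ t_i + t_m^{c_i}` (for `i < m`)
restricts to an `R`-automorphism of `R[M_m]`. -/
def InClassCPhi {r : ℕ} (M : AddSubmonoid (Fin r → ℕ)) : Prop :=
  MonoidSeminormal M ∧
  ∀ (m : Fin r) (c : ℕ), ∃ cs : Fin r → ℕ, (∀ i : Fin r, i < m → c < cs i) ∧
    ∀ (R : Type) (_ : CommRing R),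
      Subalgebra.map (subst m cs R) (truncAlgebra M m R) = truncAlgebra M m R

/-- A unimodular element of a module. -/
def IsUnimodular {R P : Type*} [CommRing R] [AddCommGroup P] [Module R P] (p : P) : Prop :=
  ∃ φ : P →ₗ[R] R, φ p = 1

universe u

section Height

theorem height_le_one_of_comap_C_eq_bot {D : Type*} [CommRing D] [IsDomain D]
    (Q : Ideal (Polynomial D)) [hQ : Q.IsPrime] (h : Q.comap Polynomial.C = ⊥) : Q.height ≤ 1 := by
  let K := FractionRing D
  let M : Submonoid (Polynomial D) := Submonoid.map Polynomial.C (nonZeroDivisors D)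
  let _ : Algebra (Polynomial D) (Polynomial K) := Polynomial.algebra D K
  have : IsLocalization M (Polynomial K) := Polynomial.isLocalization (nonZeroDivisors D) K
  have hd : Disjoint (M : Set (Polynomial D)) (Q : Set (Polynomial D)) := by
    rw [Set.disjoint_left]
    rintro _ ⟨d, hd, rfl⟩ hq
    have : d ∈ Q.comap Polynomial.C := hq
    rw [h, Ideal.mem_bot] at this
    exact nonZeroDivisors.ne_zero hd this
  have hp := IsLocalization.isPrime_of_isPrime_disjoint M (Polynomial K) Q hQ hd
  have e := IsLocalization.under_map_of_isPrime_disjoint M (Polynomial K) hQ hd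
  have e2 := IsLocalization.height_under M (Ideal.map (algebraMap (Polynomial D) (Polynomial K)) Q)
  rw [e] at e2
  rw [e2]
  have h1 : ringKrullDim (Polynomial K) = 1 := by
    rw [Polynomial.ringKrullDim_of_isNoetherianRing, ringKrullDim_eq_zero_of_field]; rfl
  have h2 := Ideal.height_le_ringKrullDim_of_isPrime
    (I := Ideal.map (algebraMap (Polynomial D) (Polynomial K)) Q)
  rw [h1] at h2
  exact_mod_cast h2

theorem Ideal.height_polynomial_le {R : Type*} [CommRing R] [IsNoetherianRing R]
    (Q : Ideal (Polynomial R)) [hQ : Q.IsPrime] :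
    Q.height ≤ (Q.comap Polynomial.C).height + 1 := by
  set p := Q.comap (Polynomial.C (R := R)) with hp
  have : p.IsPrime := Ideal.comap_isPrime _ _
  have : Q.LiesOver p := ⟨rfl⟩
  rw [Ideal.height_eq_height_add_of_liesOver_of_hasGoingDown p]
  gcongr
  let e : (Polynomial R ⧸ (p.map (algebraMap R (Polynomial R)))) ≃+* Polynomial (R ⧸ p) :=
    (Ideal.polynomialQuotientEquivQuotientPolynomial p).symm
  rw [← e.height_map]
  have hker : RingHom.ker (Ideal.Quotient.mk (p.map (algebraMap R (Polynomial R)))) ≤ Q := by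
    rw [Ideal.mk_ker]; exact Ideal.map_comap_le
  have h1 : (Q.map (Ideal.Quotient.mk (p.map (algebraMap R (Polynomial R))))).IsPrime :=
    Ideal.map_isPrime_of_surjective Ideal.Quotient.mk_surjective hker
  have : (Ideal.map e (Q.map (Ideal.Quotient.mk (p.map (algebraMap R (Polynomial R)))))).IsPrime :=
    Ideal.map_isPrime_of_equiv e
  apply height_le_one_of_comap_C_eq_bot
  rw [eq_bot_iff]
  intro x hx
  obtain ⟨x, rfl⟩ := Ideal.Quotient.mk_surjective x
  rw [Ideal.mem_comap, ← Ideal.comap_symm, Ideal.mem_comap] at hx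
  have h3 : e.symm (Polynomial.C (Ideal.Quotient.mk p x)) =
      Ideal.Quotient.mk (p.map (algebraMap R (Polynomial R))) (Polynomial.C x) := by
    have := Ideal.polynomialQuotientEquivQuotientPolynomial_map_mk p (Polynomial.C x)
    simpa [e] using this
  rw [h3] at hx
  have h4 : Polynomial.C x ∈ (Q.map (Ideal.Quotient.mk (p.map (algebraMap R (Polynomial R))))).comap
    (Ideal.Quotient.mk (p.map (algebraMap R (Polynomial R)))) := hx
  rw [Ideal.comap_map_of_surjective' _ Ideal.Quotient.mk_surjective, sup_eq_left.mpr hker] at h4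
  rw [Ideal.mem_bot, Ideal.Quotient.eq_zero_iff_mem]
  exact h4

theorem Ideal.height_map_C_le {R : Type*} [CommRing R] [IsNoetherianRing R]
    (p : Ideal R) [p.IsPrime] : (p.map (Polynomial.C (R := R))).height ≤ p.height := by
  have : (p.map (Polynomial.C (R := R))).IsPrime := Ideal.isPrime_map_C_of_isPrime
  have : (p.map (Polynomial.C (R := R))).LiesOver p := ⟨by
    ext x
    constructor
    · intro h; exact Ideal.mem_map_of_mem _ h
    · intro h
      have h : Polynomial.C x ∈ p.map Polynomial.C := h
      rw [Ideal.mem_map_C_iff] at h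
      simpa using h 0⟩
  rw [Ideal.height_eq_height_add_of_liesOver_of_hasGoingDown p]
  have : (Ideal.map (Ideal.Quotient.mk (Ideal.map (algebraMap R (Polynomial R)) p))
      (p.map (Polynomial.C (R := R)))) = ⊥ := by
    rw [Ideal.map_eq_bot_iff_le_ker, Ideal.mk_ker]; rfl
  rw [this]
  have : Nontrivial (Polynomial R ⧸ Ideal.map (algebraMap R (Polynomial R)) p) :=
    Ideal.Quotient.nontrivial_iff.mpr (Ideal.IsPrime.ne_top ‹_›)
  rw [Ideal.height_bot, add_zero]

theorem Ideal.height_le_height_comap_of_isIntegral {A B : Type*} [CommRing A] [CommRing B]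
    (f : A →+* B) (hf : f.IsIntegral) (Q : Ideal B) [hQ : Q.IsPrime] :
    Q.height ≤ (Q.comap f).height := by
  let _ := f.toAlgebra
  have : Algebra.IsIntegral A B := ⟨hf⟩
  have h := Order.height_le_height_apply_of_strictMono (PrimeSpectrum.comap f)
    (fun I J hIJ => Ideal.IsIntegral.comap_lt_comap (R := A) (I := I.asIdeal) (J := J.asIdeal) hIJ)
    ⟨Q, hQ⟩
  rw [← PrimeSpectrum.height_eq_orderHeight, ← PrimeSpectrum.height_eq_orderHeight] at h
  exact h

/-- A version of basic element theory (Eisenbud–Evans). -/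
theorem exists_forall_le_height_of_add_mul_mem {A : Type*} [CommRing A] [IsNoetherianRing A]
    (t : A) : ∀ (k : ℕ) (w : Fin k → A), ∃ a : Fin k → A, ∀ 𝔮 : Ideal A, 𝔮.IsPrime → t ∉ 𝔮 →
      (∀ i, w i + t * a i ∈ 𝔮) → (k : ℕ∞) ≤ 𝔮.height := by
  intro k
  induction k with
  | zero => intro w; exact ⟨0, by simp⟩
  | succ k ih =>
    intro w
    obtain ⟨a, ha⟩ := ih (fun i => w i.castSucc)
    set I : Ideal A := Ideal.span (Set.range fun i : Fin k => w i.castSucc + t * a i) with hI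
    have hfin := Ideal.finite_minimalPrimes_of_isNoetherianRing A I
    classical
    let S : Finset (Ideal A) := hfin.toFinset
    have hS : ∀ p ∈ S, p ∈ I.minimalPrimes := fun p hp => by simpa [S] using hp
    let v := w (Fin.last k)
    obtain ⟨b, hb1, hb2⟩ : ∃ b : A, (∀ p ∈ S, v ∉ p → b ∈ p) ∧ (∀ p ∈ S, v ∈ p → b ∉ p) := by
      by_contra! hcon
      have hsub : (((S.filter (fun p => v ∉ p)).inf id : Ideal A) : Set A) ⊆
          ⋃ i ∈ ((S.filter (fun p => v ∈ p)) : Set (Ideal A)), ((id i : Ideal A) : Set A) := by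
        intro b hb
        obtain ⟨p, hp, hvp, hbp⟩ := hcon b (fun p hp hv => by
          have : (S.filter (fun p => v ∉ p)).inf id ≤ p :=
            Finset.inf_le (f := id) (Finset.mem_filter.mpr ⟨hp, hv⟩)
          exact this hb)
        exact Set.mem_biUnion (x := p) (by simp [hp, hvp]) hbp
      rw [Ideal.subset_union_prime ⊥ ⊥] at hsub
      · obtain ⟨p, hp, hle⟩ := hsub
        rw [Finset.mem_filter] at hp
        have hpm := hS p hp.1
        obtain ⟨q, hq, hqp⟩ := (Ideal.IsPrime.inf_le' hpm.isPrime).mp hle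
        rw [Finset.mem_filter] at hq
        have hqm := hS q hq.1
        have : p ≤ q := hpm.2 hqm.1 hqp
        exact hq.2 (this hp.2)
      · intro p hp _ _
        exact (hS p (Finset.mem_filter.mp hp).1).isPrime
    refine ⟨Fin.snoc a b, fun 𝔮 h𝔮 ht hmem => ?_⟩
    have hI𝔮 : I ≤ 𝔮 := by
      rw [hI, Ideal.span_le]
      rintro _ ⟨i, rfl⟩
      simpa using hmem i.castSucc
    obtain ⟨p, hp, hp𝔮⟩ := Ideal.exists_minimalPrimes_le hI𝔮
    have htp : t ∉ p := fun h => ht (hp𝔮 h)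
    have := hp.isPrime
    have hk : (k : ℕ∞) ≤ p.height := ha p hp.isPrime htp fun i =>
      hp.1.2 (Ideal.subset_span ⟨i, rfl⟩)
    have hlast : v + t * b ∈ 𝔮 := by simpa using hmem (Fin.last k)
    have hpS : p ∈ S := by simpa [S] using hp
    have hne : p ≠ 𝔮 := by
      rintro rfl
      by_cases hv : v ∈ p
      · have := (p.add_mem_iff_right hv).mp hlast
        exact (hp.isPrime.mem_or_mem this).elim htp (hb2 p hpS hv)
      · exact hv ((p.add_mem_iff_left (p.mul_mem_left t (hb1 p hpS hv))).mp hlast)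
    have hlt : p < 𝔮 := lt_of_le_of_ne hp𝔮 hne
    have := Ideal.height_add_one_le_of_lt_of_isPrime hlt
    push_cast
    exact le_trans (by gcongr) this

end Height

section Idempotent

theorem exists_mul_eq_of_isIdempotent_of_pid {A : Type*} [CommRing A] [IsDomain A]
    [IsPrincipalIdealRing A] {n : Type*} [Fintype n] [DecidableEq n] (e : Matrix n n A)
    (he : e * e = e) : ∃ (k : ℕ) (X : Matrix n (Fin k) A) (Y : Matrix (Fin k) n A),
      X * Y = e ∧ Y * X = 1 := by
  obtain ⟨k, b⟩ := Submodule.basisOfPid (Pi.basisFun A n) (LinearMap.range e.mulVecLin)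
  let X : Matrix n (Fin k) A := Matrix.of fun i j => (b j : n → A) i
  let col : n → LinearMap.range e.mulVecLin := fun j => ⟨e.mulVec (Pi.single j 1), ⟨_, rfl⟩⟩
  let Y : Matrix (Fin k) n A := Matrix.of fun i j => b.repr (col j) i
  have hXv : ∀ v : Fin k → A, X.mulVec v = ((∑ j, v j • b j : LinearMap.range e.mulVecLin) : n → A) := by
    intro v
    ext i
    simp [X, Matrix.mulVec, dotProduct, mul_comm]
  have hXY : X * Y = e := by
    ext i j
    have : (X * Y) i j = X.mulVec (fun l => Y l j) i := rfl
    rw [this, hXv]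
    have h2 : ∑ l, Y l j • b l = col j := b.sum_repr (col j)
    rw [h2]
    simp [col]
  have heb : e * X = X := by
    ext i j
    obtain ⟨v, hv⟩ := (b j).2
    have h1 : (e * X) i j = e.mulVec (b j : n → A) i := rfl
    rw [h1, ← hv]
    simp only [Matrix.mulVecLin_apply, Matrix.mulVec_mulVec, he]
    have : X i j = (b j : n → A) i := rfl
    rw [this, ← hv]; rfl
  refine ⟨k, X, Y, hXY, ?_⟩
  have hinj : ∀ v : Fin k → A, X.mulVec v = 0 → v = 0 := by
    intro v hv
    rw [hXv] at hv
    have hz : ∑ j, v j • b j = 0 := Subtype.ext hv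
    have := Fintype.linearIndependent_iff.mp b.linearIndependent v hz
    exact funext this
  have hX0 : X * (Y * X - 1) = 0 := by
    rw [Matrix.mul_sub, ← Matrix.mul_assoc, hXY, heb, Matrix.mul_one, sub_self]
  rw [← sub_eq_zero]
  ext i j
  have : X.mulVec (fun l => (Y * X - 1 : Matrix (Fin k) (Fin k) A) l j) = 0 := by
    ext i
    have : X.mulVec (fun l => (Y * X - 1 : Matrix (Fin k) (Fin k) A) l j) i = (X * (Y * X - 1 : Matrix (Fin k) (Fin k) A)) i j := rfl
    rw [this, hX0]; rfl
  exact congrFun (hinj _ this) i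

end Idempotent

section LexMonic

/-- A polynomial whose lexicographically leading coefficient is `1` (variable `0` dominating). -/
def LexMonic {L : Type*} [CommRing L] : ∀ {m : ℕ}, MvPolynomial (Fin m) L → Prop
  | 0, f => f = 1
  | _ + 1, f => LexMonic (Polynomial.leadingCoeff (finSuccEquiv L _ f))

variable {L : Type*} [CommRing L]

theorem LexMonic.of_subsingleton [Subsingleton L] : ∀ {m : ℕ} (f : MvPolynomial (Fin m) L),
    LexMonic f
  | 0, f => Subsingleton.elim _ _
  | m + 1, f => by
    change LexMonic (Polynomial.leadingCoeff (finSuccEquiv L m f))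
    exact LexMonic.of_subsingleton (m := m) _

theorem LexMonic.ne_zero [Nontrivial L] : ∀ {m : ℕ} {f : MvPolynomial (Fin m) L},
    LexMonic f → f ≠ 0
  | 0, f, h => by rw [show f = 1 from h]; exact one_ne_zero
  | m + 1, f, h => by
    rintro rfl
    have h : LexMonic (Polynomial.leadingCoeff (finSuccEquiv L m 0)) := h
    rw [map_zero, Polynomial.leadingCoeff_zero] at h
    exact LexMonic.ne_zero (m := m) h rfl

theorem LexMonic.one : ∀ {m : ℕ}, LexMonic (1 : MvPolynomial (Fin m) L)
  | 0 => rfl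
  | _ + 1 => by
    nontriviality L using LexMonic.of_subsingleton
    change LexMonic (Polynomial.leadingCoeff (finSuccEquiv L _ 1))
    rw [map_one, Polynomial.leadingCoeff_one]
    exact LexMonic.one

theorem LexMonic.mul : ∀ {m : ℕ} {f g : MvPolynomial (Fin m) L},
    LexMonic f → LexMonic g → LexMonic (f * g)
  | 0, f, g, hf, hg => by
    rw [show f = 1 from hf, show g = 1 from hg, mul_one]; exact LexMonic.one
  | _ + 1, f, g, hf, hg => by
    nontriviality L using LexMonic.of_subsingleton
    change LexMonic (Polynomial.leadingCoeff (finSuccEquiv L _ (f * g)))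
    have h := LexMonic.mul (f := Polynomial.leadingCoeff (finSuccEquiv L _ f))
      (g := Polynomial.leadingCoeff (finSuccEquiv L _ g)) hf hg
    rw [map_mul, Polynomial.leadingCoeff_mul' h.ne_zero]
    exact h

/-- The multiplicative set of lexicographically monic polynomials. -/
def lexMonicSubmonoid (L : Type*) [CommRing L] (m : ℕ) : Submonoid (MvPolynomial (Fin m) L) where
  carrier := {f | LexMonic f}
  one_mem' := LexMonic.one
  mul_mem' := LexMonic.mul

theorem exists_lexMonic_mem_of_forall_prime {m : ℕ} (I : Ideal (MvPolynomial (Fin m) L))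
    (h : ∀ 𝔮 : Ideal (MvPolynomial (Fin m) L), 𝔮.IsPrime → I ≤ 𝔮 → ∃ f ∈ 𝔮, LexMonic f) :
    ∃ f ∈ I, LexMonic f := by
  by_contra! hcon
  obtain ⟨p, hp, hIp, hd⟩ := Ideal.exists_le_prime_disjoint I (lexMonicSubmonoid L m)
    (Set.disjoint_left.mpr fun f hf hf' => hcon f hf hf')
  obtain ⟨f, hf, hf'⟩ := h p hp hIp
  exact Set.disjoint_left.mp hd hf hf'

theorem Ideal.le_map_C_of_leadingCoeff_le {R : Type*} [CommRing R] (Q : Ideal (Polynomial R))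
    (h : Q.leadingCoeff ≤ Q.comap Polynomial.C) :
    Q ≤ (Q.comap Polynomial.C).map Polynomial.C := by
  intro f
  induction hn : f.natDegree using Nat.strong_induction_on generalizing f with
  | _ n ih =>
    intro hf
    have hlc : f.leadingCoeff ∈ Q.comap Polynomial.C := h ((Ideal.mem_leadingCoeff _ _).mpr ⟨f, hf, rfl⟩)
    have hmon : Polynomial.C f.leadingCoeff * Polynomial.X ^ f.natDegree ∈
        (Q.comap Polynomial.C).map Polynomial.C :=
      Ideal.mul_mem_right _ _ (Ideal.mem_map_of_mem _ hlc)
    have hmonQ := Ideal.map_comap_le hmon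
    rw [← Polynomial.eraseLead_add_C_mul_X_pow f]
    refine add_mem ?_ hmon
    by_cases h0 : f.eraseLead = 0
    · rw [h0]; exact zero_mem _
    · have hQ : f.eraseLead ∈ Q := by
        rw [← Polynomial.self_sub_C_mul_X_pow]
        exact sub_mem hf hmonQ
      have hlt := (f.eraseLead_natDegree_lt_or_eraseLead_eq_zero).resolve_right h0
      exact ih _ (hn ▸ hlt) rfl hQ

theorem exists_lexMonic_mem_of_le_height {R : Type*} [CommRing R] [IsNoetherianRing R] {D : ℕ}
    (hD : ringKrullDim R < D) : ∀ {m : ℕ} (𝔮 : Ideal (MvPolynomial (Fin m) R)) (_ : 𝔮.IsPrime),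
    (D : ℕ∞) ≤ 𝔮.height → ∃ f ∈ 𝔮, LexMonic f := by
  intro m
  induction m with
  | zero =>
    intro 𝔮 h𝔮 hht
    have h1 := Ideal.height_le_ringKrullDim_of_isPrime (I := 𝔮)
    rw [MvPolynomial.ringKrullDim_of_isNoetherianRing] at h1
    simp only [Nat.card_eq_fintype_card, Fintype.card_fin, Nat.cast_zero, add_zero] at h1
    have h2 : ((D : ℕ∞) : WithBot ℕ∞) ≤ (𝔮.height : WithBot ℕ∞) := by exact_mod_cast hht
    exact absurd (h2.trans h1) (not_le.mpr hD)
  | succ m ih =>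
    intro 𝔮 h𝔮 hht
    let E := (finSuccEquiv R m).toRingEquiv
    let Q := 𝔮.map E
    have : Q.IsPrime := Ideal.map_isPrime_of_equiv E
    have hQht : (D : ℕ∞) ≤ Q.height := by rw [show Q.height = 𝔮.height from E.height_map 𝔮]; exact hht
    suffices ∃ g ∈ Q, LexMonic g.leadingCoeff by
      obtain ⟨g, hg, hgl⟩ := this
      refine ⟨E.symm g, ?_, ?_⟩
      · have : g ∈ 𝔮.map E := hg
        rw [← Ideal.comap_symm] at this
        exact this
      · change LexMonic (Polynomial.leadingCoeff (E (E.symm g)))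
        rwa [RingEquiv.apply_symm_apply]
    set p := Q.comap (Polynomial.C (R := MvPolynomial (Fin m) R)) with hp
    have : p.IsPrime := Ideal.comap_isPrime _ _
    by_cases hph : (D : ℕ∞) ≤ p.height
    · obtain ⟨f, hf, hfl⟩ := ih p ‹_› hph
      exact ⟨Polynomial.C f, hf, by rwa [Polynomial.leadingCoeff_C]⟩
    obtain ⟨f, hf, hfl⟩ : ∃ f ∈ Q.leadingCoeff, LexMonic f := by
      apply exists_lexMonic_mem_of_forall_prime
      intro P hP hle
      apply ih P hP
      have hpP : p ≤ P := fun x hx => hle ((Ideal.mem_leadingCoeff _ _).mpr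
        ⟨Polynomial.C x, hx, Polynomial.leadingCoeff_C x⟩)
      have hne : p ≠ P := by
        rintro rfl
        have h1 := Ideal.le_map_C_of_leadingCoeff_le Q hle
        have h2 := Ideal.height_mono h1
        exact hph ((hQht.trans h2).trans (Ideal.height_map_C_le p))
      exact (hQht.trans Q.height_polynomial_le).trans
        (Ideal.height_add_one_le_of_lt_of_isPrime (lt_of_le_of_ne hpP hne))
    obtain ⟨g, hg, rfl⟩ := (Ideal.mem_leadingCoeff _ _).mp hf
    exact ⟨g, hg, hfl⟩

theorem exists_lexMonic_C_mul {K : Type*} [Field K] : ∀ {m : ℕ} (f : MvPolynomial (Fin m) K),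
    f ≠ 0 → ∃ a : K, a ≠ 0 ∧ LexMonic (C a * f)
  | 0, f, hf => by
    obtain ⟨b, rfl⟩ := C_surjective (R := K) (Fin 0) f
    have hb : b ≠ 0 := by rintro rfl; simp at hf
    refine ⟨b⁻¹, inv_ne_zero hb, ?_⟩
    change C b⁻¹ * C b = 1
    rw [← C_mul, inv_mul_cancel₀ hb, C_1]
  | m + 1, f, hf => by
    have h0 : (finSuccEquiv K m f).leadingCoeff ≠ 0 := by
      rw [Ne, Polynomial.leadingCoeff_eq_zero]
      simpa using hf
    obtain ⟨a, ha, h⟩ := exists_lexMonic_C_mul _ h0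
    refine ⟨a, ha, ?_⟩
    change LexMonic (Polynomial.leadingCoeff (finSuccEquiv K m (C a * f)))
    have : finSuccEquiv K m (C a) = Polynomial.C (C a) := by
      simp [finSuccEquiv_apply]
    rwa [map_mul, this, Polynomial.leadingCoeff_mul, Polynomial.leadingCoeff_C]

theorem LexMonic.exists_weight : ∀ {m : ℕ} {f : MvPolynomial (Fin m) L} (S : Fin m → Set ℕ),
    (∀ (i : Fin m) (b : ℕ), (i.val + 1 < m ∨ b = 0) → ∃ s ∈ S i, b < s) → LexMonic f →
    ∃ w : Fin m → ℕ, (∀ i, w i ∈ S i) ∧ ∃ x : Fin m →₀ ℕ, f.coeff x = 1 ∧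
      ∀ y ∈ f.support, y ≠ x → ∑ i, w i * y i < ∑ i, w i * x i
  | 0, f, S, _, hf => by
    refine ⟨Fin.elim0, fun i => i.elim0, 0, ?_, fun y _ hy => (hy (Subsingleton.elim _ _)).elim⟩
    rw [show f = 1 from hf]
    simp
  | m + 1, f, S, hS, hf => by
    set g := finSuccEquiv L m f with hg
    obtain ⟨w, hw, x, hx1, hx⟩ := LexMonic.exists_weight (f := g.leadingCoeff)
      (fun i => S i.succ) (fun i b hb => hS i.succ b (by simpa using hb)) hf
    let b := f.support.sup fun y => ∑ i, w i * y (Fin.succ i)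
    have hb0 : 0 + 1 < m + 1 ∨ b = 0 := by
      rcases Nat.eq_zero_or_pos m with rfl | hm
      · right
        rw [← Nat.le_zero]
        exact Finset.sup_le fun y _ => by simp
      · left; omega
    obtain ⟨s, hs, hbs⟩ := hS 0 b hb0
    refine ⟨Fin.cons s w, fun i => ?_, x.cons g.natDegree, ?_, ?_⟩
    · refine Fin.cases ?_ (fun i => ?_) i
      · simpa using hs
      · simpa using hw i
    · rw [← finSuccEquiv_coeff_coeff]; exact hx1
    · intro y hy hne
      rw [Fin.sum_univ_succ, Fin.sum_univ_succ]
      simp only [Fin.cons_zero, Fin.cons_succ, Finsupp.cons_zero, Finsupp.cons_succ]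
      have hcy : (g.coeff (y 0)).coeff y.tail = f.coeff y := by
        rw [hg, finSuccEquiv_coeff_coeff, Finsupp.cons_tail]
      have hcy0 : (g.coeff (y 0)).coeff y.tail ≠ 0 := by
        rw [hcy]; exact mem_support_iff.mp hy
      have hdeg : y 0 ≤ g.natDegree := by
        apply Polynomial.le_natDegree_of_ne_zero
        intro h; rw [h] at hcy0; simp at hcy0
      rcases hdeg.eq_or_lt with hdeg | hdeg
      · have hne' : y.tail ≠ x := by
          rintro rfl
          apply hne
          rw [← hdeg, Finsupp.cons_tail]
        have := hx y.tail (by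
          rw [mem_support_iff]
          rw [hdeg] at hcy0
          exact hcy0) hne'
        simp only [Finsupp.tail_apply] at this
        rw [hdeg]
        omega
      · have h1 : ∑ i, w i * y (Fin.succ i) ≤ b :=
          Finset.le_sup (f := fun y : Fin (m + 1) →₀ ℕ => ∑ i, w i * y (Fin.succ i)) hy
        have h2 : s * (y 0 + 1) ≤ s * g.natDegree := Nat.mul_le_mul_left _ hdeg
        rw [mul_add, mul_one] at h2
        generalize s * g.natDegree = A at *
        generalize s * y 0 = B at *
        omega

end LexMonic

section MonAlg

variable {r : ℕ} {R : Type*} [CommRing R]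

/-- All exponents occurring in `p` lie in `T`. -/
def SuppIn (T : Set (Fin r →₀ ℕ)) (p : MvPolynomial (Fin r) R) : Prop :=
  ∀ x, p.coeff x ≠ 0 → x ∈ T

theorem SuppIn.mono {T T' : Set (Fin r →₀ ℕ)} {p : MvPolynomial (Fin r) R} (h : SuppIn T p)
    (hT : T ⊆ T') : SuppIn T' p := fun x hx => hT (h x hx)

theorem SuppIn.zero {T : Set (Fin r →₀ ℕ)} : SuppIn T (0 : MvPolynomial (Fin r) R) :=
  fun x hx => (hx (coeff_zero x)).elim

theorem SuppIn.add {T : Set (Fin r →₀ ℕ)} {p q : MvPolynomial (Fin r) R} (hp : SuppIn T p)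
    (hq : SuppIn T q) : SuppIn T (p + q) := by
  intro x hx
  by_cases h : p.coeff x = 0
  · apply hq
    rwa [coeff_add, h, zero_add] at hx
  · exact hp x h

theorem SuppIn.sum {T : Set (Fin r →₀ ℕ)} {ι : Type*} (s : Finset ι)
    (p : ι → MvPolynomial (Fin r) R) (hp : ∀ i ∈ s, SuppIn T (p i)) :
    SuppIn T (∑ i ∈ s, p i) := by
  classical
  induction s using Finset.induction_on with
  | empty => exact SuppIn.zero
  | insert a s ha ih =>
    rw [Finset.sum_insert ha]
    exact (hp a (Finset.mem_insert_self _ _)).add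
      (ih fun i hi => hp i (Finset.mem_insert_of_mem hi))

theorem SuppIn.mul {T T' T'' : Set (Fin r →₀ ℕ)} {p q : MvPolynomial (Fin r) R}
    (hp : SuppIn T p) (hq : SuppIn T' q) (h : ∀ x ∈ T, ∀ y ∈ T', x + y ∈ T'') :
    SuppIn T'' (p * q) := by
  classical
  intro x hx
  have := support_mul p q (mem_support_iff.mpr hx)
  obtain ⟨a, ha, b, hb, rfl⟩ := Finset.mem_add.mp this
  exact h a (hp a (mem_support_iff.mp ha)) b (hq b (mem_support_iff.mp hb))

theorem SuppIn.monomial {T : Set (Fin r →₀ ℕ)} {x : Fin r →₀ ℕ} (hx : x ∈ T) (a : R) :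
    SuppIn T (monomial x a) := by
  classical
  intro y hy
  rw [coeff_monomial] at hy
  split_ifs at hy with h
  · exact h ▸ hx
  · exact (hy rfl).elim

theorem SuppIn.induction {T : Set (Fin r →₀ ℕ)} {P : MvPolynomial (Fin r) R → Prop}
    (hmon : ∀ x ∈ T, ∀ a, P (MvPolynomial.monomial x a)) (hz : P 0)
    (hadd : ∀ p q, SuppIn T p → SuppIn T q → P p → P q → P (p + q))
    {p : MvPolynomial (Fin r) R} (hp : SuppIn T p) : P p := by
  rw [p.as_sum]
  suffices h : ∀ s : Finset (Fin r →₀ ℕ), (∀ x ∈ s, x ∈ T) →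
      P (∑ x ∈ s, MvPolynomial.monomial x (p.coeff x)) from
    h p.support fun x hx => hp x (mem_support_iff.mp hx)
  classical
  intro s
  induction s using Finset.induction_on with
  | empty => intro _; simpa using hz
  | insert a s ha ih =>
    intro hs
    rw [Finset.sum_insert ha]
    have h1 := hs a (Finset.mem_insert_self _ _)
    have h2 := fun x hx => hs x (Finset.mem_insert_of_mem hx)
    exact hadd _ _ (SuppIn.monomial h1 _) (SuppIn.sum _ _ fun x hx => SuppIn.monomial (h2 x hx) _)
      (hmon _ h1 _) (ih h2)

/-- The monoid algebra `R[N]` inside the polynomial ring. -/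
noncomputable def monAlg (R : Type*) [CommRing R] (N : AddSubmonoid (Fin r →₀ ℕ)) :
    Subalgebra R (MvPolynomial (Fin r) R) where
  carrier := {p | SuppIn (N : Set (Fin r →₀ ℕ)) p}
  mul_mem' hp hq := SuppIn.mul hp hq fun _ hx _ hy => N.add_mem hx hy
  add_mem' hp hq := SuppIn.add hp hq
  algebraMap_mem' a := by
    change SuppIn _ (C a)
    exact SuppIn.monomial N.zero_mem a

variable {N N' : AddSubmonoid (Fin r →₀ ℕ)}

theorem monAlg_mono (h : N ≤ N') : monAlg R N ≤ monAlg R N' := fun _ hp => SuppIn.mono hp h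

theorem monomial_mem_monAlg {x : Fin r →₀ ℕ} (hx : x ∈ N) (a : R) :
    monomial x a ∈ monAlg R N := SuppIn.monomial hx a

/-- A map of polynomial rings sending monomials of `N` into a submodule does so for `R[N]`. -/
theorem map_mem_of_mem_monAlg (A : Subalgebra R (MvPolynomial (Fin r) R))
    (f : MvPolynomial (Fin r) R →ₐ[R] MvPolynomial (Fin r) R)
    (h : ∀ x ∈ N, f (monomial x 1) ∈ A) {p : MvPolynomial (Fin r) R} (hp : p ∈ monAlg R N) :
    f p ∈ A := by
  refine SuppIn.induction (P := fun p => f p ∈ A) ?_ ?_ ?_ hp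
  · intro x hx a
    have : monomial x a = a • monomial x (1 : R) := by rw [smul_monomial, smul_eq_mul, mul_one]
    rw [this, map_smul]
    exact A.smul_mem (h x hx) a
  · rw [map_zero]; exact A.zero_mem
  · intro p q _ _ hp hq
    rw [map_add]; exact A.add_mem hp hq

/-- The elements of `N` not involving the coordinate `j`. -/
def faceMon (j : Fin r) (N : AddSubmonoid (Fin r →₀ ℕ)) : AddSubmonoid (Fin r →₀ ℕ) where
  carrier := {x | x ∈ N ∧ x j = 0}
  add_mem' hx hy := ⟨N.add_mem hx.1 hy.1, by simp [hx.2, hy.2]⟩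
  zero_mem' := ⟨N.zero_mem, rfl⟩

theorem faceMon_le (j : Fin r) (N : AddSubmonoid (Fin r →₀ ℕ)) : faceMon j N ≤ N := fun _ h => h.1

/-- The substitution `X_j ↦ l X_j`. -/
noncomputable def scaleVar (j : Fin r) (l : MvPolynomial (Fin r) R) :
    MvPolynomial (Fin r) R →ₐ[R] MvPolynomial (Fin r) R :=
  aeval fun i => if i = j then l * X j else X i

theorem scaleVar_monomial (j : Fin r) (l : MvPolynomial (Fin r) R) (x : Fin r →₀ ℕ) (a : R) :
    scaleVar j l (monomial x a) = l ^ x j * monomial x a := by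
  rw [scaleVar, aeval_monomial, MvPolynomial.monomial_eq (s := x), Finsupp.prod_fintype _ _ (by simp),
    Finsupp.prod_fintype _ _ (by simp), MvPolynomial.algebraMap_eq, mul_left_comm]
  congr 1
  have : ∀ i, (if i = j then l * X j else (X i : MvPolynomial (Fin r) R)) ^ x i =
      (if i = j then l ^ x j else 1) * X i ^ x i := by
    intro i
    split_ifs with h
    · subst h; rw [mul_pow]
    · rw [one_mul]
  rw [Finset.prod_congr rfl fun i _ => this i, Finset.prod_mul_distrib, Finset.prod_ite_eq']
  simp

theorem scaleVar_one (j : Fin r) : scaleVar j (1 : MvPolynomial (Fin r) R) = AlgHom.id R _ := by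
  apply MvPolynomial.algHom_ext
  intro i
  rw [scaleVar, aeval_X]
  split_ifs with h
  · subst h; simp
  · simp

theorem scaleVar_zero_comp (j : Fin r) (l : MvPolynomial (Fin r) R) (p : MvPolynomial (Fin r) R) :
    scaleVar j 0 (scaleVar j l p) = scaleVar j 0 p := by
  rw [← AlgHom.comp_apply]
  congr 1
  apply MvPolynomial.algHom_ext
  intro i
  rw [AlgHom.comp_apply, scaleVar, scaleVar, aeval_X, aeval_X]
  split_ifs with h
  · rw [map_mul, aeval_X]; simp
  · rw [aeval_X]; simp [h]

theorem scaleVar_of_mem_face (j : Fin r) (l : MvPolynomial (Fin r) R) {p : MvPolynomial (Fin r) R}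
    (hp : p ∈ monAlg R (faceMon j N)) : scaleVar j l p = p := by
  refine SuppIn.induction (P := fun p => scaleVar j l p = p) ?_ ?_ ?_ hp
  · intro x hx a
    rw [scaleVar_monomial, show x j = 0 from hx.2, pow_zero, one_mul]
  · exact map_zero _
  · intro p q _ _ hp hq
    rw [map_add, hp, hq]

theorem scaleVar_zero_mem_face (j : Fin r) {p : MvPolynomial (Fin r) R} (hp : p ∈ monAlg R N) :
    scaleVar j 0 p ∈ monAlg R (faceMon j N) := by
  refine map_mem_of_mem_monAlg _ _ (fun x hx => ?_) hp
  rw [scaleVar_monomial]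
  by_cases h : x j = 0
  · rw [h, pow_zero, one_mul]
    exact monomial_mem_monAlg (show x ∈ faceMon j N from ⟨hx, h⟩) _
  · rw [zero_pow h, zero_mul]; exact Subalgebra.zero_mem _

theorem scaleVar_mem (j : Fin r) {l p : MvPolynomial (Fin r) R} (hl : l ∈ monAlg R N)
    (hp : p ∈ monAlg R N) : scaleVar j l p ∈ monAlg R N := by
  refine map_mem_of_mem_monAlg _ _ (fun x hx => ?_) hp
  rw [scaleVar_monomial]
  exact Subalgebra.mul_mem _ (Subalgebra.pow_mem _ hl _) (monomial_mem_monAlg hx _)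

theorem exists_scaleVar_sub_scaleVar (j : Fin r) {l u p : MvPolynomial (Fin r) R}
    (hl : l ∈ monAlg R N) (hu : u ∈ monAlg R N) (hp : p ∈ monAlg R N) :
    ∃ z ∈ monAlg R N, scaleVar j 0 z = 0 ∧ scaleVar j l p - scaleVar j u p = (l - u) * z := by
  refine SuppIn.induction (P := fun p => ∃ z ∈ monAlg R N, scaleVar j 0 z = 0 ∧
    scaleVar j l p - scaleVar j u p = (l - u) * z) ?_ ?_ ?_ hp
  · intro x hx a
    refine ⟨(∑ i ∈ Finset.range (x j), l ^ i * u ^ (x j - 1 - i)) * monomial x a, ?_, ?_, ?_⟩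
    · refine Subalgebra.mul_mem _ (Subalgebra.sum_mem _ fun i _ => Subalgebra.mul_mem _
        (Subalgebra.pow_mem _ hl _) (Subalgebra.pow_mem _ hu _)) (monomial_mem_monAlg hx _)
    · rw [map_mul, scaleVar_monomial]
      by_cases h : x j = 0
      · rw [h]; simp
      · rw [zero_pow h]; simp
    · rw [scaleVar_monomial, scaleVar_monomial, ← sub_mul, ← mul_assoc, mul_comm (l - u),
        Commute.geom_sum₂_mul (Commute.all _ _)]
  · exact ⟨0, Subalgebra.zero_mem _, map_zero _, by simp⟩
  · rintro p q _ _ ⟨z, hz, hz0, hzp⟩ ⟨y, hy, hy0, hyp⟩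
    refine ⟨z + y, Subalgebra.add_mem _ hz hy, by rw [map_add, hz0, hy0, add_zero], ?_⟩
    rw [map_add, map_add, mul_add, ← hzp, ← hyp]; ring

/-- Exponents obtained from `x` by trading coordinates `i < j` for `w i` units of coordinate `j`. -/
def tradeSet (j : Fin r) (w : Fin r → ℕ) (x : Fin r →₀ ℕ) : Set (Fin r →₀ ℕ) :=
  {y | (∀ i, i < j → y i ≤ x i) ∧ (∀ i, j < i → y i = x i) ∧
    y j = x j + ∑ i ∈ Finset.Iio j, (x i - y i) * w i}

theorem tradeSet_add {j : Fin r} {w : Fin r → ℕ} {x x' y y' : Fin r →₀ ℕ}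
    (h : y ∈ tradeSet j w x) (h' : y' ∈ tradeSet j w x') : y + y' ∈ tradeSet j w (x + x') := by
  refine ⟨fun i hi => add_le_add (h.1 i hi) (h'.1 i hi), fun i hi => ?_, ?_⟩
  · simp [h.2.1 i hi, h'.2.1 i hi]
  · rw [Finsupp.add_apply, h.2.2, h'.2.2, Finsupp.add_apply, add_add_add_comm,
      ← Finset.sum_add_distrib]
    congr 1
    refine Finset.sum_congr rfl fun i hi => ?_
    have h1 := h.1 i (Finset.mem_Iio.mp hi)
    have h2 := h'.1 i (Finset.mem_Iio.mp hi)
    rw [← add_mul]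
    congr 1
    simp only [Finsupp.add_apply]
    omega

theorem self_mem_tradeSet (j : Fin r) (w : Fin r → ℕ) (x : Fin r →₀ ℕ) : x ∈ tradeSet j w x :=
  ⟨fun _ _ => le_rfl, fun _ _ => rfl, by simp⟩

theorem single_mem_tradeSet {j i : Fin r} (w : Fin r → ℕ) (hi : i < j) :
    Finsupp.single j (w i) ∈ tradeSet j w (Finsupp.single i 1) := by
  refine ⟨fun l hl => by simp [Finsupp.single_apply, hl.ne'], fun l hl => ?_, ?_⟩
  · simp [hl.ne, (hi.trans hl).ne]
  · rw [Finset.sum_eq_single i]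
    · simp [hi.ne, hi.ne']
    · intro b _ hb; simp [Finsupp.single_apply, hb.symm]
    · intro h; exact absurd (Finset.mem_Iio.mpr hi) h

/-- The substitution `X_i ↦ X_i + a X_j ^ (w i)` for `i < j`. -/
noncomputable def shear (j : Fin r) (w : Fin r → ℕ) (a : R) :
    MvPolynomial (Fin r) R →ₐ[R] MvPolynomial (Fin r) R :=
  aeval fun i => if i < j then X i + C a * X j ^ w i else X i

theorem shear_X_of_lt {j i : Fin r} (w : Fin r → ℕ) (a : R) (h : i < j) :
    shear j w a (X i) = X i + C a * X j ^ w i := by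
  rw [shear, aeval_X, if_pos h]

theorem shear_X_of_not_lt {j i : Fin r} (w : Fin r → ℕ) (a : R) (h : ¬ i < j) :
    shear j w a (X i) = X i := by
  rw [shear, aeval_X, if_neg h]

theorem shear_shear (j : Fin r) (w : Fin r → ℕ) {a b : R} (hab : a + b = 0)
    (p : MvPolynomial (Fin r) R) : shear j w a (shear j w b p) = p := by
  rw [← AlgHom.comp_apply]
  conv_rhs => rw [← AlgHom.id_apply (R := R) p]
  congr 1
  apply MvPolynomial.algHom_ext
  intro i
  rw [AlgHom.comp_apply, AlgHom.id_apply]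
  by_cases h : i < j
  · rw [shear_X_of_lt w b h, map_add, shear_X_of_lt w a h, map_mul, map_pow,
      shear_X_of_not_lt w a (lt_irrefl j), ← MvPolynomial.algebraMap_eq, AlgHom.commutes, add_assoc,
      ← add_mul, ← map_add, hab, map_zero, zero_mul, add_zero]
  · rw [shear_X_of_not_lt w b h, shear_X_of_not_lt w a h]

theorem scaleVar_zero_shear (j : Fin r) (w : Fin r → ℕ) (hw : ∀ i, i < j → 0 < w i) (a : R)
    (p : MvPolynomial (Fin r) R) : scaleVar j 0 (shear j w a p) = scaleVar j 0 p := by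
  rw [← AlgHom.comp_apply]
  congr 1
  apply MvPolynomial.algHom_ext
  intro i
  rw [AlgHom.comp_apply]
  by_cases h : i < j
  · rw [shear_X_of_lt w a h, map_add, map_mul, map_pow]
    have : scaleVar j 0 (X j : MvPolynomial (Fin r) R) = 0 := by rw [scaleVar, aeval_X]; simp
    rw [this, zero_pow (hw i h).ne', mul_zero, add_zero]
  · rw [shear_X_of_not_lt w a h]

theorem exp_induction {P : (Fin r →₀ ℕ) → Prop} (h0 : P 0) (h1 : ∀ i, P (Finsupp.single i 1))
    (hadd : ∀ x y, P x → P y → P (x + y)) (x : Fin r →₀ ℕ) : P x := by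
  refine Finsupp.induction_linear x h0 (fun _ _ => hadd _ _) fun i n => ?_
  induction n with
  | zero => simpa using h0
  | succ n ih => rw [Finsupp.single_add]; exact hadd _ _ ih (h1 i)

theorem suppIn_shear_monomial (j : Fin r) (w : Fin r → ℕ) (a : R) (x : Fin r →₀ ℕ) :
    SuppIn (tradeSet j w x) (shear j w a (monomial x 1)) := by
  refine exp_induction (P := fun x => SuppIn (tradeSet j w x) (shear j w a (monomial x 1)))
    ?_ ?_ ?_ x
  · rw [show (monomial (0 : Fin r →₀ ℕ) (1 : R)) = 1 from rfl, map_one]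
    exact SuppIn.monomial (self_mem_tradeSet _ _ _) _
  · intro i
    change SuppIn _ (shear j w a (X i))
    by_cases h : i < j
    · rw [shear_X_of_lt w a h, C_mul_X_pow_eq_monomial]
      exact (SuppIn.monomial (self_mem_tradeSet _ _ _) _).add
        (SuppIn.monomial (single_mem_tradeSet w h) _)
    · rw [shear_X_of_not_lt w a h]
      exact SuppIn.monomial (self_mem_tradeSet _ _ _) _
  · intro x y hx hy
    have : monomial (x + y) (1 : R) = monomial x 1 * monomial y 1 := by simp
    rw [this, map_mul]
    exact SuppIn.mul hx hy fun _ h _ h' => tradeSet_add h h'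

/-- `p` is `X_j ^ D` plus terms of smaller degree in `X_j`. -/
def VarMonic (j : Fin r) (D : ℕ) (p : MvPolynomial (Fin r) R) : Prop :=
  SuppIn {y | y j < D} (p - X j ^ D)

theorem VarMonic.suppIn {j : Fin r} {D : ℕ} {p : MvPolynomial (Fin r) R} (h : VarMonic j D p) :
    SuppIn {y | y j ≤ D} p := by
  have : p = (p - X j ^ D) + X j ^ D := by ring
  rw [this]
  refine SuppIn.add (h.mono fun y (hy : y j < D) => (hy.le : y j ≤ D)) ?_
  rw [X_pow_eq_monomial]
  exact SuppIn.monomial (by simp) _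

theorem VarMonic.mul {j : Fin r} {D E : ℕ} {p q : MvPolynomial (Fin r) R} (hp : VarMonic j D p)
    (hq : VarMonic j E q) : VarMonic j (D + E) (p * q) := by
  have : p * q - X j ^ (D + E) = (p - X j ^ D) * q + X j ^ D * (q - X j ^ E) := by ring
  rw [VarMonic, this]
  refine SuppIn.add (SuppIn.mul hp hq.suppIn ?_) (SuppIn.mul (T := {y | y j ≤ D}) ?_ hq ?_)
  · intro x (hx : x j < D) y (hy : y j ≤ E)
    exact add_lt_add_of_lt_of_le hx hy
  · rw [X_pow_eq_monomial]
    exact SuppIn.monomial (by simp) _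
  · intro x (hx : x j ≤ D) y (hy : y j < E)
    exact add_lt_add_of_le_of_lt hx hy

theorem VarMonic.add_lower {j : Fin r} {D : ℕ} {p q : MvPolynomial (Fin r) R} (hp : VarMonic j D p)
    (hq : SuppIn {y | y j < D} q) : VarMonic j D (p + q) := by
  rw [VarMonic, add_sub_right_comm]
  exact SuppIn.add hp hq

theorem varMonic_shear_monomial (j : Fin r) (w : Fin r → ℕ) (hw : ∀ i, i < j → 0 < w i)
    (hwj : w j = 1) (a : R) (ha : a = 1) (x : Fin r →₀ ℕ) (hx : ∀ i, j < i → x i = 0) :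
    VarMonic j (∑ i, w i * x i) (shear j w a (monomial x 1)) := by
  subst ha
  revert hx
  refine exp_induction (P := fun x => (∀ i, j < i → x i = 0) →
    VarMonic j (∑ i, w i * x i) (shear j w 1 (monomial x 1))) ?_ ?_ ?_ x
  · intro _
    rw [show (monomial (0 : Fin r →₀ ℕ) (1 : R)) = 1 from rfl, map_one]
    simp only [Finsupp.coe_zero, Pi.zero_apply, mul_zero, Finset.sum_const_zero]
    rw [VarMonic, pow_zero, sub_self]
    exact SuppIn.zero
  · intro i hi
    have hsum : ∑ l, w l * (Finsupp.single i 1 : Fin r →₀ ℕ) l = w i := by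
      rw [Finset.sum_eq_single i]
      · simp
      · intro b _ hb; simp [hb.symm]
      · simp
    rw [hsum]
    change VarMonic j (w i) (shear j w 1 (X i))
    rcases lt_trichotomy i j with h | rfl | h
    · rw [shear_X_of_lt w 1 h, VarMonic, C_1, one_mul, add_sub_cancel_right]
      refine SuppIn.monomial ?_ _
      simp [h.ne, hw i h]
    · rw [shear_X_of_not_lt w 1 (lt_irrefl i), hwj, VarMonic, pow_one, sub_self]
      exact SuppIn.zero
    · have := hi i h
      simp at this
  · intro x y hx hy hxy
    have h1 : monomial (x + y) (1 : R) = monomial x 1 * monomial y 1 := by simp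
    have h2 : ∑ i, w i * (x + y) i = (∑ i, w i * x i) + ∑ i, w i * y i := by
      rw [← Finset.sum_add_distrib]
      exact Finset.sum_congr rfl fun i _ => by rw [Finsupp.add_apply, mul_add]
    rw [h1, h2, map_mul]
    refine VarMonic.mul (hx fun i hi => ?_) (hy fun i hi => ?_)
    · have := hxy i hi; rw [Finsupp.add_apply] at this; omega
    · have := hxy i hi; rw [Finsupp.add_apply] at this; omega

/-- `N` is closed under trading coordinates below `j` for coordinate `j`. -/
def TradeAt (j : Fin r) (w : Fin r → ℕ) (N : AddSubmonoid (Fin r →₀ ℕ)) : Prop :=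
  ∀ x ∈ N, (∀ i, j < i → x i = 0) → tradeSet j w x ⊆ N

/-- The combinatorial consequences of membership in `C(Φ)` used in the proof. -/
structure GoodMon (c : ℕ) (N : AddSubmonoid (Fin r →₀ ℕ)) : Prop where
  pos : 0 < c
  single_mem : ∀ i, Finsupp.single i c ∈ N
  mem_of_add : ∀ x i, 0 < x i → x + Finsupp.single i c ∈ N → x ∈ N
  trade : ∀ j, ∃ w : Fin r → ℕ, (∀ i, i < j → 0 < w i) ∧ TradeAt j w N

/-- The elements of `N` supported on the first `m` coordinates. -/
def levelMon (N : AddSubmonoid (Fin r →₀ ℕ)) (m : ℕ) : AddSubmonoid (Fin r →₀ ℕ) where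
  carrier := {x | x ∈ N ∧ ∀ i : Fin r, m ≤ i.val → x i = 0}
  add_mem' hx hy := ⟨N.add_mem hx.1 hy.1, fun i hi => by simp [hx.2 i hi, hy.2 i hi]⟩
  zero_mem' := ⟨N.zero_mem, fun _ _ => rfl⟩

theorem mem_levelMon {m : ℕ} {x : Fin r →₀ ℕ} :
    x ∈ levelMon N m ↔ x ∈ N ∧ ∀ i : Fin r, m ≤ i.val → x i = 0 := Iff.rfl

theorem levelMon_eq_faceMon (j : Fin r) :
    levelMon N j.val = faceMon j (levelMon N (j.val + 1)) := by
  ext x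
  constructor
  · intro h
    exact ⟨⟨h.1, fun i hi => h.2 i (by omega)⟩, h.2 j le_rfl⟩
  · intro h
    refine ⟨h.1.1, fun i hi => ?_⟩
    rcases hi.eq_or_lt with h' | h'
    · rw [← Fin.ext h']; exact h.2
    · exact h.1.2 i h'

theorem levelMon_self : levelMon N r = N := by
  ext x
  exact ⟨fun h => h.1, fun h => ⟨h, fun i hi => absurd i.2 (by omega)⟩⟩

theorem TradeAt.add_mul {j : Fin r} {w : Fin r → ℕ} {c : ℕ} (h : TradeAt j w N)
    (hc : Finsupp.single j c ∈ N) (v : Fin r → ℕ) : TradeAt j (fun i => w i + c * v i) N := by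
  intro x hx hxj y hy
  let n := ∑ i ∈ Finset.Iio j, (x i - y i) * v i
  have hle : x j + ∑ i ∈ Finset.Iio j, (x i - y i) * w i + n * c = y j := by
    rw [hy.2.2, add_assoc, Finset.sum_mul, ← Finset.sum_add_distrib]
    congr 1
    exact Finset.sum_congr rfl fun i _ => by ring
  let z := y - Finsupp.single j (n * c)
  have hz : y = z + n • Finsupp.single j c := by
    rw [Finsupp.smul_single, smul_eq_mul, tsub_add_cancel_of_le]
    rw [Finsupp.single_le_iff]; omega
  have hzi : ∀ i, i ≠ j → z i = y i := fun i hi => by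
    simp [z, hi.symm]
  have hzj : z j = y j - n * c := by simp [z]
  rw [hz]
  refine N.add_mem (h x hx hxj ⟨fun i hi => ?_, fun i hi => ?_, ?_⟩) (N.nsmul_mem hc n)
  · rw [hzi i hi.ne]; exact hy.1 i hi
  · rw [hzi i hi.ne']; exact hy.2.1 i hi
  · rw [hzj, ← hle, Nat.add_sub_cancel]
    congr 1
    refine Finset.sum_congr rfl fun i hi => ?_
    rw [hzi i (Finset.mem_Iio.mp hi).ne]

theorem TradeAt.shear_mem {j : Fin r} {w : Fin r → ℕ} (h : TradeAt j w N) (a : R)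
    {p : MvPolynomial (Fin r) R} (hp : p ∈ monAlg R (levelMon N (j.val + 1))) :
    shear j w a p ∈ monAlg R (levelMon N (j.val + 1)) := by
  refine map_mem_of_mem_monAlg _ _ (fun x hx => ?_) hp
  refine (suppIn_shear_monomial j w a x).mono fun y hy => ?_
  have hx0 : ∀ i, j < i → x i = 0 := fun i hi => hx.2 i hi
  exact ⟨h x hx.1 hx0 hy, fun i hi => by rw [hy.2.1 i hi]; exact hx0 i hi⟩

/-- The polynomial ring on the first `m` variables mapped to `c`-th powers of the variables. -/
noncomputable def powVar (R : Type*) [CommRing R] (c : ℕ) {m : ℕ} (hm : m ≤ r) :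
    MvPolynomial (Fin m) R →ₐ[R] MvPolynomial (Fin r) R :=
  (expand c).comp (rename (Fin.castLE hm))

theorem powVar_monomial (c : ℕ) {m : ℕ} (hm : m ≤ r) (x : Fin m →₀ ℕ) (a : R) :
    powVar R c hm (monomial x a) = monomial (c • x.mapDomain (Fin.castLE hm)) a := by
  rw [powVar, AlgHom.comp_apply, rename_monomial, expand_monomial]

theorem nsmul_mem_levelMon {c m : ℕ} (hN : ∀ i, Finsupp.single i c ∈ N) {x : Fin r →₀ ℕ}
    (hx : ∀ i : Fin r, m ≤ i.val → x i = 0) : c • x ∈ levelMon N m := by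
  refine ⟨?_, fun i hi => by simp [hx i hi]⟩
  have : ∀ y : Fin r →₀ ℕ, c • y ∈ N := fun y => by
    refine exp_induction (P := fun y => c • y ∈ N) (by simp) (fun i => ?_) (fun x y hx hy => ?_) y
    · rw [Finsupp.smul_single, smul_eq_mul, mul_one]; exact hN i
    · rw [smul_add]; exact N.add_mem hx hy
  exact this x

theorem mapDomain_castLE_eq_zero {m : ℕ} (hm : m ≤ r) (x : Fin m →₀ ℕ) (i : Fin r)
    (hi : m ≤ i.val) : x.mapDomain (Fin.castLE hm) i = 0 := by
  apply Finsupp.mapDomain_of_notMem_range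
  rintro ⟨l, rfl⟩
  have := l.2
  simp only [Fin.val_castLE] at hi
  omega

theorem powVar_mem {c : ℕ} (hN : ∀ i, Finsupp.single i c ∈ N) {m : ℕ} (hm : m ≤ r)
    (p : MvPolynomial (Fin m) R) : powVar R c hm p ∈ monAlg R (levelMon N m) := by
  induction p using MvPolynomial.induction_on' with
  | monomial x a =>
    rw [powVar_monomial]
    exact monomial_mem_monAlg (nsmul_mem_levelMon hN (mapDomain_castLE_eq_zero hm x)) _
  | add p q hp hq => rw [map_add]; exact Subalgebra.add_mem _ hp hq

/-- Coordinates in `J` can be reduced modulo `c` inside `N`. -/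
theorem exists_reduce {c : ℕ} (hc : 0 < c) {J : Set (Fin r)}
    (hN : ∀ x, ∀ i ∈ J, 0 < x i → x + Finsupp.single i c ∈ N → x ∈ N) :
    ∀ x ∈ N, ∃ z ∈ N, ∃ k : Fin r →₀ ℕ, (∀ i ∈ J, z i ≤ c) ∧ (∀ i, i ∉ J → k i = 0) ∧
      x = z + c • k := by
  intro x
  induction hn : ∑ i, x i using Nat.strong_induction_on generalizing x with
  | _ n ih =>
    intro hx
    by_cases h : ∀ i ∈ J, x i ≤ c
    · exact ⟨x, hx, 0, h, fun _ _ => rfl, by simp⟩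
    push Not at h
    obtain ⟨i, hi, hci⟩ := h
    have hle : Finsupp.single i c ≤ x := by rw [Finsupp.single_le_iff]; exact hci.le
    have hxe : x - Finsupp.single i c + Finsupp.single i c = x := tsub_add_cancel_of_le hle
    have hmem : x - Finsupp.single i c ∈ N := by
      apply hN _ i hi
      · simp; omega
      · rwa [hxe]
    have hlt : ∑ l, (x - Finsupp.single i c) l < n := by
      rw [← hn]
      conv_rhs => rw [← hxe]
      simp only [Finsupp.add_apply, Finset.sum_add_distrib]
      have : ∑ l, (Finsupp.single i c : Fin r →₀ ℕ) l = c := by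
        rw [Finset.sum_eq_single i] <;> simp +contextual [eq_comm]
      omega
    obtain ⟨z, hz, k, h1, h2, h3⟩ := ih _ hlt _ rfl hmem
    refine ⟨z, hz, k + Finsupp.single i 1, h1, fun l hl => ?_, ?_⟩
    · have : i ≠ l := by rintro rfl; exact hl hi
      simp [h2 l hl, this]
    · rw [smul_add, Finsupp.smul_single, smul_eq_mul, mul_one, ← add_assoc, ← h3, hxe]

theorem finite_setOf_le (b : Fin r → ℕ) : {x : Fin r →₀ ℕ | ∀ i, x i ≤ b i}.Finite := by
  have : {x : Fin r →₀ ℕ | ∀ i, x i ≤ b i} = Set.Iic (Finsupp.equivFunOnFinite.symm b) := by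
    ext x; rfl
  rw [this]
  exact Set.finite_Iic _

theorem GoodMon.mem_of_add_level {c : ℕ} (hN : GoodMon c N) {m : ℕ} (x : Fin r →₀ ℕ) (i : Fin r)
    (hx : 0 < x i) (h : x + Finsupp.single i c ∈ levelMon N m) : x ∈ levelMon N m := by
  refine ⟨hN.mem_of_add x i hx h.1, fun l hl => ?_⟩
  have := h.2 l hl
  rw [Finsupp.add_apply] at this
  omega

/-- `powVar` with values in the monoid algebra. -/
noncomputable def powVarAlg (R : Type*) [CommRing R] {c : ℕ} (hN : ∀ i, Finsupp.single i c ∈ N)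
    {m : ℕ} (hm : m ≤ r) : MvPolynomial (Fin m) R →ₐ[R] monAlg R (levelMon N m) :=
  (powVar R c hm).codRestrict _ (powVar_mem hN hm)

theorem GoodMon.finite_powVarAlg {c : ℕ} (hN : GoodMon c N) {m : ℕ} (hm : m ≤ r) :
    (powVarAlg R hN.single_mem hm).toRingHom.Finite := by
  let _ := (powVarAlg R hN.single_mem hm).toRingHom.toAlgebra
  change Module.Finite _ _
  let Z : Set (Fin r →₀ ℕ) := {x | x ∈ levelMon N m ∧ ∀ i, x i ≤ c}
  have hZ : Z.Finite := (finite_setOf_le fun _ => c).subset fun x hx => hx.2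
  let g : Z → monAlg R (levelMon N m) := fun z => ⟨monomial z.1 1, monomial_mem_monAlg z.2.1 1⟩
  have := hZ.to_subtype
  refine ⟨(Submodule.fg_def).mpr ⟨Set.range g, Set.finite_range g, ?_⟩⟩
  rw [eq_top_iff]
  rintro ⟨p, hp⟩ -
  refine SuppIn.induction (P := fun p => ∀ hp : p ∈ monAlg R (levelMon N m),
    (⟨p, hp⟩ : monAlg R (levelMon N m)) ∈ Submodule.span (MvPolynomial (Fin m) R) (Set.range g))
    ?_ ?_ ?_ hp hp
  · intro x hx a hp
    obtain ⟨z, hz, k, h1, -, h3⟩ := exists_reduce hN.pos (J := Set.univ)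
      (fun x i _ => hN.mem_of_add_level (m := m) x i) x hx
    have hk0 : ∀ i : Fin r, m ≤ i.val → k i = 0 := fun i hi => by
      have h4 := hx.2 i hi
      rw [h3] at h4
      simp only [Finsupp.add_apply, Finsupp.smul_apply, smul_eq_mul, Nat.add_eq_zero_iff,
        mul_eq_zero] at h4
      have := hN.pos
      omega
    let k' : Fin m →₀ ℕ := Finsupp.equivFunOnFinite.symm fun i => k (Fin.castLE hm i)
    have hk' : k'.mapDomain (Fin.castLE hm) = k := by
      ext i
      by_cases hi : i.val < m
      · have : i = Fin.castLE hm ⟨i.val, hi⟩ := rfl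
        rw [this, Finsupp.mapDomain_apply (Fin.castLE_injective hm)]
        rfl
      · rw [mapDomain_castLE_eq_zero hm _ _ (by omega), hk0 i (by omega)]
    have : (⟨monomial x a, hp⟩ : monAlg R (levelMon N m)) =
        (monomial k' a : MvPolynomial (Fin m) R) • g ⟨z, hz, fun i => h1 i trivial⟩ := by
      rw [Algebra.smul_def]
      apply Subtype.ext
      change monomial x a = powVar R c hm (monomial k' a) * monomial z 1
      rw [powVar_monomial, hk', monomial_mul, mul_one, add_comm, ← h3]
    rw [this]
    exact Submodule.smul_mem _ _ (Submodule.subset_span ⟨_, rfl⟩)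
  · intro hp; exact Submodule.zero_mem _
  · intro p q hp hq ihp ihq _
    exact Submodule.add_mem _ (ihp hp) (ihq hq)

theorem GoodMon.isNoetherianRing [IsNoetherianRing R] {c : ℕ} (hN : GoodMon c N) {m : ℕ}
    (hm : m ≤ r) : IsNoetherianRing (monAlg R (levelMon N m)) := by
  have h := hN.finite_powVarAlg (R := R) hm
  let _ := (powVarAlg R hN.single_mem hm).toRingHom.toAlgebra
  have : Module.Finite (MvPolynomial (Fin m) R) (monAlg R (levelMon N m)) := h
  exact IsNoetherianRing.of_finite (MvPolynomial (Fin m) R) _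

/-- An ideal of large height contains a lexicographically monic element. -/
theorem GoodMon.exists_lexMonic_mem [IsNoetherianRing R] {c : ℕ} (hN : GoodMon c N) {m : ℕ}
    (hm : m ≤ r) {D : ℕ} (hD : ringKrullDim R < D) (I : Ideal (monAlg R (levelMon N m)))
    (hI : ∀ 𝔮 : Ideal (monAlg R (levelMon N m)), 𝔮.IsPrime → I ≤ 𝔮 → (D : ℕ∞) ≤ 𝔮.height) :
    ∃ F, LexMonic F ∧ powVarAlg R hN.single_mem hm F ∈ I := by
  by_contra! hcon
  let f := (powVarAlg R hN.single_mem hm).toRingHom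
  let S := (lexMonicSubmonoid R m).map f
  obtain ⟨p, hp, hIp, hd⟩ := Ideal.exists_le_prime_disjoint I S
    (Set.disjoint_left.mpr (by rintro _ hx ⟨F, hF, rfl⟩; exact hcon F hF hx))
  have h1 := hI p hp hIp
  have h2 := Ideal.height_le_height_comap_of_isIntegral f
    (hN.finite_powVarAlg (R := R) hm).to_isIntegral p
  obtain ⟨F, hF, hFl⟩ := exists_lexMonic_mem_of_le_height hD (p.comap f)
    (Ideal.comap_isPrime _ _) (h1.trans h2)
  exact Set.disjoint_left.mp hd hF ⟨F, hFl, rfl⟩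

theorem GoodMon.exists_varMonic_shear {c : ℕ} (hN : GoodMon c N) (j : Fin r)
    {F : MvPolynomial (Fin (j.val + 1)) R} (hF : LexMonic F) :
    ∃ (w : Fin r → ℕ) (n : ℕ), (∀ i, i < j → 0 < w i) ∧ TradeAt j w N ∧
      VarMonic j (c * n) (shear j w 1 (powVar R c j.2 F)) := by
  obtain ⟨w₀, hw₀, htr⟩ := hN.trade j
  have hc := hN.pos
  let S : Fin (j.val + 1) → Set ℕ := fun i =>
    if i.val < j.val then {s | ∃ v, s = w₀ (Fin.castLE j.2 i) + c * v} else {1}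
  obtain ⟨w, hw, x, hx1, hx⟩ := LexMonic.exists_weight S (by
    intro i b hb
    by_cases hi : i.val < j.val
    · refine ⟨w₀ (Fin.castLE j.2 i) + c * (b + 1), ?_, ?_⟩
      · simp only [S, if_pos hi]; exact ⟨_, rfl⟩
      · nlinarith
    · refine ⟨1, by simp [S, if_neg hi], ?_⟩
      rcases hb with hb | hb <;> omega) hF
  choose v hv using fun (i : Fin (j.val + 1)) (hi : i.val < j.val) =>
    (show ∃ v, w i = w₀ (Fin.castLE j.2 i) + c * v by
      have := hw i
      simp only [S, if_pos hi, Set.mem_ofPred_eq] at this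
      exact this)
  let W : Fin r → ℕ := fun i => if h : i.val < j.val + 1 then w ⟨i.val, h⟩ else 0
  have hWj : W j = 1 := by
    simp only [W, dif_pos (Nat.lt_succ_self j.val)]
    have := hw ⟨j.val, Nat.lt_succ_self j.val⟩
    simpa [S] using this
  have hWlt : ∀ i, i < j → ∃ v, W i = w₀ i + c * v := by
    intro i hi
    have hi' : i.val < j.val + 1 := by have : i.val < j.val := hi; omega
    refine ⟨v ⟨i.val, hi'⟩ hi, ?_⟩
    simp only [W, dif_pos hi']
    exact hv ⟨i.val, hi'⟩ hi
  choose! V hV using hWlt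
  have hpos : ∀ i, i < j → 0 < W i := fun i hi => by rw [hV i hi]; have := hw₀ i hi; omega
  have hWt : TradeAt j W N := by
    intro y hy hyj z hz
    refine TradeAt.add_mul htr (hN.single_mem j) V y hy hyj ⟨hz.1, hz.2.1, ?_⟩
    rw [hz.2.2]
    congr 1
    exact Finset.sum_congr rfl fun i hi => by rw [hV i (Finset.mem_Iio.mp hi)]
  have hwt : ∀ y : Fin (j.val + 1) →₀ ℕ,
      ∑ i, W i * (c • y.mapDomain (Fin.castLE j.2)) i = c * ∑ i, w i * y i := by
    intro y
    rw [Finset.mul_sum]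
    symm
    refine Finset.sum_of_injOn (Fin.castLE j.2) (Fin.castLE_injective _).injOn (by simp) ?_ ?_
    · intro i _ hi
      rw [Finsupp.smul_apply, Finsupp.mapDomain_of_notMem_range]
      · simp
      · simpa using hi
    · intro i _
      rw [Finsupp.smul_apply, Finsupp.mapDomain_apply (Fin.castLE_injective _)]
      have : W (Fin.castLE j.2 i) = w i := by
        simp only [W]
        rw [dif_pos (show (Fin.castLE j.2 i).val < j.val + 1 from i.2)]
        rfl
      rw [this, smul_eq_mul]; ring
  have hmon : ∀ y : Fin (j.val + 1) →₀ ℕ, VarMonic j (c * ∑ i, w i * y i)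
      (shear j W 1 (monomial (c • y.mapDomain (Fin.castLE j.2)) (1 : R))) := by
    intro y
    rw [← hwt]
    refine varMonic_shear_monomial j W hpos hWj 1 rfl _ fun i hi => ?_
    rw [Finsupp.smul_apply, mapDomain_castLE_eq_zero j.2 _ _ hi, smul_zero]
  refine ⟨W, ∑ i, w i * x i, hpos, hWt, ?_⟩
  classical
  have hdec : F = monomial x 1 + ∑ y ∈ F.support.erase x, monomial y (F.coeff y) := by
    conv_lhs => rw [F.as_sum]
    by_cases hxs : x ∈ F.support
    · rw [← Finset.add_sum_erase _ _ hxs, hx1]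
    · have h0 : (1 : R) = 0 := by rw [← hx1]; simpa using hxs
      rw [Finset.erase_eq_of_notMem hxs, h0, monomial_zero, zero_add]
  rw [hdec, map_add, map_add, powVar_monomial, map_sum, map_sum]
  refine (hmon x).add_lower (SuppIn.sum _ _ fun y hy => ?_)
  rw [Finset.mem_erase] at hy
  have hlt := hx y hy.2 hy.1
  have : monomial y (F.coeff y) = F.coeff y • monomial y (1 : R) := by
    rw [smul_monomial, smul_eq_mul, mul_one]
  rw [this, map_smul, map_smul, powVar_monomial, smul_eq_C_mul]
  refine SuppIn.mul (T := {y | y j ≤ 0}) (SuppIn.monomial (by simp) _) (hmon y).suppIn ?_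
  intro a (ha : a j ≤ 0) b (hb : b j ≤ _)
  have := Nat.mul_lt_mul_of_pos_left hlt hc
  change a j + b j < _
  omega

end MonAlg

section Horrocks

/-- The data on an algebra `A` over a local ring `B` needed for a monic inversion theorem:
`A` is spanned by monomials graded by a degree, `u` plays the role of the variable, and `A` maps
onto a polynomial ring over the residue field with kernel nilpotent modulo the maximal ideal. -/
structure HorrocksDatum (B A Y : Type*) [CommRing B] [IsLocalRing B] [CommRing A] [Algebra B A]
    [AddCommMonoid Y] where
  mon : Y → A
  deg : Y →+ ℕ
  wt : Y →+ ℕ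
  u : A
  step : ℕ
  bound : ℕ
  eps : A →+* Polynomial (IsLocalRing.ResidueField B)
  mon_zero : mon 0 = 1
  mon_add : ∀ y z, mon (y + z) = mon y * mon z
  step_pos : 0 < step
  span_mon : Submodule.span B (Set.range mon) = ⊤
  exists_step : ∀ y, step ≤ deg y → ∃ z, deg z + step = deg y ∧ wt z = wt y ∧ mon y = u * mon z
  u_eq : ∃ (b : B) (y : Y), deg y = step ∧ u = b • mon y
  mem_of_bound : ∀ y, bound ≤ wt y →
    mon y ∈ (IsLocalRing.maximalIdeal B).map (algebraMap B A)
  low : ∀ y, wt y = 0 → deg y < step → ∃ b, mon y = algebraMap B A b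
  fg_low : ∀ n, (Submodule.span B (mon '' {y | deg y < n})).FG
  eps_algebraMap : ∀ b, eps (algebraMap B A b) = Polynomial.C (IsLocalRing.residue B b)
  eps_u : eps u = Polynomial.X
  eps_mon : ∀ y, wt y ≠ 0 → eps (mon y) = 0

namespace HorrocksDatum

variable {B A Y : Type*} [CommRing B] [IsLocalRing B] [CommRing A] [Algebra B A]
  [AddCommMonoid Y] (H : HorrocksDatum B A Y)

/-- The span of the monomials of degree less than `n`. -/
def lowSub (n : ℕ) : Submodule B A := Submodule.span B (H.mon '' {y | H.deg y < n})

/-- `f` is `u ^ D` plus terms of smaller degree. -/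
def IsMon (D : ℕ) (f : A) : Prop := f - H.u ^ D ∈ H.lowSub (D * H.step)

theorem mon_mem_lowSub {y : Y} {n : ℕ} (h : H.deg y < n) : H.mon y ∈ H.lowSub n :=
  Submodule.subset_span ⟨y, h, rfl⟩

theorem lowSub_mono {m n : ℕ} (h : m ≤ n) : H.lowSub m ≤ H.lowSub n :=
  Submodule.span_mono (Set.image_mono fun _ (hy : _ < _) => hy.trans_le h)

theorem mul_mem_lowSub {a b : ℕ} {p q : A} (hp : p ∈ H.lowSub a) (hq : q ∈ H.lowSub (b + 1)) :
    p * q ∈ H.lowSub (a + b) := by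
  have : H.lowSub a * H.lowSub (b + 1) ≤ H.lowSub (a + b) := by
    rw [lowSub, lowSub, Submodule.span_mul_span, Submodule.span_le]
    rintro _ ⟨_, ⟨y, hy, rfl⟩, _, ⟨z, hz, rfl⟩, rfl⟩
    change H.mon y * H.mon z ∈ _
    rw [← H.mon_add]
    refine H.mon_mem_lowSub ?_
    rw [map_add]
    simp only [Set.mem_ofPred_eq] at hy hz
    omega
  exact this (Submodule.mul_mem_mul hp hq)

theorem one_mem_lowSub : (1 : A) ∈ H.lowSub 1 := by
  rw [← H.mon_zero]; exact H.mon_mem_lowSub (by simp)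

theorem u_mem_lowSub : H.u ∈ H.lowSub (H.step + 1) := by
  obtain ⟨b, y, hy, hu⟩ := H.u_eq
  rw [hu]
  exact Submodule.smul_mem _ _ (H.mon_mem_lowSub (by omega))

theorem u_pow_mem_lowSub (q : ℕ) : H.u ^ q ∈ H.lowSub (q * H.step + 1) := by
  induction q with
  | zero => simpa using H.one_mem_lowSub
  | succ q ih =>
    rw [pow_succ]
    exact H.lowSub_mono (by rw [Nat.succ_mul]; omega) (H.mul_mem_lowSub ih H.u_mem_lowSub)

theorem IsMon.mem_lowSub {H : HorrocksDatum B A Y} {D : ℕ} {f : A} (h : H.IsMon D f) :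
    f ∈ H.lowSub (D * H.step + 1) := by
  have := Submodule.add_mem _ (H.lowSub_mono (Nat.le_succ _) h) (H.u_pow_mem_lowSub D)
  rwa [sub_add_cancel] at this

theorem IsMon.mul {H : HorrocksDatum B A Y} {D E : ℕ} {f g : A} (hf : H.IsMon D f)
    (hg : H.IsMon E g) : H.IsMon (D + E) (f * g) := by
  have : f * g - H.u ^ (D + E) = (f - H.u ^ D) * g + (g - H.u ^ E) * H.u ^ D := by ring
  rw [IsMon, this, add_mul D]
  refine Submodule.add_mem _ (H.mul_mem_lowSub hf hg.mem_lowSub) ?_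
  rw [add_comm]
  exact H.mul_mem_lowSub hg (H.u_pow_mem_lowSub D)

theorem isMon_aeval {P : Polynomial B} (hP : P.Monic) :
    H.IsMon P.natDegree (Polynomial.aeval H.u P) := by
  have h0 : Polynomial.aeval H.u P = Polynomial.aeval H.u (Polynomial.X ^ P.natDegree +
      ∑ i ∈ Finset.range P.natDegree, Polynomial.C (P.coeff i) * Polynomial.X ^ i) := by
    rw [← hP.as_sum]
  rw [IsMon, h0, map_add, map_pow, Polynomial.aeval_X, add_sub_cancel_left, map_sum]
  refine Submodule.sum_mem _ fun i hi => ?_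
  rw [map_mul, Polynomial.aeval_C, map_pow, Polynomial.aeval_X, ← Algebra.smul_def]
  refine Submodule.smul_mem _ _ (H.lowSub_mono ?_ (H.u_pow_mem_lowSub i))
  have h1 : i + 1 ≤ P.natDegree := Finset.mem_range.mp hi
  have h2 := H.step_pos
  nlinarith

theorem exists_pow_mul (y : Y) : ∃ (q : ℕ) (z : Y), H.deg z < H.step ∧
    H.deg z + q * H.step = H.deg y ∧ H.wt z = H.wt y ∧ H.mon y = H.u ^ q * H.mon z := by
  induction hn : H.deg y using Nat.strong_induction_on generalizing y with
  | _ n ih =>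
    by_cases h : H.deg y < H.step
    · exact ⟨0, y, h, by omega, rfl, by simp⟩
    · obtain ⟨z, hz, hw, hm⟩ := H.exists_step y (not_lt.mp h)
      have hp := H.step_pos
      obtain ⟨q, x, h1, h2, h3, h4⟩ := ih (H.deg z) (by omega) z rfl
      refine ⟨q + 1, x, h1, by rw [Nat.succ_mul]; omega, h3.trans hw, ?_⟩
      rw [hm, h4, pow_succ]; ring

theorem exists_pow_mul_of_le (y : Y) (n : ℕ) (h : n * H.step ≤ H.deg y) : ∃ z : Y,
    H.deg z + n * H.step = H.deg y ∧ H.wt z = H.wt y ∧ H.mon y = H.u ^ n * H.mon z := by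
  induction n generalizing y with
  | zero => exact ⟨y, by simp, rfl, by simp⟩
  | succ n ih =>
    rw [Nat.succ_mul] at h
    obtain ⟨z, hz, hw, hm⟩ := H.exists_step y (by omega)
    obtain ⟨x, h2, h3, h4⟩ := ih z (by omega)
    refine ⟨x, by rw [Nat.succ_mul]; omega, h3.trans hw, ?_⟩
    rw [hm, h4, pow_succ]; ring

/-- Division with remainder by a monic element. -/
theorem exists_div {D : ℕ} {f : A} (hf : H.IsMon D f) (a : A) :
    ∃ c, ∃ l ∈ H.lowSub (D * H.step), a = f * c + l := by
  let T : Submodule B A := (LinearMap.range (LinearMap.mulLeft B f)) ⊔ H.lowSub (D * H.step)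
  have hlow : ∀ n, H.lowSub n ≤ T := by
    intro n
    induction n with
    | zero =>
      rw [lowSub, Submodule.span_le]
      rintro _ ⟨y, hy, rfl⟩
      exact absurd hy (Nat.not_lt_zero _)
    | succ n ih =>
      rw [lowSub, Submodule.span_le]
      rintro _ ⟨y, hy, rfl⟩
      have hy : H.deg y < n + 1 := hy
      by_cases h : H.deg y < D * H.step
      · exact Submodule.mem_sup_right (H.mon_mem_lowSub h)
      obtain ⟨z, h1, h2, h3⟩ := H.exists_pow_mul_of_le y D (not_lt.mp h)
      have : H.mon y = f * H.mon z - (f - H.u ^ D) * H.mon z := by rw [h3]; ring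
      rw [this]
      refine Submodule.sub_mem _ (Submodule.mem_sup_left ⟨_, rfl⟩) (ih ?_)
      exact H.lowSub_mono (by omega) (H.mul_mem_lowSub hf (H.mon_mem_lowSub (Nat.lt_succ_self _)))
  have : a ∈ T := by
    have ha : a ∈ Submodule.span B (Set.range H.mon) := by rw [H.span_mon]; trivial
    refine (Submodule.span_le.mpr ?_ : _ ≤ T) ha
    rintro _ ⟨y, rfl⟩
    exact hlow _ (H.mon_mem_lowSub (Nat.lt_succ_self _))
  obtain ⟨_, ⟨c, rfl⟩, l, hl, h⟩ := Submodule.mem_sup.mp this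
  exact ⟨c, l, hl, h.symm⟩

/-- The span of the monomials of positive weight. -/
def posSub : Submodule B A := Submodule.span B (H.mon '' {y | H.wt y ≠ 0})

theorem exists_aeval_add (a : A) : ∃ (P : Polynomial B), a - Polynomial.aeval H.u P ∈ H.posSub := by
  have ha : a ∈ Submodule.span B (Set.range H.mon) := by rw [H.span_mon]; trivial
  induction ha using Submodule.span_induction with
  | mem x hx =>
    obtain ⟨y, rfl⟩ := hx
    by_cases hy : H.wt y = 0
    · obtain ⟨q, z, h1, -, h3, h4⟩ := H.exists_pow_mul y
      obtain ⟨b, hb⟩ := H.low z (h3.trans hy) h1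
      refine ⟨Polynomial.X ^ q * Polynomial.C b, ?_⟩
      rw [h4, hb, map_mul, map_pow, Polynomial.aeval_X, Polynomial.aeval_C, sub_self]
      exact Submodule.zero_mem _
    · refine ⟨0, ?_⟩
      rw [map_zero, sub_zero]
      exact Submodule.subset_span ⟨y, hy, rfl⟩
  | zero => exact ⟨0, by simp⟩
  | add x y _ _ hx hy =>
    obtain ⟨P, hP⟩ := hx
    obtain ⟨Q, hQ⟩ := hy
    refine ⟨P + Q, ?_⟩
    rw [map_add, add_sub_add_comm]
    exact Submodule.add_mem _ hP hQ
  | smul b x _ hx =>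
    obtain ⟨P, hP⟩ := hx
    refine ⟨b • P, ?_⟩
    rw [map_smul, ← smul_sub]
    exact Submodule.smul_mem _ _ hP

theorem eps_smul (b : B) (a : A) :
    H.eps (b • a) = Polynomial.C (IsLocalRing.residue B b) * H.eps a := by
  rw [Algebra.smul_def, map_mul, H.eps_algebraMap]

theorem eps_aeval (P : Polynomial B) :
    H.eps (Polynomial.aeval H.u P) = P.map (IsLocalRing.residue B) := by
  induction P using Polynomial.induction_on' with
  | add p q hp hq => rw [map_add, map_add, hp, hq, Polynomial.map_add]
  | monomial n b =>
    rw [Polynomial.aeval_monomial, map_mul, H.eps_algebraMap, map_pow, H.eps_u,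
      Polynomial.map_monomial, Polynomial.C_mul_X_pow_eq_monomial]

theorem eps_posSub {a : A} (ha : a ∈ H.posSub) : H.eps a = 0 := by
  induction ha using Submodule.span_induction with
  | mem x hx => obtain ⟨y, hy, rfl⟩ := hx; exact H.eps_mon y hy
  | zero => exact map_zero _
  | add x y _ _ hx hy => rw [map_add, hx, hy, add_zero]
  | smul b x _ hx => rw [H.eps_smul, hx, mul_zero]

theorem eps_surjective (Q : Polynomial (IsLocalRing.ResidueField B)) : ∃ a, H.eps a = Q := by
  obtain ⟨P, hP⟩ := Polynomial.map_surjective _ (IsLocalRing.residue_surjective (R := B)) Q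
  exact ⟨_, (H.eps_aeval P).trans hP⟩

theorem mem_of_eps_eq_zero {a : A} (ha : H.eps a = 0) :
    ∃ b ∈ (IsLocalRing.maximalIdeal B).map (algebraMap B A), ∃ c ∈ H.posSub, a = b + c := by
  obtain ⟨P, hP⟩ := H.exists_aeval_add a
  have h1 := H.eps_posSub hP
  rw [map_sub, ha, zero_sub, neg_eq_zero, H.eps_aeval] at h1
  refine ⟨Polynomial.aeval H.u P, ?_, _, hP, by ring⟩
  rw [Polynomial.aeval_eq_sum_range]
  refine Ideal.sum_mem _ fun i _ => ?_
  rw [Algebra.smul_def]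
  refine Ideal.mul_mem_right _ _ (Ideal.mem_map_of_mem _ ?_)
  rw [← IsLocalRing.residue_eq_zero_iff, ← Polynomial.coeff_map, h1, Polynomial.coeff_zero]

theorem eps_lowSub {n : ℕ} {a : A} (ha : a ∈ H.lowSub (n * H.step)) : (H.eps a).degree < n := by
  induction ha using Submodule.span_induction with
  | mem x hx =>
    obtain ⟨y, hy, rfl⟩ := hx
    by_cases hw : H.wt y = 0
    · obtain ⟨q, z, h1, h2, h3, h4⟩ := H.exists_pow_mul y
      obtain ⟨b, hb⟩ := H.low z (h3.trans hw) h1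
      rw [h4, hb, map_mul, map_pow, H.eps_u, H.eps_algebraMap, mul_comm]
      refine (Polynomial.degree_C_mul_X_pow_le _ _).trans_lt ?_
      have hy : H.deg y < n * H.step := hy
      have : q < n := by
        by_contra hq
        have := Nat.mul_le_mul_right H.step (not_lt.mp hq)
        omega
      exact_mod_cast this
    · rw [H.eps_mon y hw, Polynomial.degree_zero]; exact WithBot.bot_lt_coe n
  | zero => rw [map_zero, Polynomial.degree_zero]; exact WithBot.bot_lt_coe n
  | add x y _ _ hx hy =>
    rw [map_add]
    exact (Polynomial.degree_add_le _ _).trans_lt (max_lt hx hy)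
  | smul b x _ hx =>
    rw [H.eps_smul]
    refine lt_of_le_of_lt ?_ hx
    exact (Polynomial.degree_mul_le _ _).trans
      (by simpa using add_le_add_left (Polynomial.degree_C_le) (H.eps x).degree)

theorem IsMon.eps {H : HorrocksDatum B A Y} {D : ℕ} {f : A} (hf : H.IsMon D f) :
    (H.eps f).Monic ∧ (H.eps f).natDegree = D := by
  have h1 := H.eps_lowSub hf
  have h2 : H.eps f = Polynomial.X ^ D + H.eps (f - H.u ^ D) := by
    rw [map_sub, map_pow, H.eps_u]; ring
  rw [h2]
  refine ⟨Polynomial.monic_X_pow_add h1, ?_⟩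
  rw [Polynomial.natDegree_add_eq_left_of_degree_lt (by rwa [Polynomial.degree_X_pow]),
    Polynomial.natDegree_X_pow]

theorem exists_div_of_eps_eq_zero {D : ℕ} {f : A} (hf : H.IsMon D f) {a : A} (ha : H.eps a = 0) :
    ∃ c, H.eps c = 0 ∧ ∃ l ∈ H.lowSub ((D + 1) * H.step), a = f * c + l := by
  have hpos := H.step_pos
  let T : Submodule B A := {
    carrier := {a | ∃ c, H.eps c = 0 ∧ ∃ l ∈ H.lowSub ((D + 1) * H.step), a = f * c + l}
    add_mem' := by
      rintro _ _ ⟨c, hc, l, hl, rfl⟩ ⟨c', hc', l', hl', rfl⟩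
      exact ⟨c + c', by rw [map_add, hc, hc', add_zero], l + l', Submodule.add_mem _ hl hl', by ring⟩
    zero_mem' := ⟨0, map_zero _, 0, Submodule.zero_mem _, by simp⟩
    smul_mem' := by
      rintro b _ ⟨c, hc, l, hl, rfl⟩
      exact ⟨b • c, by rw [H.eps_smul, hc, mul_zero], b • l, Submodule.smul_mem _ _ hl, by
        rw [smul_add, mul_smul_comm]⟩ }
  obtain ⟨b, hb, p, hp, rfl⟩ := H.mem_of_eps_eq_zero ha
  refine T.add_mem ?_ ((Submodule.span_le.mpr ?_ : H.posSub ≤ T) hp)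
  · have hb : b ∈ (IsLocalRing.maximalIdeal B) • (⊤ : Submodule B A) := by
      rw [Ideal.smul_top_eq_map]; exact hb
    refine Submodule.smul_induction_on (p := fun b => b ∈ T) hb ?_ fun _ _ => T.add_mem
    intro m hm a _
    obtain ⟨c, l, hl, rfl⟩ := H.exists_div hf a
    refine ⟨m • c, ?_, m • l, Submodule.smul_mem _ _ (H.lowSub_mono (by nlinarith) hl), by
      rw [smul_add, mul_smul_comm]⟩
    rw [H.eps_smul, (IsLocalRing.residue_eq_zero_iff m).mpr hm, map_zero, zero_mul]
  · rintro _ ⟨y, hy, rfl⟩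
    have hy : H.wt y ≠ 0 := hy
    obtain ⟨q, z, h1, h2, h3, h4⟩ := H.exists_pow_mul y
    obtain ⟨c, l, hl, h⟩ := H.exists_div hf (H.u ^ q)
    refine ⟨c * H.mon z, ?_, l * H.mon z, ?_, by rw [h4, h]; ring⟩
    · rw [map_mul, H.eps_mon z (by rwa [h3]), mul_zero]
    · exact H.lowSub_mono (by nlinarith)
        (H.mul_mem_lowSub hl (H.mon_mem_lowSub (Nat.lt_succ_self (H.deg z))))

end HorrocksDatum

end Horrocks

section Horrocks

namespace HorrocksDatum

variable {B A Y : Type*} [CommRing B] [IsLocalRing B] [CommRing A] [Algebra B A]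
  [AddCommMonoid Y] (H : HorrocksDatum B A Y)

theorem eq_top_of_sup_map {D : ℕ} {f : A} (hf : H.IsMon D f) (N : Submodule B A)
    (hN : ∀ a, f * a ∈ N)
    (h : ∀ a : A, ∃ x ∈ N, ∃ y ∈ (IsLocalRing.maximalIdeal B).map (algebraMap B A), a = x + y) :
    N = ⊤ := by
  have h1 : ∀ y ∈ (IsLocalRing.maximalIdeal B).map (algebraMap B A),
      y ∈ N ⊔ (IsLocalRing.maximalIdeal B) • H.lowSub (D * H.step) := by
    intro y hy
    have hy : y ∈ (IsLocalRing.maximalIdeal B) • (⊤ : Submodule B A) := by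
      rw [Ideal.smul_top_eq_map]; exact hy
    refine Submodule.smul_induction_on hy ?_ fun _ _ => Submodule.add_mem _
    intro m hm a _
    obtain ⟨c, l, hl, rfl⟩ := H.exists_div hf a
    rw [smul_add]
    exact Submodule.add_mem _ (Submodule.mem_sup_left (Submodule.smul_mem _ _ (hN c)))
      (Submodule.mem_sup_right (Submodule.smul_mem_smul hm hl))
  have h2 : H.lowSub (D * H.step) ≤ N := by
    refine Submodule.le_of_le_smul_of_le_jacobson_bot (I := IsLocalRing.maximalIdeal B)
      (H.fg_low _) (IsLocalRing.maximalIdeal_le_jacobson _) ?_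
    intro a _
    obtain ⟨x, hx, y, hy, rfl⟩ := h a
    exact Submodule.add_mem _ (Submodule.mem_sup_left hx) (h1 y hy)
  rw [eq_top_iff]
  intro a _
  obtain ⟨c, l, hl, rfl⟩ := H.exists_div hf a
  exact Submodule.add_mem _ (hN c) (h2 hl)

theorem mon_nsmul (y : Y) (n : ℕ) : H.mon (n • y) = H.mon y ^ n := by
  induction n with
  | zero => rw [zero_smul, H.mon_zero, pow_zero]
  | succ n ih => rw [succ_nsmul, H.mon_add, ih, pow_succ]

theorem mem_radical_of_eps_eq_zero {a : A} (ha : H.eps a = 0) :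
    a ∈ ((IsLocalRing.maximalIdeal B).map (algebraMap B A)).radical := by
  obtain ⟨b, hb, c, hc, rfl⟩ := H.mem_of_eps_eq_zero ha
  refine Ideal.add_mem _ (Ideal.le_radical hb) ?_
  refine (Submodule.span_le (p := ((IsLocalRing.maximalIdeal B).map
    (algebraMap B A)).radical.restrictScalars B)).mpr ?_ hc
  rintro _ ⟨y, hy, rfl⟩
  refine ⟨H.bound, ?_⟩
  rw [← H.mon_nsmul]
  refine H.mem_of_bound _ ?_
  rw [map_nsmul, smul_eq_mul]
  exact Nat.le_mul_of_pos_right _ (Nat.pos_of_ne_zero hy)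

theorem eq_top_of_isMon {D : ℕ} {f : A} (hf : H.IsMon D f) {I : Ideal A} (hfI : f ∈ I) {a : A}
    (ha : a ∈ I) (ha1 : H.eps a = 1) : I = ⊤ := by
  have h1 : I ⊔ (IsLocalRing.maximalIdeal B).map (algebraMap B A) = ⊤ := by
    rw [← Ideal.radical_eq_top, ← top_le_iff, ← (Ideal.eq_top_iff_one _).mpr
      (show (1 : A) ∈ I ⊔ ((IsLocalRing.maximalIdeal B).map (algebraMap B A)).radical from ?_)]
    · refine sup_le (le_sup_left.trans Ideal.le_radical) (Ideal.radical_mono le_sup_right)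
    · have : (1 : A) = a + (1 - a) := by ring
      rw [this]
      refine Submodule.add_mem_sup ha (H.mem_radical_of_eps_eq_zero ?_)
      rw [map_sub, map_one, ha1, sub_self]
  have h2 := H.eq_top_of_sup_map hf (I.restrictScalars B) (fun a => I.mul_mem_right _ hfI) (by
    intro x
    have : x ∈ I ⊔ (IsLocalRing.maximalIdeal B).map (algebraMap B A) := by rw [h1]; trivial
    obtain ⟨y, hy, z, hz, h⟩ := Submodule.mem_sup.mp this
    exact ⟨y, hy, z, hz, h.symm⟩)
  rw [Ideal.eq_top_iff_one]
  have : (1 : A) ∈ I.restrictScalars B := by rw [h2]; trivial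
  exact this

/-- A congruence modulo `eps` to a power of `u` can be improved to one modulo low terms. -/
theorem exists_pow_sub_mem {D n : ℕ} {g p : A} (hg : H.IsMon D g) {J : Ideal A} (hgJ : g ∈ J)
    (hpJ : p ∈ J)
    {P : Polynomial B} (hP : P.Monic) (hPn : P.natDegree = n)
    (hpP : H.eps p = P.map (IsLocalRing.residue B)) :
    ∃ b ∈ J, H.u ^ n - b ∈ H.lowSub (n * H.step) := by
  have key : (J.restrictScalars B) ⊔ H.lowSub (n * H.step) = ⊤ := by
    refine H.eq_top_of_sup_map hg _ (fun a => Submodule.mem_sup_left (J.mul_mem_right _ hgJ)) ?_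
    let T : Submodule B A := (J.restrictScalars B) ⊔ H.lowSub (n * H.step) ⊔
      ((IsLocalRing.maximalIdeal B).map (algebraMap B A)).restrictScalars B
    suffices hT : T = ⊤ by
      intro a
      have : a ∈ T := by rw [hT]; trivial
      obtain ⟨x, hx, y, hy, h⟩ := Submodule.mem_sup.mp this
      exact ⟨x, hx, y, hy, h.symm⟩
    have hmon : ∀ y, H.mon y ∈ T := by
      intro y
      induction hw : H.bound - H.wt y using Nat.strong_induction_on generalizing y with
      | _ w ihw =>
      induction hd : H.deg y using Nat.strong_induction_on generalizing y with
      | _ d ihd =>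
      by_cases h1 : H.bound ≤ H.wt y
      · exact Submodule.mem_sup_right (H.mem_of_bound y h1)
      by_cases h2 : H.deg y < n * H.step
      · exact Submodule.mem_sup_left (Submodule.mem_sup_right (H.mon_mem_lowSub h2))
      obtain ⟨z, hz1, hz2, hz3⟩ := H.exists_pow_mul_of_le y n (not_lt.mp h2)
      have hl := H.isMon_aeval hP
      rw [hPn] at hl
      have h0 : H.eps (p - Polynomial.aeval H.u P) = 0 := by
        rw [map_sub, H.eps_aeval, hpP, sub_self]
      obtain ⟨b, hb, c, hc, hbc⟩ := H.mem_of_eps_eq_zero h0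
      have : H.mon y = p * H.mon z - (Polynomial.aeval H.u P - H.u ^ n) * H.mon z
          - b * H.mon z - c * H.mon z := by
        rw [hz3]; linear_combination (-H.mon z) * hbc
      rw [this]
      refine T.sub_mem (T.sub_mem (T.sub_mem ?_ ?_) ?_) ?_
      · exact Submodule.mem_sup_left (Submodule.mem_sup_left (J.mul_mem_right _ hpJ))
      · refine (show (H.lowSub (n * H.step)).map (LinearMap.mulRight B (H.mon z)) ≤ T from ?_)
          ⟨_, hl, rfl⟩
        rw [lowSub, Submodule.map_span, Submodule.span_le]
        rintro _ ⟨_, ⟨x, hx, rfl⟩, rfl⟩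
        have hx : H.deg x < n * H.step := hx
        change H.mon x * H.mon z ∈ T
        rw [← H.mon_add]
        by_cases h3 : H.wt x = 0
        · exact ihd (H.deg (x + z)) (by rw [map_add]; omega) (x + z)
            (by rw [map_add]; omega) rfl
        · exact ihw (H.bound - H.wt (x + z)) (by rw [map_add]; omega) (x + z) rfl
      · exact Submodule.mem_sup_right (Ideal.mul_mem_right _ _ hb)
      · refine (show H.posSub.map (LinearMap.mulRight B (H.mon z)) ≤ T from ?_) ⟨_, hc, rfl⟩
        rw [posSub, Submodule.map_span, Submodule.span_le]
        rintro _ ⟨_, ⟨x, hx, rfl⟩, rfl⟩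
        have hx : H.wt x ≠ 0 := hx
        change H.mon x * H.mon z ∈ T
        rw [← H.mon_add]
        exact ihw (H.bound - H.wt (x + z)) (by rw [map_add]; omega) (x + z) rfl
    rw [eq_top_iff, ← H.span_mon, Submodule.span_le]
    rintro _ ⟨y, rfl⟩
    exact hmon y
  have : H.u ^ n ∈ (J.restrictScalars B) ⊔ H.lowSub (n * H.step) := by rw [key]; trivial
  obtain ⟨b, hb, l, hl, h⟩ := Submodule.mem_sup.mp this
  exact ⟨b, hb, by rw [← h, add_sub_cancel_left]; exact hl⟩

end HorrocksDatum

end Horrocks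

section Frames

variable {A : Type*} [CommRing A] {n : Type*} [Fintype n] [DecidableEq n]

/-- The image of the idempotent matrix `e` is free. -/
def IsFreeIdem (e : Matrix n n A) : Prop :=
  ∃ (k : ℕ) (X : Matrix n (Fin k) A) (Y : Matrix (Fin k) n A), X * Y = e ∧ Y * X = 1

/-- `X` and `Y` are inverse to each other up to `g` as maps between the image of `e` and a free
module. -/
structure IsFrame {ι : Type*} [Fintype ι] [DecidableEq ι] (e : Matrix n n A) (X : Matrix n ι A)
    (Y : Matrix ι n A) (g : A) : Prop where
  mul_eq : X * Y = g • e
  mul_eq' : Y * X = g • (1 : Matrix ι ι A)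
  left : e * X = X
  right : Y * e = Y

omit [DecidableEq n] in
theorem IsFrame.of_isDomain [IsDomain A] {ι : Type*} [Fintype ι] [DecidableEq ι]
    {e : Matrix n n A} {X : Matrix n ι A} {Y : Matrix ι n A} {g : A} (hg : g ≠ 0)
    (h : X * Y = g • e) (h' : Y * X = g • (1 : Matrix ι ι A)) : IsFrame e X Y g := by
  refine ⟨h, h', smul_right_injective _ hg ?_, smul_right_injective _ hg ?_⟩
  · change g • (e * X) = g • X
    rw [← Matrix.smul_mul, ← h, Matrix.mul_assoc, h', Matrix.mul_smul, Matrix.mul_one]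
  · change g • (Y * e) = g • Y
    rw [← Matrix.mul_smul, ← h, ← Matrix.mul_assoc, h', Matrix.smul_mul, Matrix.one_mul]

omit [DecidableEq n] in
theorem isIdempotent_sub {e : Matrix n n A} (he : e * e = e) {P : Matrix n Unit A}
    {Q : Matrix Unit n A} (hP : e * P = P) (hQ : Q * e = Q) (hQP : Q * P = 1) :
    (e - P * Q) * (e - P * Q) = e - P * Q := by
  have h1 : e * (P * Q) = P * Q := by rw [← Matrix.mul_assoc, hP]
  have h2 : (P * Q) * e = P * Q := by rw [Matrix.mul_assoc, hQ]
  have h3 : (P * Q) * (P * Q) = P * Q := by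
    rw [Matrix.mul_assoc, ← Matrix.mul_assoc Q, hQP, Matrix.one_mul]
  rw [Matrix.sub_mul, Matrix.mul_sub, Matrix.mul_sub, he, h1, h2, h3]; abel

omit [DecidableEq n] in
/-- Splitting off a unimodular element from a frame. -/
theorem IsFrame.sub {k : ℕ} {e : Matrix n n A} (he : e * e = e) {X : Matrix n (Fin (k + 1)) A}
    {Y : Matrix (Fin (k + 1)) n A} {g : A} (h : IsFrame e X Y g) {P : Matrix n Unit A}
    {Q : Matrix Unit n A} (hP : e * P = P) (hQ : Q * e = Q) (hQP : Q * P = 1) :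
    ∃ X' Y', IsFrame (ι := Fin k) (e - P * Q) X' Y' ((Y * P) 0 () * g) := by
  let X0 : Matrix n Unit A := X.submatrix id fun _ => 0
  let X1 : Matrix n (Fin k) A := X.submatrix id Fin.succ
  let Y0 : Matrix Unit n A := Y.submatrix (fun _ => 0) id
  let Y1 : Matrix (Fin k) n A := Y.submatrix Fin.succ id
  have h1 : X0 * Y0 + X1 * Y1 = g • e := by
    rw [← h.mul_eq]
    ext i j
    simp [Matrix.mul_apply, Fin.sum_univ_succ, X0, X1, Y0, Y1]
  have h2 : X0 * (Y0 * P) + X1 * (Y1 * P) = g • P := by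
    rw [← Matrix.mul_assoc, ← Matrix.mul_assoc, ← Matrix.add_mul, h1, Matrix.smul_mul, hP]
  have h3 : Y0 * X1 = 0 := by
    ext i j
    have := congrFun (congrFun h.mul_eq' 0) j.succ
    simp only [Matrix.smul_apply, Matrix.one_apply_ne (Fin.succ_ne_zero j).symm, smul_zero] at this
    simpa [Matrix.mul_apply, X1, Y0] using this
  have h4 : Y1 * X1 = g • (1 : Matrix (Fin k) (Fin k) A) := by
    ext i j
    have := congrFun (congrFun h.mul_eq' i.succ) j.succ
    simp only [Matrix.smul_apply, Matrix.one_apply, Fin.succ_inj] at this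
    simpa [Matrix.mul_apply, X1, Y1, Matrix.one_apply] using this
  have h5 : Y0 * e = Y0 := by
    ext i j
    have := congrFun (congrFun h.right 0) j
    simpa [Matrix.mul_apply, Y0] using this
  have h6 : Y1 * e = Y1 := by
    ext i j
    have := congrFun (congrFun h.right i.succ) j
    simpa [Matrix.mul_apply, Y1] using this
  set φ : A := (Y * P) 0 () with hφ
  have h7 : Y0 * P = φ • (1 : Matrix Unit Unit A) := by
    ext i j
    simp [Matrix.mul_apply, Y0, hφ]
  set e' := e - P * Q with he'
  have hee := isIdempotent_sub he hP hQ hQP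
  rw [← he'] at hee
  have h8 : e' * e = e' := by rw [he', Matrix.sub_mul, he, Matrix.mul_assoc, hQ]
  have h9 : e' * P = 0 := by
    rw [he', Matrix.sub_mul, hP, Matrix.mul_assoc, hQP, Matrix.mul_one, sub_self]
  let Y' : Matrix (Fin k) n A := φ • Y1 - (Y1 * P) * Y0
  have hYP : Y' * P = 0 := by
    simp only [Y']
    rw [Matrix.sub_mul, Matrix.mul_assoc _ Y0, h7, Matrix.mul_smul, Matrix.mul_one, Matrix.smul_mul,
      sub_self]
  have hYe : Y' * e' = Y' := by
    rw [he', Matrix.mul_sub, ← Matrix.mul_assoc, hYP, Matrix.zero_mul, sub_zero]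
    simp only [Y']
    rw [Matrix.sub_mul, Matrix.smul_mul, h6, Matrix.mul_assoc _ Y0, h5]
  refine ⟨e' * X1, Y', ?_, ?_, by rw [← Matrix.mul_assoc, hee], hYe⟩
  · have : X1 * Y' = (φ * g) • e - g • (P * Y0) := by
      have h2' : X1 * (Y1 * P) = g • P - X0 * (φ • (1 : Matrix Unit Unit A)) := by
        rw [← h2, h7]; abel
      have h1' : X1 * Y1 = g • e - X0 * Y0 := by rw [← h1]; abel
      simp only [Y']
      rw [Matrix.mul_sub, Matrix.mul_smul, h1', ← Matrix.mul_assoc, h2', Matrix.mul_smul,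
        Matrix.mul_one, Matrix.sub_mul, Matrix.smul_mul, Matrix.smul_mul, smul_sub, smul_smul]
      abel
    rw [Matrix.mul_assoc, this, Matrix.mul_sub, Matrix.mul_smul, h8, Matrix.mul_smul,
      ← Matrix.mul_assoc, h9, Matrix.zero_mul, smul_zero, sub_zero]
  · rw [← Matrix.mul_assoc, hYe]
    simp only [Y']
    rw [Matrix.sub_mul, Matrix.smul_mul, h4, Matrix.mul_assoc _ Y0, h3, Matrix.mul_zero, sub_zero,
      smul_smul]

omit [DecidableEq n] in
theorem isFreeIdem_of_sub {e : Matrix n n A} {P : Matrix n Unit A}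
    {Q : Matrix Unit n A} (hP : e * P = P) (hQ : Q * e = Q) (hQP : Q * P = 1)
    (h : IsFreeIdem (e - P * Q)) : IsFreeIdem e := by
  obtain ⟨k, X, Y, hXY, hYX⟩ := h
  have h1 : Q * (e - P * Q) = 0 := by
    rw [Matrix.mul_sub, hQ, ← Matrix.mul_assoc, hQP, Matrix.one_mul, sub_self]
  have h2 : (e - P * Q) * P = 0 := by
    rw [Matrix.sub_mul, hP, Matrix.mul_assoc, hQP, Matrix.mul_one, sub_self]
  have h3 : Q * X = 0 := by
    have : Q * X = Q * (X * Y) * X := by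
      rw [Matrix.mul_assoc, Matrix.mul_assoc X, hYX, Matrix.mul_one]
    rw [this, hXY, h1, Matrix.zero_mul]
  have h4 : Y * P = 0 := by
    have : Y * P = Y * ((X * Y) * P) := by
      rw [← Matrix.mul_assoc, ← Matrix.mul_assoc, hYX, Matrix.one_mul]
    rw [this, hXY, h2, Matrix.mul_zero]
  let f : Fin (k + 1) ≃ Unit ⊕ Fin k := Fintype.equivOfCardEq (by simp [add_comm])
  refine ⟨k + 1, (Matrix.fromCols P X).submatrix id f, (Matrix.fromRows Q Y).submatrix f id, ?_, ?_⟩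
  · rw [Matrix.submatrix_mul_equiv, Matrix.fromCols_mul_fromRows, hXY]
    simp
  · rw [← Matrix.submatrix_mul _ _ _ _ _ Function.bijective_id, Matrix.fromRows_mul_fromCols,
      hYX, hQP, h3, h4, Matrix.fromBlocks_one, Matrix.submatrix_one_equiv]

theorem le_of_mul_eq_smul_one [IsDomain A] {k k' : ℕ} {M : Matrix (Fin k) (Fin k') A}
    {N : Matrix (Fin k') (Fin k) A} {c : A} (hc : c ≠ 0)
    (h : M * N = c • (1 : Matrix (Fin k) (Fin k) A)) : k ≤ k' := by
  refine le_of_fin_injective A (Matrix.mulVecLin N) ?_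
  rw [← LinearMap.ker_eq_bot, LinearMap.ker_eq_bot']
  intro v hv
  have h1 : c • v = 0 := by
    have : (M * N).mulVec v = c • v := by rw [h, Matrix.smul_mulVec, Matrix.one_mulVec]
    rw [← this, ← Matrix.mulVec_mulVec]
    have hv : N.mulVec v = 0 := hv
    rw [hv, Matrix.mulVec_zero]
  exact (smul_eq_zero.mp h1).resolve_left hc

theorem exists_monic_sum {K : Type*} [Field K] {k : ℕ} (hk : 2 ≤ k) (a : Fin k → Polynomial K)
    (ha : ∃ i, a i ≠ 0) (N : ℕ) : ∃ (x : Fin k → Polynomial K) (j : Fin k), x j = 1 ∧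
      (∑ i, a i * x i).Monic ∧ N ≤ (∑ i, a i * x i).natDegree := by
  obtain ⟨i, hi⟩ := ha
  have : Nontrivial (Fin k) := Fin.nontrivial_iff_two_le.mpr hk
  obtain ⟨j, hj⟩ := exists_ne i
  let m : Polynomial K := a i * Polynomial.C (a i).leadingCoeff⁻¹
  have hm : m.Monic := Polynomial.monic_mul_leadingCoeff_inv hi
  let d := N + (a j).natDegree + 1
  have hd : (Polynomial.X ^ d * m).Monic := (Polynomial.monic_X_pow d).mul hm
  have hdd : d ≤ (Polynomial.X ^ d * m).natDegree := by
    rw [(Polynomial.monic_X_pow d).natDegree_mul hm, Polynomial.natDegree_X_pow]; omega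
  have hlt : (a j).degree < (Polynomial.X ^ d * m).degree := by
    apply Polynomial.degree_lt_degree
    omega
  let x : Fin k → Polynomial K := fun l =>
    if l = i then Polynomial.C (a i).leadingCoeff⁻¹ * Polynomial.X ^ d else if l = j then 1 else 0
  have hsum : ∑ l, a l * x l = Polynomial.X ^ d * m + a j := by
    rw [Fintype.sum_eq_add i j hj.symm]
    · simp only [x, if_pos, if_neg hj, m]; ring
    · rintro l ⟨h1, h2⟩
      simp [x, h1, h2]
  refine ⟨x, j, by simp [x, hj], ?_, ?_⟩
  · rw [hsum]; exact hd.add_of_left hlt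
  · rw [hsum, Polynomial.natDegree_add_eq_left_of_degree_lt hlt]; omega

end Frames

section Horrocks

namespace HorrocksDatum

variable {B A Y : Type*} [CommRing B] [IsLocalRing B] [CommRing A] [Algebra B A]
  [AddCommMonoid Y] (H : HorrocksDatum B A Y) {n : Type*} [Fintype n] [DecidableEq n]

omit [DecidableEq n] in
theorem exists_row {D : ℕ} {m : Type*} {e : Matrix n n A} (he : e * e = e) {W : Matrix m n A}
    {i : m} {P : Matrix n Unit A} (hP : e * P = P) (hW : H.IsMon D ((W * P) i ()))
    {Q₀ : Matrix Unit n (Polynomial (IsLocalRing.ResidueField B))} (hQ : Q₀ * P.map H.eps = 1) :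
    ∃ Q : Matrix Unit n A, Q * e = Q ∧ Q * P = 1 := by
  choose Q₁ hQ₁ using fun l => H.eps_surjective (Q₀ () l)
  have htop : Ideal.span (Set.range fun l => P l ()) = ⊤ := by
    refine H.eq_top_of_isMon hW (a := ∑ l, Q₁ l * P l ()) ?_ ?_ ?_
    · rw [Matrix.mul_apply]
      exact Ideal.sum_mem _ fun l _ => Ideal.mul_mem_left _ _ (Ideal.subset_span ⟨l, rfl⟩)
    · exact Ideal.sum_mem _ fun l _ => Ideal.mul_mem_left _ _ (Ideal.subset_span ⟨l, rfl⟩)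
    · have := congrFun (congrFun hQ ()) ()
      rw [Matrix.mul_apply] at this
      simpa [hQ₁] using this
  have h1 : (1 : A) ∈ Ideal.span (Set.range fun l => P l ()) := by rw [htop]; trivial
  obtain ⟨c, hc⟩ := Ideal.mem_span_range_iff_exists_fun.mp h1
  refine ⟨Matrix.of (fun _ => c) * e, by rw [Matrix.mul_assoc, he], ?_⟩
  rw [Matrix.mul_assoc, hP]
  ext i j
  simpa [Matrix.mul_apply] using hc

theorem exists_unimodular [IsDomain A] {k D : ℕ} {e : Matrix n n A} (he : e * e = e)
    {X : Matrix n (Fin (k + 1)) A} {W : Matrix (Fin (k + 1)) n A} {g : A} (h : IsFrame e X W g)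
    (hg : H.IsMon D g) : ∃ (P : Matrix n Unit A) (Q : Matrix Unit n A) (d : ℕ),
      e * P = P ∧ Q * e = Q ∧ Q * P = 1 ∧ H.IsMon d ((W * P) 0 ()) := by
  have hgm := hg.eps
  have hg0 : H.eps g ≠ 0 := hgm.1.ne_zero
  obtain ⟨k', Xh, Yh, h1, h2⟩ := exists_mul_eq_of_isIdempotent_of_pid (e.map H.eps) (by
    rw [← Matrix.map_mul, he])
  have hXW : X.map H.eps * W.map H.eps = H.eps g • e.map H.eps := by
    rw [← Matrix.map_mul, h.mul_eq]; ext1 i j; simp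
  have hWX : W.map H.eps * X.map H.eps =
      H.eps g • (1 : Matrix (Fin (k + 1)) (Fin (k + 1)) (Polynomial _)) := by
    rw [← Matrix.map_mul, h.mul_eq']
    ext1 i j
    by_cases hij : i = j
    · subst hij; simp
    · simp [Matrix.one_apply_ne hij]
  have hWe : W.map H.eps * e.map H.eps = W.map H.eps := by rw [← Matrix.map_mul, h.right]
  have hMN : (W.map H.eps * Xh) * (Yh * X.map H.eps) =
      H.eps g • (1 : Matrix (Fin (k + 1)) (Fin (k + 1)) (Polynomial _)) := by
    rw [Matrix.mul_assoc, ← Matrix.mul_assoc Xh, h1, ← Matrix.mul_assoc, hWe, hWX]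
  have hNM : (Yh * X.map H.eps) * (W.map H.eps * Xh) =
      H.eps g • (1 : Matrix (Fin k') (Fin k') (Polynomial _)) := by
    rw [Matrix.mul_assoc, ← Matrix.mul_assoc (X.map H.eps), hXW, Matrix.smul_mul, Matrix.mul_smul,
      ← h1, Matrix.mul_assoc Xh, h2, Matrix.mul_one, h2]
  obtain rfl : k' = k + 1 :=
    le_antisymm (le_of_mul_eq_smul_one hg0 hNM) (le_of_mul_eq_smul_one hg0 hMN)
  let a : Fin (k + 1) → Polynomial (IsLocalRing.ResidueField B) := fun i => (W.map H.eps * Xh) 0 i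
  have ha : ∃ i, a i ≠ 0 := by
    by_contra! hcon
    have := congrFun (congrFun hMN 0) 0
    rw [Matrix.mul_apply] at this
    rw [Finset.sum_eq_zero fun i _ => by
      rw [show (W.map H.eps * Xh) 0 i = 0 from hcon i, zero_mul]] at this
    exact hg0 (by simpa using this.symm)
  -- lifting elements of the image modulo `eps`
  have lift : ∀ x : Fin (k + 1) → Polynomial (IsLocalRing.ResidueField B),
      ∃ P : Matrix n Unit A, e * P = P ∧ P.map H.eps = Xh * Matrix.of (fun i (_ : Unit) => x i) ∧
        H.eps ((W * P) 0 ()) = ∑ i, a i * x i := by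
    intro x
    choose P₀ hP₀ using fun l => H.eps_surjective ((Xh * Matrix.of (fun i (_ : Unit) => x i)) l ())
    have hP₁ : (Matrix.of fun l (_ : Unit) => P₀ l).map H.eps =
        Xh * Matrix.of (fun i (_ : Unit) => x i) := by
      ext1 l j; exact hP₀ l
    have hP₂ : (e * Matrix.of fun l (_ : Unit) => P₀ l).map H.eps =
        Xh * Matrix.of (fun i (_ : Unit) => x i) := by
      rw [Matrix.map_mul, hP₁, ← h1, Matrix.mul_assoc, ← Matrix.mul_assoc Yh, h2, Matrix.one_mul]
    refine ⟨e * Matrix.of fun l _ => P₀ l, by rw [← Matrix.mul_assoc, he], hP₂, ?_⟩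
    have : H.eps ((W * (e * Matrix.of fun l (_ : Unit) => P₀ l)) 0 ()) =
        ((W * (e * Matrix.of fun l (_ : Unit) => P₀ l)).map H.eps) 0 () := rfl
    rw [this, Matrix.map_mul, hP₂, ← Matrix.mul_assoc, Matrix.mul_apply]
    rfl
  have liftMonic : ∀ α : Polynomial (IsLocalRing.ResidueField B), α.Monic →
      ∃ P : Polynomial B, P.map (IsLocalRing.residue B) = α ∧ P.natDegree = α.natDegree ∧
        P.Monic := fun α hα => by
    refine Polynomial.lifts_and_natDegree_eq_and_monic ?_ hα
    rw [Polynomial.mem_lifts]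
    exact Polynomial.map_surjective _ (IsLocalRing.residue_surjective (R := B)) α
  rcases Nat.eq_zero_or_pos k with rfl | hk
  · have ha0 : a 0 ≠ 0 := by
      obtain ⟨i, hi⟩ := ha
      rwa [show i = 0 from Fin.ext (by omega)] at hi
    set c := (a 0).leadingCoeff⁻¹ with hc
    have hα : (a 0 * Polynomial.C c).Monic := Polynomial.monic_mul_leadingCoeff_inv ha0
    have hαd : (a 0 * Polynomial.C c).natDegree = (a 0).natDegree :=
      Polynomial.natDegree_mul_leadingCoeff_inv _ ha0
    obtain ⟨P₀, hP₀, -, hP₀'⟩ := lift fun _ => Polynomial.C c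
    rw [Fin.sum_univ_one] at hP₀'
    obtain ⟨α, hα1, hα2, hα3⟩ := liftMonic _ hα
    let J : Ideal A := Ideal.span (Set.range fun l => W 0 l)
    obtain ⟨b, hb, hbl⟩ := H.exists_pow_sub_mem hg (J := J) (p := (W * P₀) 0 ())
      (n := (a 0).natDegree) (by
        have := congrFun (congrFun h.mul_eq' 0) 0
        rw [Matrix.mul_apply, Matrix.smul_apply, Matrix.one_apply_eq, smul_eq_mul, mul_one] at this
        rw [← this]
        exact Ideal.sum_mem _ fun l _ => Ideal.mul_mem_right _ _ (Ideal.subset_span ⟨l, rfl⟩))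
      (by
        rw [Matrix.mul_apply]
        exact Ideal.sum_mem _ fun l _ => Ideal.mul_mem_right _ _ (Ideal.subset_span ⟨l, rfl⟩))
      hα3 (hα2.trans hαd) (by rw [hP₀', hα1])
    obtain ⟨x, hx⟩ := Ideal.mem_span_range_iff_exists_fun.mp hb
    let P₁ : Matrix n Unit A := e * Matrix.of fun l _ => x l
    have hP₁ : e * P₁ = P₁ := by simp only [P₁]; rw [← Matrix.mul_assoc, he]
    have hWP : (W * P₁) 0 () = b := by
      simp only [P₁]
      rw [← Matrix.mul_assoc, h.right, Matrix.mul_apply, ← hx]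
      exact Finset.sum_congr rfl fun l _ => mul_comm _ _
    have hbm : H.IsMon (a 0).natDegree b := by
      rw [IsMon, ← neg_sub]; exact Submodule.neg_mem _ hbl
    set c₀ := (Yh * P₁.map H.eps) 0 () with hc₀
    have hac : a 0 * c₀ = H.eps b := by
      have h3 : (W.map H.eps * Xh) * (Yh * P₁.map H.eps) = (W * P₁).map H.eps := by
        rw [Matrix.mul_assoc, ← Matrix.mul_assoc Xh, h1, ← Matrix.mul_assoc, hWe]
        exact Matrix.map_mul.symm
      have := congrFun (congrFun h3 0) ()
      rw [Matrix.mul_apply, Fin.sum_univ_one, Matrix.map_apply, hWP] at this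
      exact this
    have hc0 : c₀ ≠ 0 := by
      intro h0
      rw [h0, mul_zero] at hac
      exact hbm.eps.1.ne_zero hac.symm
    have hdeg := hbm.eps.2
    rw [← hac, Polynomial.natDegree_mul ha0 hc0] at hdeg
    obtain ⟨d, hd⟩ : ∃ d, c₀ = Polynomial.C d :=
      ⟨_, Polynomial.eq_C_of_natDegree_eq_zero (by omega)⟩
    have hd0 : d ≠ 0 := by rintro rfl; exact hc0 (by rw [hd, map_zero])
    obtain ⟨Q, hQ1, hQ2⟩ := H.exists_row he hP₁ (W := W) (i := 0) (by rw [hWP]; exact hbm)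
      (Q₀ := Polynomial.C d⁻¹ • Yh.submatrix (fun _ => 0) id) (by
        ext1 i j
        have h4 : (Yh.submatrix (fun _ : Unit => 0) id * P₁.map H.eps) i j = c₀ := rfl
        rw [Matrix.smul_mul, Matrix.smul_apply, h4, hd, smul_eq_mul, ← map_mul,
          inv_mul_cancel₀ hd0, map_one]
        rfl)
    exact ⟨P₁, Q, _, hP₁, hQ1, hQ2, by rw [hWP]; exact hbm⟩
  · obtain ⟨x, j, hxj, hm, hN⟩ := exists_monic_sum (by omega) a ha (D + 1)
    obtain ⟨P₀, hP₀, hP₀e, hP₀'⟩ := lift x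
    obtain ⟨α, hα1, hα2, hα3⟩ := liftMonic _ hm
    obtain ⟨γ, hγ, l, hl, hν⟩ := H.exists_div_of_eps_eq_zero hg
      (a := (W * P₀) 0 () - Polynomial.aeval H.u α)
      (by rw [map_sub, hP₀', H.eps_aeval, hα1, sub_self])
    let X₀ : Matrix n Unit A := X.submatrix id fun _ => 0
    let P₁ : Matrix n Unit A := P₀ - γ • X₀
    have heX : e * X₀ = X₀ := by
      ext1 i j
      have := congrFun (congrFun h.left i) 0
      simpa [Matrix.mul_apply, X₀] using this
    have hP₁ : e * P₁ = P₁ := by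
      simp only [P₁]
      rw [Matrix.mul_sub, hP₀, Matrix.mul_smul, heX]
    have hWX0 : (W * X₀) 0 () = g := by
      have := congrFun (congrFun h.mul_eq' 0) 0
      rw [Matrix.smul_apply, Matrix.one_apply_eq, smul_eq_mul, mul_one] at this
      rw [← this]; rfl
    have hWP : (W * P₁) 0 () = Polynomial.aeval H.u α + l := by
      simp only [P₁]
      rw [Matrix.mul_sub, Matrix.mul_smul, Matrix.sub_apply, Matrix.smul_apply, hWX0, smul_eq_mul]
      linear_combination hν
    have hbm : H.IsMon α.natDegree ((W * P₁) 0 ()) := by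
      rw [hWP, IsMon, add_sub_right_comm]
      refine Submodule.add_mem _ (H.isMon_aeval hα3) (H.lowSub_mono ?_ hl)
      rw [hα2]; exact Nat.mul_le_mul_right _ hN
    have hP₁e : P₁.map H.eps = P₀.map H.eps := by
      ext1 i j
      simp [P₁, hγ]
    obtain ⟨Q, hQ1, hQ2⟩ := H.exists_row he hP₁ hbm
      (Q₀ := Yh.submatrix (fun _ => j) id) (by
        rw [hP₁e, hP₀e]
        ext1 i i'
        have h4 : (Yh.submatrix (fun _ : Unit => j) id *
            (Xh * Matrix.of (fun i (_ : Unit) => x i))) i i' =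
            (Yh * (Xh * Matrix.of (fun i (_ : Unit) => x i))) j () := rfl
        rw [h4, ← Matrix.mul_assoc, h2, Matrix.one_mul]
        exact hxj)
    exact ⟨P₁, Q, _, hP₁, hQ1, hQ2, hbm⟩

/-- Monic inversion over a local base. -/
theorem isFreeIdem_of_isFrame [IsDomain A] {k D : ℕ} {e : Matrix n n A} (he : e * e = e)
    {X : Matrix n (Fin k) A} {W : Matrix (Fin k) n A} {g : A} (h : IsFrame e X W g)
    (hg : H.IsMon D g) : IsFreeIdem e := by
  induction k generalizing e g D with
  | zero =>
    have hg0 : g ≠ 0 := by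
      rintro rfl
      exact hg.eps.1.ne_zero (map_zero _)
    refine ⟨0, X, W, ?_, Subsingleton.elim _ _⟩
    have h0 : X * W = 0 := by ext; simp [Matrix.mul_apply]
    have := h.mul_eq
    rw [h0] at this ⊢
    exact ((smul_eq_zero.mp this.symm).resolve_left hg0).symm
  | succ k ih =>
    obtain ⟨P, Q, d, hP, hQ, hQP, hm⟩ := H.exists_unimodular he h hg
    obtain ⟨X', Y', h'⟩ := h.sub he hP hQ hQP
    exact isFreeIdem_of_sub hP hQ hQP (ih (isIdempotent_sub he hP hQ hQP) h' (hm.mul hg))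

end HorrocksDatum

end Horrocks

section MonElt

variable {r : ℕ} (R : Type*) [CommRing R] {N : AddSubmonoid (Fin r →₀ ℕ)}

/-- The monomial of `R[N]` with a given exponent. -/
noncomputable def monElt (y : N) : monAlg R N :=
  ⟨monomial (y : Fin r →₀ ℕ) 1, monomial_mem_monAlg y.2 1⟩

theorem monElt_zero : monElt R (0 : N) = 1 := rfl

theorem monElt_add (y z : N) : monElt R (y + z) = monElt R y * monElt R z := by
  apply Subtype.ext
  simp [monElt, monomial_mul]

theorem monElt_nsmul (n : ℕ) (y : N) : monElt R (n • y) = monElt R y ^ n := by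
  apply Subtype.ext
  simp [monElt, monomial_pow]

theorem span_monElt : Submodule.span R (Set.range (monElt R (N := N))) = ⊤ := by
  rw [eq_top_iff]
  rintro ⟨p, hp⟩ -
  suffices h : ∀ hp : p ∈ monAlg R N, (⟨p, hp⟩ : monAlg R N) ∈
      Submodule.span R (Set.range (monElt R (N := N))) from h hp
  refine SuppIn.induction (T := (N : Set (Fin r →₀ ℕ)))
    (P := fun p => ∀ hp : p ∈ monAlg R N, (⟨p, hp⟩ : monAlg R N) ∈
      Submodule.span R (Set.range (monElt R (N := N)))) ?_ ?_ ?_ hp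
  · intro x hx a _
    have : (⟨monomial x a, monomial_mem_monAlg hx a⟩ : monAlg R N) = a • monElt R ⟨x, hx⟩ := by
      apply Subtype.ext
      simp [monElt, smul_monomial]
    rw [this]
    exact Submodule.smul_mem _ _ (Submodule.subset_span ⟨_, rfl⟩)
  · intro _; exact Submodule.zero_mem _
  · intro p q hp hq h1 h2 _
    exact Submodule.add_mem _ (h1 hp) (h2 hq)

/-- The algebra homomorphism from the abstract monoid algebra to `R[N]`. -/
noncomputable def monAlgHom : AddMonoidAlgebra R N →ₐ[R] monAlg R N :=
  AddMonoidAlgebra.lift R _ N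
    { toFun := fun y => monElt R y.toAdd
      map_one' := rfl
      map_mul' := fun y z => monElt_add R y.toAdd z.toAdd }

theorem monAlgHom_single (y : N) (a : R) :
    monAlgHom R (AddMonoidAlgebra.single y a) = a • monElt R y := by
  simp [monAlgHom]
  rfl

theorem monAlgHom_injective : Function.Injective (monAlgHom R (N := N)) := by
  have h : ∀ p : AddMonoidAlgebra R N, ((monAlgHom R p : monAlg R N) : MvPolynomial (Fin r) R) =
      AddMonoidAlgebra.mapDomain N.subtype p := by
    intro p
    induction p using AddMonoidAlgebra.induction_linear with
    | zero => simp
    | add p q hp hq => simp [hp, hq, AddMonoidAlgebra.mapDomain_add]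
    | single y a =>
      rw [monAlgHom_single, AddMonoidAlgebra.mapDomain_single]
      simp [monElt, smul_monomial]
      rfl
  intro p q hpq
  apply AddMonoidAlgebra.mapDomain_injective (R := R) (f := N.subtype) Subtype.val_injective
  rw [← h, ← h, hpq]

theorem monAlgHom_surjective : Function.Surjective (monAlgHom R (N := N)) := by
  rw [← AlgHom.range_eq_top]
  rw [eq_top_iff]
  intro p _
  have : p ∈ Submodule.span R (Set.range (monElt R (N := N))) := by rw [span_monElt]; trivial
  revert this
  apply Submodule.span_induction
  · rintro _ ⟨y, rfl⟩
    exact ⟨AddMonoidAlgebra.single y 1, by simp [monAlgHom_single]⟩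
  · exact Subalgebra.zero_mem _
  · intro _ _ _ _ h1 h2; exact Subalgebra.add_mem _ h1 h2
  · intro a _ _ h; exact Subalgebra.smul_mem _ h a

/-- The isomorphism between the abstract monoid algebra and `R[N]`. -/
noncomputable def monAlgEquiv : AddMonoidAlgebra R N ≃ₐ[R] monAlg R N :=
  AlgEquiv.ofBijective (monAlgHom R) ⟨monAlgHom_injective R, monAlgHom_surjective R⟩

theorem monAlgEquiv_single (y : N) (a : R) :
    monAlgEquiv R (AddMonoidAlgebra.single y a) = a • monElt R y := monAlgHom_single R y a

variable {R} {T : Type*} [CommRing T]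

theorem monAlg_ringHom_ext {f g : monAlg R N →+* T}
    (h1 : ∀ a : R, f (algebraMap R _ a) = g (algebraMap R _ a))
    (h2 : ∀ y, f (monElt R y) = g (monElt R y)) : f = g := by
  ext p
  have : p ∈ Submodule.span R (Set.range (monElt R (N := N))) := by rw [span_monElt]; trivial
  revert this
  apply Submodule.span_induction
  · rintro _ ⟨y, rfl⟩; exact h2 y
  · rw [map_zero, map_zero]
  · intro _ _ _ _ h1 h2; rw [map_add, map_add, h1, h2]
  · intro a _ _ h; rw [Algebra.smul_def, map_mul, map_mul, h, h1]

theorem exists_monAlg_ringHom (f : R →+* T) (φ : N → T) (h0 : φ 0 = 1)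
    (hadd : ∀ y z, φ (y + z) = φ y * φ z) :
    ∃ F : monAlg R N →+* T, (∀ a : R, F (algebraMap R _ a) = f a) ∧ ∀ y, F (monElt R y) = φ y := by
  let G : AddMonoidAlgebra R N →+* T := AddMonoidAlgebra.liftNCRingHom f
    { toFun := fun y => φ y.toAdd
      map_one' := h0
      map_mul' := fun y z => hadd y.toAdd z.toAdd } (fun _ _ => Commute.all _ _)
  refine ⟨G.comp (monAlgEquiv R).symm.toRingEquiv.toRingHom, fun a => ?_, fun y => ?_⟩
  · have : (monAlgEquiv R).symm (algebraMap R (monAlg R N) a) = algebraMap R _ a :=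
      AlgEquiv.commutes _ a
    change G ((monAlgEquiv R).symm (algebraMap R (monAlg R N) a)) = f a
    rw [this, AddMonoidAlgebra.coe_algebraMap]
    simp [G, h0]
  · have : (monAlgEquiv R).symm (monElt R y) = AddMonoidAlgebra.single y 1 := by
      rw [AlgEquiv.symm_apply_eq, monAlgEquiv_single, one_smul]
    change G ((monAlgEquiv R).symm (monElt R y)) = _
    rw [this]
    simp [G]

end MonElt

section LocMon

variable {r : ℕ}

/-- Monoids in the coordinates up to `j` in which `c e_j` can be cancelled. -/
structure LocMon (c : ℕ) (j : Fin r) (N : AddSubmonoid (Fin r →₀ ℕ)) : Prop where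
  pos : 0 < c
  supp : ∀ x ∈ N, ∀ i, j < i → x i = 0
  single_mem : ∀ i ≤ j, Finsupp.single i c ∈ N
  mem_of_add : ∀ x i, (0 < x i ∨ i = j) → x + Finsupp.single i c ∈ N → x ∈ N

variable {c : ℕ} {j : Fin r} {N : AddSubmonoid (Fin r →₀ ℕ)}

theorem LocMon.mem_of_add_nsmul (h : LocMon c j N) (q : ℕ) (x : Fin r →₀ ℕ)
    (hx : x + q • Finsupp.single j c ∈ N) : x ∈ N := by
  induction q generalizing x with
  | zero => simpa using hx
  | succ q ih =>
    refine ih x (h.mem_of_add _ j (Or.inr rfl) ?_)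
    rwa [add_assoc, ← succ_nsmul]

/-- The total exponent in the coordinates other than `j` outside `U`. -/
noncomputable def outerWt (j : Fin r) (U : Set (Fin r)) : (Fin r →₀ ℕ) →+ ℕ :=
  open Classical in
  { toFun := fun y => ∑ i with i ≠ j ∧ i ∉ U, y i
    map_zero' := by simp
    map_add' := fun y z => by simp [Finset.sum_add_distrib] }

theorem outerWt_eq_zero {U : Set (Fin r)} {y : Fin r →₀ ℕ} :
    outerWt j U y = 0 ↔ ∀ i, i ≠ j → i ∉ U → y i = 0 := by
  simp only [outerWt, AddMonoidHom.coe_mk, ZeroHom.coe_mk, Finset.sum_eq_zero_iff]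
  simp

theorem exists_lt_of_outerWt {U : Set (Fin r)} {y : Fin r →₀ ℕ} (h : r * c + 1 ≤ outerWt j U y) :
    ∃ i, i ≠ j ∧ i ∉ U ∧ c < y i := by
  classical
  by_contra! hc
  have : outerWt j U y ≤ r * c := by
    simp only [outerWt, AddMonoidHom.coe_mk, ZeroHom.coe_mk]
    refine (Finset.sum_le_card_nsmul _ _ c fun i hi => ?_).trans ?_
    · simp only [Finset.mem_filter, Finset.mem_univ, true_and] at hi
      exact hc i hi.1 hi.2
    · rw [smul_eq_mul]
      exact Nat.mul_le_mul_right _ ((Finset.card_le_univ _).trans (by simp))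
  omega

theorem LocMon.exists_min (h : LocMon c j N) (U : Set (Fin r)) :
    ∃ x0 ∈ N, outerWt j U x0 = 0 ∧ 0 < x0 j ∧
      ∀ x ∈ N, outerWt j U x = 0 → 0 < x j → x0 j ≤ x j := by
  classical
  have hex : ∃ m, ∃ x ∈ N, outerWt j U x = 0 ∧ 0 < x j ∧ x j = m := by
    refine ⟨c, Finsupp.single j c, h.single_mem j le_rfl, ?_, by simpa using h.pos, by simp⟩
    rw [outerWt_eq_zero]
    intro i hi _
    simp [hi.symm]
  obtain ⟨x, hx, h1, h2, h3⟩ := Nat.find_spec hex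
  exact ⟨x, hx, h1, h2, fun y hy h4 h5 => h3 ▸ Nat.find_min' hex ⟨y, hy, h4, h5, rfl⟩⟩

/-- Trading `q • x0 j` in the coordinate `j`. -/
theorem LocMon.exists_trade (h : LocMon c j N) {x0 : Fin r →₀ ℕ} (h0 : x0 ∈ N) {y : Fin r →₀ ℕ}
    (hy : y ∈ N) (q : ℕ) (hq : q * x0 j ≤ y j) :
    ∃ z ∈ N, z + (q * x0 j) • Finsupp.single j c = y + (q * (c - 1)) • x0 := by
  have hle : (q * x0 j) • Finsupp.single j c ≤ y + (q * (c - 1)) • x0 := by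
    rw [Finsupp.smul_single, Finsupp.single_le_iff]
    obtain ⟨c', hc⟩ : ∃ c', c = c' + 1 := ⟨c - 1, by have := h.pos; omega⟩
    subst hc
    simp only [smul_eq_mul, Finsupp.add_apply, Finsupp.smul_apply, Nat.add_sub_cancel]
    nlinarith
  have hz := tsub_add_cancel_of_le hle
  refine ⟨_, h.mem_of_add_nsmul (q * x0 j) _ ?_, hz⟩
  rw [hz]
  exact N.add_mem hy (N.nsmul_mem h0 _)

theorem LocMon.trade_apply (h : LocMon c j N) {x0 y z : Fin r →₀ ℕ} {q : ℕ}
    (hz : z + (q * x0 j) • Finsupp.single j c = y + (q * (c - 1)) • x0) :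
    z j + q * x0 j = y j := by
  obtain ⟨c', hc⟩ : ∃ c', c = c' + 1 := ⟨c - 1, by have := h.pos; omega⟩
  subst hc
  have := DFunLike.congr_fun hz j
  simp at this
  nlinarith

theorem LocMon.dvd_of_min (h : LocMon c j N) {U : Set (Fin r)} {x0 : Fin r →₀ ℕ} (h0 : x0 ∈ N)
    (hU : outerWt j U x0 = 0) (hpos : 0 < x0 j)
    (hmin : ∀ x ∈ N, outerWt j U x = 0 → 0 < x j → x0 j ≤ x j) {y : Fin r →₀ ℕ} (hy : y ∈ N)
    (hyU : outerWt j U y = 0) : x0 j ∣ y j := by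
  obtain ⟨z, hz, hze⟩ := h.exists_trade h0 hy (y j / x0 j) (Nat.div_mul_le_self _ _)
  have h1 := h.trade_apply hze
  have h2 : outerWt j U z = 0 := by
    have := congrArg (outerWt j U) hze
    rw [map_add, map_add, map_nsmul, map_nsmul, hyU, hU] at this
    simp at this
    exact this.1
  have h3 := Nat.div_add_mod (y j) (x0 j)
  have h4 := Nat.mod_lt (y j) hpos
  rw [mul_comm] at h3
  have h5 : z j = y j % x0 j := by omega
  rcases Nat.eq_zero_or_pos (z j) with h6 | h6
  · exact Nat.dvd_of_mod_eq_zero (h5 ▸ h6)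
  · have := hmin z hz h2 h6
    omega

end LocMon

section LocalDatum

variable {r : ℕ} {K : Type*} [Field K] {c : ℕ} {j : Fin r} {N : AddSubmonoid (Fin r →₀ ℕ)}

noncomputable instance faceAlgebra : Algebra (monAlg K (faceMon j N)) (monAlg K N) :=
  (Subalgebra.inclusion (monAlg_mono (faceMon_le j N))).toRingHom.toAlgebra

theorem algebraMap_face_coe (b : monAlg K (faceMon j N)) :
    ((algebraMap (monAlg K (faceMon j N)) (monAlg K N) b : monAlg K N) :
      MvPolynomial (Fin r) K) = b := rfl

theorem algebraMap_face_monElt (y : faceMon j N) :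
    algebraMap (monAlg K (faceMon j N)) (monAlg K N) (monElt K y) =
      monElt K ⟨y, faceMon_le j N y.2⟩ := rfl

theorem algebraMap_face_injective :
    Function.Injective (algebraMap (monAlg K (faceMon j N)) (monAlg K N)) :=
  Subalgebra.inclusion_injective _

theorem LocMon.nsmul_mem (h : LocMon c j N) {x : Fin r →₀ ℕ} (hx : ∀ i, j < i → x i = 0) :
    c • x ∈ N := by
  have : c • x = ∑ i, x i • Finsupp.single i c := by
    ext l
    rw [Finsupp.finsetSum_apply, Finset.sum_eq_single l]
    · simp [mul_comm]
    · intro b _ hb; simp [hb]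
    · simp
  rw [this]
  refine N.sum_mem fun i _ => ?_
  by_cases hi : j < i
  · rw [hx i hi, zero_smul]; exact N.zero_mem
  · exact N.nsmul_mem (h.single_mem i (not_lt.1 hi)) _

/-- The coordinates below `j` whose monomials are units at `𝔪`. -/
def unitCoords (c : ℕ) (𝔪 : Ideal (monAlg K (faceMon j N))) : Set (Fin r) :=
  {i | i < j ∧ ∀ h, monElt K (⟨Finsupp.single i c, h⟩ : faceMon j N) ∉ 𝔪}

variable {𝔪 : Ideal (monAlg K (faceMon j N))}

theorem LocMon.monElt_notMem [h𝔪 : 𝔪.IsPrime] (h : LocMon c j N) (x : faceMon j N)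
    (hx : outerWt j (unitCoords c 𝔪) x = 0) : monElt K x ∉ 𝔪 := by
  rw [outerWt_eq_zero] at hx
  have key : ∀ (s : Finset (Fin r)) (y : Fin r →₀ ℕ) (hy : y ∈ faceMon j N),
      y = ∑ i ∈ s, (x : Fin r →₀ ℕ) i • Finsupp.single i c → monElt K (⟨y, hy⟩ : faceMon j N) ∉ 𝔪 := by
    classical
    intro s
    induction s using Finset.induction_on with
    | empty =>
      intro y hy hye
      have : (⟨y, hy⟩ : faceMon j N) = 0 := Subtype.ext (by simpa using hye)
      rw [this, monElt_zero]
      exact (Ideal.ne_top_iff_one _).1 h𝔪.ne_top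
    | insert i s hi ih =>
      intro y hy hye
      rw [Finset.sum_insert hi] at hye
      by_cases hxi : (x : Fin r →₀ ℕ) i = 0
      · rw [hxi, zero_smul, zero_add] at hye
        exact ih y hy hye
      have hij : i ≠ j := fun hh => hxi (hh ▸ x.2.2)
      have hiU : i ∈ unitCoords c 𝔪 := by
        by_contra hc
        exact hxi (hx i hij hc)
      have h1 : Finsupp.single i c ∈ faceMon j N :=
        ⟨h.single_mem i hiU.1.le, by simp [hij]⟩
      have h2 : ∑ l ∈ s, (x : Fin r →₀ ℕ) l • Finsupp.single l c ∈ faceMon j N := by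
        refine AddSubmonoid.sum_mem _ fun l _ => ?_
        by_cases hl : (x : Fin r →₀ ℕ) l = 0
        · rw [hl, zero_smul]; exact AddSubmonoid.zero_mem _
        · have hlj : l ≤ j := not_lt.1 fun hh => hl (h.supp x x.2.1 l hh)
          have hlj' : l ≠ j := fun hh => hl (hh ▸ x.2.2)
          have hls : Finsupp.single l c ∈ faceMon j N :=
            ⟨h.single_mem l hlj, by simp [hlj']⟩
          exact AddSubmonoid.nsmul_mem _ hls _
      have : (⟨y, hy⟩ : faceMon j N) = (x : Fin r →₀ ℕ) i • ⟨_, h1⟩ + ⟨_, h2⟩ :=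
        Subtype.ext hye
      rw [this, monElt_add, monElt_nsmul]
      intro hm
      rcases h𝔪.mem_or_mem hm with hm | hm
      · exact hiU.2 _ (h𝔪.mem_of_pow_mem _ hm)
      · exact ih _ _ rfl hm
  intro hm
  refine key Finset.univ (c • (x : Fin r →₀ ℕ)) (AddSubmonoid.nsmul_mem _ x.2 c) ?_ ?_
  · ext l
    rw [Finsupp.finsetSum_apply, Finset.sum_eq_single l]
    · simp [mul_comm]
    · intro b _ hb; simp [hb]
    · simp
  · have : (⟨c • (x : Fin r →₀ ℕ), AddSubmonoid.nsmul_mem _ x.2 c⟩ : faceMon j N) = c • x := rfl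
    rw [this, monElt_nsmul]
    exact Ideal.pow_mem_of_mem _ hm _ h.pos

variable {B A : Type*} [CommRing B] [CommRing A]
  [Algebra (monAlg K (faceMon j N)) B] [Algebra (monAlg K N) A] [Algebra B A]

/-- Monomials of `N` in a localization. -/
noncomputable def locMon (A : Type*) [CommRing A] [Algebra (monAlg K N) A] (y : N) : A :=
  algebraMap (monAlg K N) A (monElt K y)

theorem locMon_add (y z : N) : locMon A (K := K) (y + z) = locMon A (K := K) y * locMon A (K := K) z := by
  rw [locMon, monElt_add, map_mul, locMon, locMon]

theorem mem_span_locMon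
    (hcomm : ∀ b : monAlg K (faceMon j N), algebraMap B A (algebraMap _ B b) =
      algebraMap (monAlg K N) A (algebraMap _ _ b)) {T : Set (Fin r →₀ ℕ)}
    {p : MvPolynomial (Fin r) K} (hp : p ∈ monAlg K N) (hT : SuppIn T p) :
    algebraMap (monAlg K N) A ⟨p, hp⟩ ∈
      Submodule.span B (locMon A (K := K) '' {y : N | (y : Fin r →₀ ℕ) ∈ T}) := by
  have hTN : SuppIn ((N : Set (Fin r →₀ ℕ)) ∩ T) p := fun x hx => ⟨hp x hx, hT x hx⟩
  refine SuppIn.induction (T := (N : Set (Fin r →₀ ℕ)) ∩ T)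
    (P := fun p => ∀ hp : p ∈ monAlg K N, algebraMap (monAlg K N) A ⟨p, hp⟩ ∈
      Submodule.span B (locMon A (K := K) '' {y : N | (y : Fin r →₀ ℕ) ∈ T})) ?_ ?_ ?_ hTN hp
  · intro x hx a _
    have : (⟨monomial x a, monomial_mem_monAlg hx.1 a⟩ : monAlg K N) =
        algebraMap _ _ (algebraMap K (monAlg K (faceMon j N)) a) * monElt K ⟨x, hx.1⟩ := by
      apply Subtype.ext
      change monomial x a = C a * monomial x 1
      rw [C_mul_monomial, mul_one]
    rw [this, map_mul, ← hcomm, ← Algebra.smul_def]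
    exact Submodule.smul_mem _ _ (Submodule.subset_span ⟨⟨x, hx.1⟩, hx.2, rfl⟩)
  · intro hp
    have : (⟨0, hp⟩ : monAlg K N) = 0 := rfl
    rw [this, map_zero]; exact Submodule.zero_mem _
  · intro p q hp hq h1 h2 _
    have hp' : p ∈ monAlg K N := fun x hx => (hp x hx).1
    have hq' : q ∈ monAlg K N := fun x hx => (hq x hx).1
    have : (⟨p + q, Subalgebra.add_mem _ hp' hq'⟩ : monAlg K N) = ⟨p, hp'⟩ + ⟨q, hq'⟩ := rfl
    rw [this, map_add]
    exact Submodule.add_mem _ (h1 hp') (h2 hq')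

variable [IsLocalRing B] [h𝔪 : 𝔪.IsPrime] [IsLocalization.AtPrime B 𝔪]
  [IsLocalization (Algebra.algebraMapSubmonoid (monAlg K N) 𝔪.primeCompl) A]

theorem LocMon.exists_eps (h : LocMon c j N)
    (hcomm : ∀ b : monAlg K (faceMon j N), algebraMap B A (algebraMap _ B b) =
      algebraMap (monAlg K N) A (algebraMap _ _ b))
    {x0 : Fin r →₀ ℕ} (h0 : x0 ∈ N) (hU : outerWt j (unitCoords c 𝔪) x0 = 0) (hpos : 0 < x0 j)
    (hmin : ∀ x ∈ N, outerWt j (unitCoords c 𝔪) x = 0 → 0 < x j → x0 j ≤ x j)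
    (hT : c • x0.erase j ∈ faceMon j N) :
    ∃ eps : A →+* Polynomial (IsLocalRing.ResidueField B),
      (∀ b, eps (algebraMap B A b) = Polynomial.C (IsLocalRing.residue B b)) ∧
      eps (locMon A (K := K) ⟨x0, h0⟩) = Polynomial.C (IsLocalRing.residue B
        (algebraMap _ B (monElt K (⟨_, hT⟩ : faceMon j N)))) * Polynomial.X ∧
      ∀ y : N, outerWt j (unitCoords c 𝔪) y ≠ 0 → eps (locMon A (K := K) y) = 0 := by
  classical
  let ρ : monAlg K (faceMon j N) →+* IsLocalRing.ResidueField B :=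
    (IsLocalRing.residue B).comp (algebraMap _ B)
  let β : (Fin r →₀ ℕ) → IsLocalRing.ResidueField B := fun k =>
    if hk : k ∈ faceMon j N then ρ (monElt K ⟨k, hk⟩) else 0
  have hβ : ∀ k l, k ∈ faceMon j N → l ∈ faceMon j N → β (k + l) = β k * β l := by
    intro k l hk hl
    simp only [β, dif_pos hk, dif_pos hl, dif_pos (AddSubmonoid.add_mem _ hk hl)]
    rw [← map_mul, ← monElt_add]; rfl
  let Z : (Fin r →₀ ℕ) → (Fin r →₀ ℕ) := fun y =>
    (y + (y j / x0 j * (c - 1)) • x0).erase j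
  have hZ : ∀ y ∈ N, outerWt j (unitCoords c 𝔪) y = 0 → Z y ∈ faceMon j N := by
    intro y hy hy0
    obtain ⟨z, hz, hze⟩ := h.exists_trade h0 hy (y j / x0 j) (Nat.div_mul_le_self _ _)
    have h1 := h.trade_apply hze
    rw [Nat.div_mul_cancel (h.dvd_of_min h0 hU hpos hmin hy hy0)] at h1
    have : Z y = z := by
      ext l
      rcases eq_or_ne l j with rfl | hl
      · simp [Z]; omega
      · have := DFunLike.congr_fun hze l
        simp [hl.symm] at this
        simp [Z, hl, this]
    rw [this]
    exact ⟨hz, by omega⟩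
  let φ : N → Polynomial (IsLocalRing.ResidueField B) := fun y =>
    if outerWt j (unitCoords c 𝔪) y = 0 then
      Polynomial.C (β (Z y)) * Polynomial.X ^ ((y : Fin r →₀ ℕ) j / x0 j) else 0
  have hβ0 : β 0 = 1 := by
    simp only [β, dif_pos (AddSubmonoid.zero_mem (faceMon j N))]
    have : (⟨0, AddSubmonoid.zero_mem (faceMon j N)⟩ : faceMon j N) = 0 := rfl
    rw [this, monElt_zero, map_one]
  obtain ⟨F, hF1, hF2⟩ := exists_monAlg_ringHom (N := N)
    ((Polynomial.C.comp ρ).comp (algebraMap K (monAlg K (faceMon j N)))) φ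
    (by simp [φ, Z, hβ0]) (by
      intro y z
      by_cases hy : outerWt j (unitCoords c 𝔪) y = 0
      · by_cases hz : outerWt j (unitCoords c 𝔪) z = 0
        · have hd := h.dvd_of_min h0 hU hpos hmin y.2 hy
          have hyz : outerWt j (unitCoords c 𝔪) ((y + z : N) : Fin r →₀ ℕ) = 0 := by
            rw [AddSubmonoid.coe_add, map_add, hy, hz]
          have h1 : Z ((y + z : N) : Fin r →₀ ℕ) = Z y + Z z := by
            simp only [Z, AddSubmonoid.coe_add, Finsupp.add_apply]
            rw [Nat.add_div_of_dvd_right hd, ← Finsupp.erase_add, add_mul, add_smul]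
            congr 1
            abel
          simp only [φ]
          rw [if_pos hyz, if_pos hy, if_pos hz, h1, hβ _ _ (hZ y y.2 hy) (hZ z z.2 hz),
            AddSubmonoid.coe_add, Finsupp.add_apply, Nat.add_div_of_dvd_right hd, pow_add, map_mul]
          ring
        · simp [φ, hz]
      · simp [φ, hy])
  have hF3 : ∀ b : monAlg K (faceMon j N), F (algebraMap _ _ b) = Polynomial.C (ρ b) := by
    intro b
    refine DFunLike.congr_fun (monAlg_ringHom_ext (f := F.comp (algebraMap _ (monAlg K N)))
      (g := Polynomial.C.comp ρ) (fun a => ?_) (fun y => ?_)) b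
    · exact hF1 a
    · rw [RingHom.comp_apply, algebraMap_face_monElt, hF2]
      have hyj : (y : Fin r →₀ ℕ) j = 0 := y.2.2
      have hZy : Z (y : Fin r →₀ ℕ) = y := by
        ext l
        rcases eq_or_ne l j with rfl | hl
        · simp [Z, hyj]
        · simp [Z, hyj]
      simp only [φ, hyj, Nat.zero_div, pow_zero, mul_one, hZy, β, dif_pos y.2]
      split_ifs with hw
      · rfl
      · rw [outerWt_eq_zero] at hw
        push Not at hw
        obtain ⟨i, hij, hiU, hi⟩ := hw
        have hij' : i < j := by
          by_contra hc
          exact hi (h.supp _ y.2.1 i (lt_of_le_of_ne (not_lt.1 hc) hij.symm))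
        have hiU' : ∃ hh, monElt K (⟨Finsupp.single i c, hh⟩ : faceMon j N) ∈ 𝔪 := by
          by_contra hc
          push Not at hc
          exact hiU ⟨hij', hc⟩
        obtain ⟨hh, hm⟩ := hiU'
        have hym : monElt K y ∈ 𝔪 := by
          have h1 : c • (y : Fin r →₀ ℕ) - Finsupp.single i c + Finsupp.single i c = c • y := by
            apply tsub_add_cancel_of_le
            rw [Finsupp.single_le_iff]
            simp only [Finsupp.smul_apply, smul_eq_mul]
            exact Nat.le_mul_of_pos_right _ (Nat.pos_of_ne_zero hi)
          have h2 : c • (y : Fin r →₀ ℕ) - Finsupp.single i c =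
              c • ((y : Fin r →₀ ℕ) - Finsupp.single i 1) := by
            ext l
            by_cases hl : i = l
            · subst hl; simp [Nat.mul_sub]
            · simp [hl]
          have h3 : c • ((y : Fin r →₀ ℕ) - Finsupp.single i 1) ∈ faceMon j N := by
            refine ⟨h.nsmul_mem fun l hl => ?_, ?_⟩
            · simp [h.supp _ y.2.1 l hl]
            · simp [hyj]
          refine h𝔪.mem_of_pow_mem c ?_
          rw [← monElt_nsmul]
          have : c • y = ⟨_, h3⟩ + ⟨_, hh⟩ := Subtype.ext (h1.symm.trans (by rw [h2]; rfl))
          rw [this, monElt_add]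
          exact Ideal.mul_mem_left _ _ hm
        rw [RingHom.comp_apply]
        have : ρ (monElt K y) = 0 := by
          rw [RingHom.comp_apply, IsLocalRing.residue_eq_zero_iff]
          exact (IsLocalization.AtPrime.to_map_mem_maximal_iff B 𝔪 _).2 hym
        rw [this, map_zero]
  have hunit : ∀ s : Algebra.algebraMapSubmonoid (monAlg K N) 𝔪.primeCompl,
      IsUnit (F (s : monAlg K N)) := by
    rintro ⟨_, b, hb, rfl⟩
    change IsUnit (F (algebraMap _ _ b))
    rw [hF3]
    refine ((IsLocalization.map_units B (⟨b, hb⟩ : 𝔪.primeCompl)).map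
      (Polynomial.C.comp (IsLocalRing.residue B)))
  let G := IsLocalization.lift (S := A) hunit
  have hG : ∀ p, G (algebraMap (monAlg K N) A p) = F p := fun p => IsLocalization.lift_eq _ _
  refine ⟨G, fun b => ?_, ?_, fun y hy => ?_⟩
  · refine DFunLike.congr_fun (IsLocalization.ringHom_ext 𝔪.primeCompl
      (j := G.comp (algebraMap B A)) (k := Polynomial.C.comp (IsLocalRing.residue B)) ?_) b
    ext1 b
    rw [RingHom.comp_apply, RingHom.comp_apply, hcomm, hG, hF3]; rfl
  · rw [locMon, hG, hF2]
    simp only [φ, hU, if_true, Nat.div_self hpos, pow_one]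
    congr 2
    have : Z x0 = c • x0.erase j := by
      have : x0 + (c - 1) • x0 = c • x0 := by
        obtain ⟨c', hc⟩ : ∃ c', c = c' + 1 := ⟨c - 1, by have := h.pos; omega⟩
        subst hc
        rw [Nat.add_sub_cancel, succ_nsmul, add_comm]
      simp only [Z, Nat.div_self hpos, one_mul, this]
      ext l
      rcases eq_or_ne l j with rfl | hl
      · simp
      · simp [hl]
    simp only [β, this, dif_pos hT]
    rfl
  · rw [locMon, hG, hF2]
    simp only [φ, if_neg hy]

end LocalDatum

section LocalDatum

variable {r : ℕ} {K : Type*} [Field K] {c : ℕ} {j : Fin r} {N : AddSubmonoid (Fin r →₀ ℕ)}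

theorem LocMon.trade_eq (h : LocMon c j N) {x0 y z : Fin r →₀ ℕ} {q : ℕ}
    (hz : z + (q * x0 j) • Finsupp.single j c = y + (q * (c - 1)) • x0) :
    z + q • x0 = y + q • c • x0.erase j := by
  have h1 := h.trade_apply hz
  obtain ⟨c', hc⟩ : ∃ c', c = c' + 1 := ⟨c - 1, by have := h.pos; omega⟩
  subst hc
  ext l
  rcases eq_or_ne l j with rfl | hl
  · simpa using h1
  · have := DFunLike.congr_fun hz l
    simp [hl.symm] at this
    simp [hl, this]
    ring

theorem LocMon.exists_horrocksDatum (𝔪 : Ideal (monAlg K (faceMon j N))) {B A : Type*} [CommRing B] [CommRing A]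
  [Algebra (monAlg K (faceMon j N)) B] [Algebra (monAlg K N) A] [Algebra B A]
  [IsLocalRing B] [h𝔪 : 𝔪.IsPrime] [IsLocalization.AtPrime B 𝔪]
  [IsLocalization (Algebra.algebraMapSubmonoid (monAlg K N) 𝔪.primeCompl) A]
  (h : LocMon c j N)
    (hcomm : ∀ b : monAlg K (faceMon j N), algebraMap B A (algebraMap _ B b) =
      algebraMap (monAlg K N) A (algebraMap _ _ b)) :
    ∃ H : HorrocksDatum B A N, ∀ (n : ℕ) (g : MvPolynomial (Fin r) K) (hg : g ∈ monAlg K N),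
      VarMonic j (c * n) g → ∃ (b : B) (D : ℕ), IsUnit b ∧
        H.IsMon D (b • algebraMap (monAlg K N) A ⟨g, hg⟩) := by
  classical
  obtain ⟨x0, h0, hU, hpos, hmin⟩ := h.exists_min (unitCoords c 𝔪)
  have hT : c • x0.erase j ∈ faceMon j N := by
    refine ⟨h.nsmul_mem fun i hi => ?_, by simp⟩
    simp [Finsupp.erase, h.supp x0 h0 i hi, hi.ne']
  have hTunit : monElt K (⟨_, hT⟩ : faceMon j N) ∉ 𝔪 := by
    refine h.monElt_notMem _ ?_
    rw [outerWt_eq_zero] at hU ⊢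
    intro i hi hiU
    simp [hi, hU i hi hiU]
  obtain ⟨eps, heps1, heps2, heps3⟩ := h.exists_eps hcomm h0 hU hpos hmin hT
  obtain ⟨b0, hb0⟩ := (IsLocalization.map_units B (⟨_, hTunit⟩ : 𝔪.primeCompl)).exists_left_inv
  change b0 * algebraMap _ B (monElt K (⟨_, hT⟩ : faceMon j N)) = 1 at hb0
  let u : A := b0 • locMon A (K := K) (⟨x0, h0⟩ : N)
  have hlocT : locMon A (K := K) (⟨_, hT.1⟩ : N) =
      algebraMap B A (algebraMap _ B (monElt K (⟨_, hT⟩ : faceMon j N))) := by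
    rw [hcomm]; rfl
  have hpow : ∀ (q : ℕ) (y : N), locMon A (K := K) (q • y) = locMon A (K := K) y ^ q := by
    intro q y; rw [locMon, monElt_nsmul, map_pow]; rfl
  have htrade : ∀ (q : ℕ) (y z : N), (z : Fin r →₀ ℕ) + (q * x0 j) • Finsupp.single j c =
      y + (q * (c - 1)) • x0 → locMon A (K := K) y = u ^ q * locMon A (K := K) z := by
    intro q y z hz
    have h1 := h.trade_eq hz
    have h2 : z + q • (⟨x0, h0⟩ : N) = y + q • ⟨_, hT.1⟩ := Subtype.ext h1
    have h3 := congrArg (locMon A (K := K)) h2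
    rw [locMon_add, locMon_add, hpow, hpow, hlocT] at h3
    simp only [u, Algebra.smul_def]
    rw [mul_pow, mul_assoc, mul_comm (locMon A _ ^ q), h3, mul_comm, mul_assoc, ← mul_pow,
      ← map_mul, mul_comm, mul_comm _ b0, hb0]
    simp
  have hface : ∀ z : N, (z : Fin r →₀ ℕ) j = 0 → ∀ hz : (z : Fin r →₀ ℕ) ∈ faceMon j N,
      locMon A (K := K) z = algebraMap B A (algebraMap _ B (monElt K (⟨z, hz⟩ : faceMon j N))) := by
    intro z _ hz
    rw [hcomm]; rfl
  refine ⟨{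
    mon := locMon A (K := K)
    deg := (Finsupp.applyAddHom j).comp N.subtype
    wt := (outerWt j (unitCoords c 𝔪)).comp N.subtype
    u := u
    step := x0 j
    bound := r * c + 1
    eps := eps
    mon_zero := by rw [locMon, monElt_zero, map_one]
    mon_add := locMon_add
    step_pos := hpos
    span_mon := ?_
    exists_step := ?_
    u_eq := ⟨b0, ⟨x0, h0⟩, rfl, rfl⟩
    mem_of_bound := ?_
    low := ?_
    fg_low := ?_
    eps_algebraMap := heps1
    eps_u := ?_
    eps_mon := heps3 }, ?_⟩
  · rw [eq_top_iff]
    intro a _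
    obtain ⟨⟨p, ⟨_, s, hs, rfl⟩⟩, ha⟩ :=
      IsLocalization.surj (Algebra.algebraMapSubmonoid (monAlg K N) 𝔪.primeCompl) a
    obtain ⟨b, hb⟩ := (IsLocalization.map_units B (⟨s, hs⟩ : 𝔪.primeCompl)).exists_left_inv
    change a * algebraMap (monAlg K N) A (algebraMap _ _ s) = algebraMap _ _ p at ha
    change b * algebraMap _ B s = 1 at hb
    have h1 := mem_span_locMon (A := A) hcomm p.2 (T := Set.univ) (fun _ _ => trivial)
    have h2 : a = b • algebraMap (monAlg K N) A ⟨p, p.2⟩ := by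
      change a = b • algebraMap (monAlg K N) A p
      rw [← ha, ← hcomm, Algebra.smul_def, mul_left_comm, ← map_mul, hb, map_one, mul_one]
    rw [h2]
    refine Submodule.smul_mem _ _ (Submodule.span_mono ?_ h1)
    exact Set.image_subset_range _ _
  · intro y hy
    obtain ⟨z, hz, hze⟩ := h.exists_trade h0 y.2 1 (by simpa using hy)
    refine ⟨⟨z, hz⟩, ?_, ?_, ?_⟩
    · have := h.trade_apply hze
      rw [one_mul] at this
      exact this
    · have := congrArg (outerWt j (unitCoords c 𝔪)) hze
      rw [map_add, map_add, map_nsmul, map_nsmul, hU] at this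
      have h2 : outerWt j (unitCoords c 𝔪) (Finsupp.single j c) = 0 := by
        rw [outerWt_eq_zero]
        intro i hi _
        simp [hi.symm]
      rw [h2] at this
      simpa using this
    · have := htrade 1 y ⟨z, hz⟩ hze
      rwa [pow_one] at this
  · intro y hy
    obtain ⟨i, hij, hiU, hi⟩ := exists_lt_of_outerWt hy
    have hij' : i < j := by
      by_contra hc
      have := h.supp _ y.2 i (lt_of_le_of_ne (not_lt.1 hc) hij.symm)
      change c < (y : Fin r →₀ ℕ) i at hi
      omega
    have hiU' : ∃ hh, monElt K (⟨Finsupp.single i c, hh⟩ : faceMon j N) ∈ 𝔪 := by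
      by_contra hc
      push Not at hc
      exact hiU ⟨hij', hc⟩
    obtain ⟨hh, hm⟩ := hiU'
    change c < (y : Fin r →₀ ℕ) i at hi
    have h1 : (y : Fin r →₀ ℕ) - Finsupp.single i c + Finsupp.single i c = y := by
      apply tsub_add_cancel_of_le
      rw [Finsupp.single_le_iff]
      exact hi.le
    have h2 : (y : Fin r →₀ ℕ) - Finsupp.single i c ∈ N := by
      refine h.mem_of_add _ i (Or.inl ?_) (by rw [h1]; exact y.2)
      simp; omega
    have h3 : y = ⟨_, h2⟩ + ⟨Finsupp.single i c, hh.1⟩ := Subtype.ext h1.symm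
    rw [h3, locMon_add]
    refine Ideal.mul_mem_left _ _ ?_
    rw [hface _ hh.2 hh]
    exact Ideal.mem_map_of_mem _ ((IsLocalization.AtPrime.to_map_mem_maximal_iff B 𝔪 _).2 hm)
  · intro y hy hlt
    have hy0 : (y : Fin r →₀ ℕ) j = 0 := by
      by_contra hne
      exact absurd (hmin y y.2 hy (Nat.pos_of_ne_zero hne)) (not_le.2 hlt)
    exact ⟨_, hface y hy0 ⟨y.2, hy0⟩⟩
  · intro n
    have hfin : {z : N | (∀ i, (z : Fin r →₀ ℕ) i ≤ max c n) ∧ (z : Fin r →₀ ℕ) j < n}.Finite := by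
      refine Set.Finite.subset ((finite_setOf_le fun _ : Fin r => max c n).preimage
        (Subtype.val_injective (p := fun x => x ∈ N)).injOn) ?_
      intro z hz; exact hz.1
    refine ⟨(hfin.image (locMon A (K := K))).toFinset, ?_⟩
    rw [Set.Finite.coe_toFinset]
    apply le_antisymm
    · exact Submodule.span_mono (Set.image_mono fun z hz => hz.2)
    · rw [Submodule.span_le]
      rintro _ ⟨y, hy, rfl⟩
      change (y : Fin r →₀ ℕ) j < n at hy
      obtain ⟨z, hz, k, hz1, hk, hye⟩ := exists_reduce h.pos (J := {i | i ≠ j}) (N := N)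
        (fun x i _ hx hxN => h.mem_of_add x i (Or.inl hx) hxN) y y.2
      have hkj : k j = 0 := hk j (by simp)
      have hkf : c • k ∈ faceMon j N := by
        refine ⟨h.nsmul_mem fun i hi => ?_, by simp [hkj]⟩
        have h1 : z i + c * k i = 0 := by
          have := DFunLike.congr_fun hye i
          rw [h.supp _ y.2 i hi] at this
          simpa using this.symm
        have h2 : c * k i = 0 := by omega
        exact (mul_eq_zero.1 h2).resolve_left h.pos.ne'
      have hzj : z j = (y : Fin r →₀ ℕ) j := by rw [hye]; simp [hkj]
      have h3 : y = ⟨_, hz⟩ + ⟨_, hkf.1⟩ := Subtype.ext hye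
      rw [h3, locMon_add, hface (⟨_, hkf.1⟩ : N) hkf.2 hkf, mul_comm, ← Algebra.smul_def]
      refine Submodule.smul_mem _ _ (Submodule.subset_span ⟨_, ⟨fun i => ?_, ?_⟩, rfl⟩)
      · by_cases hi : i = j
        · subst hi; exact (hzj.trans_lt hy).le.trans (le_max_right _ _)
        · exact (hz1 i hi).trans (le_max_left _ _)
      · exact hzj.trans_lt hy
  · simp only [u, Algebra.smul_def, map_mul, heps1, heps2]
    rw [← mul_assoc, ← map_mul, ← map_mul, hb0, map_one, map_one, one_mul]
  · intro n g hg hmon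
    have hy : (n • Finsupp.single j c : Fin r →₀ ℕ) ∈ N :=
      N.nsmul_mem (h.single_mem j le_rfl) n
    have hye : (n • Finsupp.single j c : Fin r →₀ ℕ) = Finsupp.single j (c * n) := by
      rw [Finsupp.smul_single, smul_eq_mul, mul_comm]
    have hy0 : outerWt j (unitCoords c 𝔪) (n • Finsupp.single j c) = 0 := by
      rw [outerWt_eq_zero]
      intro i hi _
      simp [hi.symm]
    have hdvd := h.dvd_of_min h0 hU hpos hmin hy hy0
    have hD : (n • Finsupp.single j c : Fin r →₀ ℕ) j / x0 j * x0 j = c * n := by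
      rw [Nat.div_mul_cancel hdvd, hye]; simp
    obtain ⟨z, hz, hze⟩ := h.exists_trade h0 hy _ (Nat.div_mul_le_self _ _)
    have hzj := h.trade_apply hze
    rw [Nat.div_mul_cancel hdvd] at hzj
    have hzj0 : z j = 0 := by omega
    have hz0 : outerWt j (unitCoords c 𝔪) z = 0 := by
      have := congrArg (outerWt j (unitCoords c 𝔪)) hze
      rw [map_add, map_add, hy0, map_nsmul, map_nsmul, hU] at this
      simp at this
      exact this.1
    have hzm : monElt K (⟨z, hz, hzj0⟩ : faceMon j N) ∉ 𝔪 := h.monElt_notMem _ hz0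
    have hzu := IsLocalization.map_units B (⟨_, hzm⟩ : 𝔪.primeCompl)
    obtain ⟨b, hb⟩ := hzu.exists_left_inv
    change b * algebraMap _ B (monElt K (⟨z, hz, hzj0⟩ : faceMon j N)) = 1 at hb
    refine ⟨b, (n • Finsupp.single j c : Fin r →₀ ℕ) j / x0 j, IsUnit.of_mul_eq_one _ hb, ?_⟩
    have htr := htrade _ ⟨_, hy⟩ ⟨z, hz⟩ hze
    rw [hface ⟨z, hz⟩ hzj0 ⟨hz, hzj0⟩] at htr
    have hlow : g - X j ^ (c * n) ∈ monAlg K N := by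
      refine Subalgebra.sub_mem _ hg ?_
      rw [X_pow_eq_monomial, ← hye]
      exact monomial_mem_monAlg hy 1
    have hmem := mem_span_locMon (A := A) hcomm hlow hmon
    have hsplit : (⟨g, hg⟩ : monAlg K N) = monElt K ⟨_, hy⟩ + ⟨_, hlow⟩ := by
      apply Subtype.ext
      change g = monomial _ 1 + (g - X j ^ (c * n))
      rw [X_pow_eq_monomial, ← hye]
      ring
    have hfin : b • algebraMap (monAlg K N) A ⟨g, hg⟩ -
        u ^ ((n • Finsupp.single j c : Fin r →₀ ℕ) j / x0 j) =
        b • algebraMap (monAlg K N) A ⟨_, hlow⟩ := by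
      rw [hsplit, map_add, smul_add]
      have : b • algebraMap (monAlg K N) A (monElt K ⟨_, hy⟩) =
          u ^ ((n • Finsupp.single j c : Fin r →₀ ℕ) j / x0 j) := by
        change b • locMon A (K := K) _ = _
        rw [htr, Algebra.smul_def, mul_left_comm, ← map_mul, hb, map_one, mul_one]
      rw [this, add_sub_cancel_left]
    change b • algebraMap (monAlg K N) A ⟨g, hg⟩ -
        u ^ ((n • Finsupp.single j c : Fin r →₀ ℕ) j / x0 j) ∈ Submodule.span B _
    rw [hfin]
    refine Submodule.smul_mem _ _ (Submodule.span_mono (Set.image_mono ?_) hmem)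
    intro y hy
    change (y : Fin r →₀ ℕ) j < _ * x0 j
    rw [hD]
    exact hy

end LocalDatum

section LocalFrames

variable {n : Type*} [Fintype n] [DecidableEq n]

theorem Matrix.map_smul_ringHom {A A' ι κ : Type*} [CommRing A] [CommRing A'] (f : A →+* A') (a : A)
    (Z : Matrix ι κ A) : (a • Z).map f = f a • Z.map f := by
  ext; simp

theorem exists_smul_eq_map {A' A m l : Type*} [CommRing A'] [CommRing A] [Algebra A' A]
    [Finite m] [Finite l] (M : Submonoid A') [IsLocalization M A] (X : Matrix m l A) :
    ∃ s ∈ M, ∃ X' : Matrix m l A', X'.map (algebraMap A' A) = algebraMap A' A s • X := by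
  obtain ⟨s, hs⟩ := IsLocalization.exist_integer_multiples_of_finite M
    (fun p : m × l => X p.1 p.2)
  choose f hf using hs
  refine ⟨s, s.2, Matrix.of fun i j => f (i, j), ?_⟩
  ext i j
  have := hf (i, j)
  change algebraMap A' A (f (i, j)) = algebraMap A' A s * X i j
  rw [this, Algebra.smul_def]

variable {r : ℕ} {K : Type*} [Field K] {c : ℕ} {j : Fin r} {N : AddSubmonoid (Fin r →₀ ℕ)}

theorem LocMon.exists_frame_aux (h : LocMon c j N) (𝔪 : Ideal (monAlg K (faceMon j N))) [𝔪.IsPrime]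
    (B A : Type*) [CommRing B] [CommRing A]
    [Algebra (monAlg K (faceMon j N)) B] [Algebra (monAlg K N) A] [Algebra B A]
    [IsLocalRing B] [IsDomain A] [IsLocalization.AtPrime B 𝔪]
    [IsLocalization (Algebra.algebraMapSubmonoid (monAlg K N) 𝔪.primeCompl) A]
    (hcomm : ∀ b : monAlg K (faceMon j N), algebraMap B A (algebraMap _ B b) =
      algebraMap (monAlg K N) A (algebraMap _ _ b))
    (hinj : Function.Injective (algebraMap (monAlg K N) A))
    {k m : ℕ} {e : Matrix n n (monAlg K N)} (he : e * e = e) {X : Matrix n (Fin k) (monAlg K N)}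
    {Y : Matrix (Fin k) n (monAlg K N)} {g : monAlg K N} (hg : VarMonic j (c * m) g.1)
    (hf : IsFrame e X Y g) :
    ∃ b ∉ 𝔪, ∃ (k' : ℕ) (X' : Matrix n (Fin k') (monAlg K N))
      (Y' : Matrix (Fin k') n (monAlg K N)),
      X' * Y' = algebraMap _ (monAlg K N) b • e ∧ Y' * X' = algebraMap _ (monAlg K N) b • 1 := by
  obtain ⟨H, hH⟩ := h.exists_horrocksDatum 𝔪 (B := B) (A := A) hcomm
  obtain ⟨b, D, hb, hD⟩ := hH m g.1 g.2 hg
  let f : monAlg K N →+* A := algebraMap _ _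
  have hfr : IsFrame (e.map f) (algebraMap B A b • X.map f) (Y.map f) (algebraMap B A b * f g) := by
    constructor
    · rw [Matrix.smul_mul, ← Matrix.map_mul, hf.mul_eq,
        show (g • e).map f = f g • e.map f from Matrix.map_smul_ringHom f g e, smul_smul]
    · rw [Matrix.mul_smul, ← Matrix.map_mul, hf.mul_eq',
        show (g • (1 : Matrix _ _ (monAlg K N))).map f = f g • (1 : Matrix _ _ _).map f from
          Matrix.map_smul_ringHom f g 1, smul_smul, Matrix.map_one _ f.map_zero f.map_one]
    · rw [Matrix.mul_smul, ← Matrix.map_mul, hf.left]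
    · rw [← Matrix.map_mul, hf.right]
  rw [← Algebra.smul_def] at hfr
  obtain ⟨k', X1, Y1, hXY, hYX⟩ := H.isFreeIdem_of_isFrame
    (by rw [← Matrix.map_mul, he]) hfr hD
  obtain ⟨_, ⟨s, hs, rfl⟩, X2, hX2⟩ := exists_smul_eq_map
    (Algebra.algebraMapSubmonoid (monAlg K N) 𝔪.primeCompl) X1
  obtain ⟨_, ⟨t, ht, rfl⟩, Y2, hY2⟩ := exists_smul_eq_map
    (Algebra.algebraMapSubmonoid (monAlg K N) 𝔪.primeCompl) Y1
  refine ⟨s * t, 𝔪.primeCompl.mul_mem hs ht, k', X2, Y2, ?_, ?_⟩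
  · apply Matrix.map_injective hinj
    refine (Matrix.map_mul (f := f)).trans (Eq.trans ?_ (Matrix.map_smul_ringHom f _ e).symm)
    change X2.map (algebraMap (monAlg K N) A) * Y2.map (algebraMap (monAlg K N) A) = _
    rw [hX2, hY2, Matrix.smul_mul, Matrix.mul_smul, hXY, smul_smul, map_mul, map_mul]
  · apply Matrix.map_injective hinj
    refine (Matrix.map_mul (f := f)).trans (Eq.trans ?_ (Matrix.map_smul_ringHom f _ 1).symm)
    change Y2.map (algebraMap (monAlg K N) A) * X2.map (algebraMap (monAlg K N) A) = _
    rw [hX2, hY2, Matrix.smul_mul, Matrix.mul_smul, hYX, smul_smul, map_mul, map_mul,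
      Matrix.map_one _ f.map_zero f.map_one, mul_comm]

theorem LocMon.exists_frame (h : LocMon c j N) (𝔪 : Ideal (monAlg K (faceMon j N))) [𝔪.IsPrime]
    {k m : ℕ} {e : Matrix n n (monAlg K N)} (he : e * e = e) {X : Matrix n (Fin k) (monAlg K N)}
    {Y : Matrix (Fin k) n (monAlg K N)} {g : monAlg K N} (hg : VarMonic j (c * m) g.1)
    (hf : IsFrame e X Y g) :
    ∃ b ∉ 𝔪, ∃ (k' : ℕ) (X' : Matrix n (Fin k') (monAlg K N))
      (Y' : Matrix (Fin k') n (monAlg K N)),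
      X' * Y' = algebraMap _ (monAlg K N) b • e ∧ Y' * X' = algebraMap _ (monAlg K N) b • 1 := by
  let B := Localization.AtPrime 𝔪
  let A := Localization (Algebra.algebraMapSubmonoid (monAlg K N) 𝔪.primeCompl)
  let _ : Algebra B A := inferInstanceAs (Algebra (Localization 𝔪.primeCompl)
    (Localization (Algebra.algebraMapSubmonoid (monAlg K N) 𝔪.primeCompl)))
  have hM : Algebra.algebraMapSubmonoid (monAlg K N) 𝔪.primeCompl ≤ nonZeroDivisors _ := by
    rintro _ ⟨s, hs, rfl⟩
    refine mem_nonZeroDivisors_of_ne_zero fun h0 => hs ?_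
    rw [(map_eq_zero_iff _ algebraMap_face_injective).1 h0]
    exact 𝔪.zero_mem
  have : IsDomain A := IsLocalization.isDomain_of_le_nonZeroDivisors A hM
  have hinj : Function.Injective (algebraMap (monAlg K N) A) := IsLocalization.injective A hM
  have hcomm : ∀ b : monAlg K (faceMon j N), algebraMap B A (algebraMap _ B b) =
      algebraMap (monAlg K N) A (algebraMap _ _ b) := by
    intro b
    exact IsLocalization.map_eq _ _
  exact h.exists_frame_aux 𝔪 B A hcomm hinj he hg hf

end LocalFrames

section MatIn

variable {R S : Type*} [CommRing R] [CommRing S] [Algebra R S] {A A' : Subalgebra R S}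
variable {l m n : Type*}

/-- All the entries of the matrix `X` lie in `A`. -/
def MatIn (A : Subalgebra R S) (X : Matrix m n S) : Prop := ∀ i j, X i j ∈ A

theorem MatIn.mono (h : A ≤ A') {X : Matrix m n S} (hX : MatIn A X) : MatIn A' X :=
  fun i j => h (hX i j)

theorem MatIn.mul [Fintype m] {X : Matrix l m S} {Y : Matrix m n S} (hX : MatIn A X)
    (hY : MatIn A Y) : MatIn A (X * Y) := fun i j => by
  rw [Matrix.mul_apply]
  exact A.sum_mem fun x _ => A.mul_mem (hX i x) (hY x j)

theorem MatIn.add {X Y : Matrix m n S} (hX : MatIn A X) (hY : MatIn A Y) : MatIn A (X + Y) :=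
  fun i j => A.add_mem (hX i j) (hY i j)

theorem MatIn.smul {X : Matrix m n S} {a : S} (ha : a ∈ A) (hX : MatIn A X) : MatIn A (a • X) :=
  fun i j => A.mul_mem ha (hX i j)

theorem MatIn.map {X : Matrix m n S} (hX : MatIn A X) {S' : Type*} [CommRing S'] [Algebra R S']
    {A' : Subalgebra R S'} {f : S → S'} (h : ∀ a ∈ A, f a ∈ A') : MatIn A' (X.map f) :=
  fun i j => h _ (hX i j)

theorem matIn_map_val (X : Matrix m n A) : MatIn A (X.map A.val) := fun i j => (X i j).2

/-- The matrix with entries in `A` underlying a matrix all of whose entries lie in `A`. -/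
def MatIn.lift {X : Matrix m n S} (hX : MatIn A X) : Matrix m n A :=
  Matrix.of fun i j => ⟨X i j, hX i j⟩

/-- The images of the idempotent matrices `e₁` and `e₂` are isomorphic over `A`. -/
def MatConj [Fintype n] (A : Subalgebra R S) (e₁ e₂ : Matrix n n S) : Prop :=
  ∃ U V : Matrix n n S, MatIn A U ∧ MatIn A V ∧ U * V = e₁ ∧ V * U = e₂

theorem MatConj.refl [Fintype n] {e : Matrix n n S} (h : MatIn A e) (he : e * e = e) :
    MatConj A e e := ⟨e, e, h, h, he, he⟩

theorem MatConj.trans [Fintype n] {e₁ e₂ e₃ : Matrix n n S} (h : MatConj A e₁ e₂)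
    (h' : MatConj A e₂ e₃) (he₁ : e₁ * e₁ = e₁) (he₃ : e₃ * e₃ = e₃) : MatConj A e₁ e₃ := by
  obtain ⟨U, V, hU, hV, rfl, h2⟩ := h
  obtain ⟨U', V', hU', hV', h3, rfl⟩ := h'
  refine ⟨U * U', V' * V, hU.mul hU', hV'.mul hV, ?_, ?_⟩
  · calc U * U' * (V' * V) = U * (U' * V') * V := by simp only [Matrix.mul_assoc]
      _ = U * V * (U * V) := by rw [h3, ← h2]; simp only [Matrix.mul_assoc]
      _ = _ := he₁
  · calc V' * V * (U * U') = V' * (V * U) * U' := by simp only [Matrix.mul_assoc]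
      _ = V' * U' * (V' * U') := by rw [h2, ← h3]; simp only [Matrix.mul_assoc]
      _ = _ := he₃

end MatIn

section Patch

variable {r : ℕ} {K : Type*} [Field K] {j : Fin r} {N N₀ : AddSubmonoid (Fin r →₀ ℕ)}
variable {n : Type*} [Fintype n] [DecidableEq n]

theorem Matrix.exists_scaleVar_sub_scaleVar {R : Type*} [CommRing R] (j : Fin r)
    {m l : Type*} {a b : MvPolynomial (Fin r) R}
    (ha : a ∈ monAlg R N) (hb : b ∈ monAlg R N) {X : Matrix m l (MvPolynomial (Fin r) R)}
    (hX : MatIn (monAlg R N) X) :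
    ∃ Z : Matrix m l (MvPolynomial (Fin r) R), MatIn (monAlg R N) Z ∧ Z.map (scaleVar j 0) = 0 ∧
      X.map (scaleVar j a) = X.map (scaleVar j b) + (a - b) • Z := by
  choose z hz h0 h using fun i k => _root_.exists_scaleVar_sub_scaleVar j ha hb (hX i k)
  refine ⟨Matrix.of z, hz, ?_, ?_⟩
  · ext1 i k
    exact h0 i k
  · ext1 i k
    have := h i k
    simp only [Matrix.add_apply, Matrix.map_apply, Matrix.smul_apply, Matrix.of_apply, smul_eq_mul]
    rw [← this]; ring

omit [DecidableEq n] in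
theorem matConj_scaleVar_add {k : ℕ} {e : Matrix n n (MvPolynomial (Fin r) K)}
    (hm : MatIn (monAlg K N) e)
    {X : Matrix n (Fin k) (MvPolynomial (Fin r) K)} {Y : Matrix (Fin k) n (MvPolynomial (Fin r) K)}
    (hX : MatIn (monAlg K N) X) (hY : MatIn (monAlg K N) Y) {β : MvPolynomial (Fin r) K}
    (hβ : β ∈ monAlg K (faceMon j N)) (hβ0 : β ≠ 0) (hXY : X * Y = β • e) (hYX : Y * X = β • 1)
    {b a : MvPolynomial (Fin r) K} (hb : b ∈ monAlg K N) (ha : a ∈ monAlg K N) :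
    MatConj (monAlg K N) (e.map (scaleVar j (a + b * β))) (e.map (scaleVar j a)) := by
  have hβ' := monAlg_mono (R := K) (faceMon_le j N) hβ
  have hab : a + b * β ∈ monAlg K N := add_mem ha (mul_mem hb hβ')
  obtain ⟨ZX, hZX, -, h1⟩ := Matrix.exists_scaleVar_sub_scaleVar j hab ha hX
  obtain ⟨ZY, hZY, -, h2⟩ := Matrix.exists_scaleVar_sub_scaleVar j hab ha hY
  rw [show a + b * β - a = β * b by ring, mul_smul] at h1 h2
  have key : ∀ x, (X.map (scaleVar j x)) * (Y.map (scaleVar j x)) = β • e.map (scaleVar j x) ∧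
      (Y.map (scaleVar j x)) * (X.map (scaleVar j x)) = β • 1 := by
    intro x
    have e1 := congrArg (fun Z => Z.map (scaleVar j x)) hXY
    have e2 := congrArg (fun Z => Z.map (scaleVar j x)) hYX
    have hs := scaleVar_of_mem_face j x hβ
    constructor
    · have h3 := Matrix.map_smul_ringHom (scaleVar j x : _ →+* MvPolynomial (Fin r) K) β e
      rw [RingHom.coe_coe, hs] at h3
      rw [← Matrix.map_mul, hXY, h3]
    · have h3 := Matrix.map_smul_ringHom (scaleVar j x : _ →+* MvPolynomial (Fin r) K) β
        (1 : Matrix (Fin k) (Fin k) _)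
      rw [RingHom.coe_coe, hs, Matrix.map_one _ (map_zero _) (map_one _)] at h3
      rw [← Matrix.map_mul, hYX, h3]
  obtain ⟨k1, k2⟩ := key a
  obtain ⟨k3, k4⟩ := key (a + b * β)
  have mX := hX.map (f := scaleVar j a) fun x hx => scaleVar_mem j ha hx
  have mY := hY.map (f := scaleVar j a) fun x hx => scaleVar_mem j ha hx
  have me := hm.map (f := scaleVar j a) fun x hx => scaleVar_mem j ha hx
  generalize X.map (scaleVar j (a + b * β)) = X' at *
  generalize Y.map (scaleVar j (a + b * β)) = Y' at *
  generalize e.map (scaleVar j (a + b * β)) = e' at *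
  generalize X.map (scaleVar j a) = X₀ at *
  generalize Y.map (scaleVar j a) = Y₀ at *
  generalize e.map (scaleVar j a) = e₀ at *
  have hU : β • (e₀ + b • (ZX * Y₀)) = X' * Y₀ := by
    rw [smul_add, ← k1, h1, Matrix.add_mul, Matrix.smul_mul, Matrix.smul_mul]
  have hV : β • (e₀ + b • (X₀ * ZY)) = X₀ * Y' := by
    rw [smul_add, ← k1, h2, Matrix.mul_add, Matrix.mul_smul, Matrix.mul_smul]
  have inj := (smul_right_injective (Matrix n n (MvPolynomial (Fin r) K)) (mul_ne_zero hβ0 hβ0))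
  refine ⟨e₀ + b • (ZX * Y₀), e₀ + b • (X₀ * ZY), me.add ((hZX.mul mY).smul hb),
    me.add ((mX.mul hZY).smul hb), inj ?_, inj ?_⟩
  · calc (β * β) • ((e₀ + b • (ZX * Y₀)) * (e₀ + b • (X₀ * ZY)))
        = (β • (e₀ + b • (ZX * Y₀))) * (β • (e₀ + b • (X₀ * ZY))) := by
          rw [Matrix.smul_mul, Matrix.mul_smul, mul_smul]
      _ = X' * (Y₀ * X₀) * Y' := by rw [hU, hV]; simp only [Matrix.mul_assoc]
      _ = (β * β) • e' := by
          rw [k2, Matrix.mul_smul, Matrix.mul_one, Matrix.smul_mul, k3, mul_smul]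
  · calc (β * β) • ((e₀ + b • (X₀ * ZY)) * (e₀ + b • (ZX * Y₀)))
        = (β • (e₀ + b • (X₀ * ZY))) * (β • (e₀ + b • (ZX * Y₀))) := by
          rw [Matrix.smul_mul, Matrix.mul_smul, mul_smul]
      _ = X₀ * (Y' * X') * Y₀ := by rw [hU, hV]; simp only [Matrix.mul_assoc]
      _ = (β * β) • e₀ := by
          rw [k4, Matrix.mul_smul, Matrix.mul_one, Matrix.smul_mul, k1, mul_smul]

omit [DecidableEq n] in
theorem Matrix.map_mul_self {A B : Type*} [CommRing A] [CommRing B] {e : Matrix n n A}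
    (he : e * e = e) (f : A →+* B) : e.map f * e.map f = e.map f := by
  rw [← Matrix.map_mul, he]

omit [DecidableEq n] in
/-- Quillen patching for the contraction of the variable `j`. -/
theorem matConj_scaleVar_zero {e : Matrix n n (MvPolynomial (Fin r) K)}
    (hm : MatIn (monAlg K N) e) (he : e * e = e)
    (H : ∀ 𝔪 : Ideal (monAlg K (faceMon j N)), 𝔪.IsPrime → ∃ β ∉ 𝔪, ∃ (k : ℕ)
      (X : Matrix n (Fin k) (MvPolynomial (Fin r) K))
      (Y : Matrix (Fin k) n (MvPolynomial (Fin r) K)), MatIn (monAlg K N) X ∧ MatIn (monAlg K N) Y ∧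
        X * Y = β.1 • e ∧ Y * X = β.1 • 1) :
    MatConj (monAlg K N) e (e.map (scaleVar j 0)) := by
  have hid (x) : e.map (scaleVar j x) * e.map (scaleVar j x) = e.map (scaleVar j x) :=
    Matrix.map_mul_self he (scaleVar j x : MvPolynomial (Fin r) K →+* MvPolynomial (Fin r) K)
  have hB : monAlg K (faceMon j N) ≤ monAlg K N := monAlg_mono (faceMon_le j N)
  let J : Ideal (monAlg K (faceMon j N)) :=
    { carrier := {μ | ∀ b a : monAlg K (faceMon j N),
        MatConj (monAlg K N) (e.map (scaleVar j (a.1 + b.1 * μ.1))) (e.map (scaleVar j a.1))}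
      zero_mem' := fun b a => by
        rw [ZeroMemClass.coe_zero, mul_zero, add_zero]
        exact MatConj.refl (hm.map fun x hx => scaleVar_mem j (hB a.2) hx) (hid _)
      add_mem' := fun {x y} hx hy b a => by
        have := hy b (a + b * x)
        refine MatConj.trans ?_ (hx b a) (hid _) (hid _)
        convert this using 4
        · simp only [AddMemClass.coe_add, MulMemClass.coe_mul]; ring
        · simp only [AddMemClass.coe_add, MulMemClass.coe_mul]
      smul_mem' := fun d x hx b a => by
        convert hx (b * d) a using 4
        simp only [smul_eq_mul, MulMemClass.coe_mul]; ring }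
  have hJ : J = ⊤ := by
    by_contra hJ
    obtain ⟨𝔪, h𝔪, hle⟩ := Ideal.exists_le_maximal J hJ
    obtain ⟨β, hβ, k, X, Y, hX, hY, hXY, hYX⟩ := H 𝔪 h𝔪.isPrime
    refine hβ (hle fun b a => matConj_scaleVar_add hm hX hY β.2 ?_ hXY hYX (hB b.2) (hB a.2))
    intro h
    exact hβ (by rw [show β = 0 from Subtype.ext h]; exact 𝔪.zero_mem)
  have h1 : (1 : monAlg K (faceMon j N)) ∈ J := hJ ▸ Submodule.mem_top
  have := h1 1 0
  rwa [ZeroMemClass.coe_zero, OneMemClass.coe_one, mul_one, zero_add, scaleVar_one,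
    AlgHom.coe_id, Matrix.map_id] at this

end Patch

section Milnor

variable {r : ℕ} {R : Type*} [CommRing R] {j : Fin r} {N N₀ : AddSubmonoid (Fin r →₀ ℕ)}
variable {n : Type*} [Fintype n] [DecidableEq n]

theorem exists_scaleVar_zero_sub {p : MvPolynomial (Fin r) R} {T : Set (Fin r →₀ ℕ)}
    (hp : SuppIn T p) (h0 : scaleVar j 0 p = 0) : SuppIn {x | x ∈ T ∧ 0 < x j} p := by
  intro x hx
  refine ⟨hp x hx, Nat.pos_of_ne_zero fun hxj => hx ?_⟩
  have key : ∀ q : MvPolynomial (Fin r) R, coeff x (scaleVar j 0 q) = coeff x q := by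
    intro q
    induction q using MvPolynomial.induction_on' with
    | monomial u a =>
      rw [scaleVar_monomial]
      by_cases hu : u j = 0
      · rw [hu, pow_zero, one_mul]
      · rw [zero_pow hu, zero_mul, coeff_zero, coeff_monomial, if_neg]
        rintro rfl; exact hu hxj
    | add p q hp hq => rw [map_add, coeff_add, coeff_add, hp, hq]
  rw [← key, h0, coeff_zero]

theorem Matrix.map_scaleVar_eq_self {m l : Type*} (a : MvPolynomial (Fin r) R)
    {X : Matrix m l (MvPolynomial (Fin r) R)}
    (hX : MatIn (monAlg R (faceMon j N)) X) : X.map (scaleVar j a) = X :=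
  Matrix.ext fun i k => scaleVar_of_mem_face j a (hX i k)

theorem MatIn.of_scaleVar {m l : Type*} (hN : N₀ ≤ N) (hpos : ∀ x ∈ N, 0 < x j → x ∈ N₀)
    {Z Z₀ : Matrix m l (MvPolynomial (Fin r) R)} (hZ : MatIn (monAlg R N) Z)
    (hZ₀ : MatIn (monAlg R (faceMon j N₀)) Z₀) (h : Z.map (scaleVar j 0) = Z₀) :
    MatIn (monAlg R N₀) Z := by
  intro a b
  have e0 : scaleVar j 0 (Z a b - Z₀ a b) = 0 := by
    rw [map_sub, scaleVar_of_mem_face j 0 (hZ₀ a b), sub_eq_zero]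
    exact congrFun (congrFun h a) b
  have hle : monAlg R (faceMon j N₀) ≤ monAlg R N := monAlg_mono ((faceMon_le _ _).trans hN)
  have := exists_scaleVar_zero_sub (Subalgebra.sub_mem _ (hZ a b) (hle (hZ₀ a b))) e0
  have h5 : Z a b - Z₀ a b ∈ monAlg R N₀ := this.mono fun x hx => hpos x hx.1 hx.2
  rw [← sub_add_cancel (Z a b) (Z₀ a b)]
  exact add_mem h5 (monAlg_mono (faceMon_le _ _) (hZ₀ a b))

omit [DecidableEq n] in
/-- If an idempotent matrix is extended over the larger monoid algebra and its contraction is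
free, then it is free. -/
theorem MatConj.exists_free {e : Matrix n n (MvPolynomial (Fin r) R)} (hN : N₀ ≤ N)
    (hpos : ∀ x ∈ N, 0 < x j → x ∈ N₀) (he : e * e = e)
    (h : MatConj (monAlg R N) e (e.map (scaleVar j 0))) {k : ℕ}
    {X₀ : Matrix n (Fin k) (MvPolynomial (Fin r) R)}
    {Y₀ : Matrix (Fin k) n (MvPolynomial (Fin r) R)}
    (hX₀ : MatIn (monAlg R (faceMon j N₀)) X₀) (hY₀ : MatIn (monAlg R (faceMon j N₀)) Y₀)
    (hXY : X₀ * Y₀ = e.map (scaleVar j 0)) (hYX : Y₀ * X₀ = 1) :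
    ∃ (X : Matrix n (Fin k) (MvPolynomial (Fin r) R))
      (Y : Matrix (Fin k) n (MvPolynomial (Fin r) R)),
      MatIn (monAlg R N₀) X ∧ MatIn (monAlg R N₀) Y ∧ X * Y = e ∧ Y * X = 1 := by
  obtain ⟨U, V, hU, hV, hUV, hVU⟩ := h
  have hle : monAlg R (faceMon j N₀) ≤ monAlg R N := monAlg_mono ((faceMon_le _ _).trans hN)
  have fX := Matrix.map_scaleVar_eq_self 0 hX₀
  have fY := Matrix.map_scaleVar_eq_self 0 hY₀
  have idem : ∀ Z : Matrix n (Fin k) (MvPolynomial (Fin r) R), Matrix.map (Z.map (scaleVar j 0))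
      (scaleVar j 0) = Z.map (scaleVar j 0) := fun Z =>
    Matrix.ext fun a b => scaleVar_zero_comp j 0 _
  have idem' : ∀ Z : Matrix (Fin k) n (MvPolynomial (Fin r) R), Matrix.map (Z.map (scaleVar j 0))
      (scaleVar j 0) = Z.map (scaleVar j 0) := fun Z =>
    Matrix.ext fun a b => scaleVar_zero_comp j 0 _
  set X' := U * X₀ with hX'
  set Y' := Y₀ * V with hY'
  have mX' : MatIn (monAlg R N) X' := hU.mul (hX₀.mono hle)
  have mY' : MatIn (monAlg R N) Y' := (hY₀.mono hle).mul hV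
  have h1 : X' * Y' = e := by
    calc X' * Y' = U * (X₀ * Y₀) * V := by simp only [hX', hY', Matrix.mul_assoc]
      _ = (U * V) * (U * V) := by rw [hXY, ← hVU]; simp only [Matrix.mul_assoc]
      _ = e := by rw [hUV, he]
  have h2 : Y' * X' = 1 := by
    calc Y' * X' = Y₀ * (V * U) * X₀ := by simp only [hX', hY', Matrix.mul_assoc]
      _ = (Y₀ * X₀) * (Y₀ * X₀) := by rw [hVU, ← hXY]; simp only [Matrix.mul_assoc]
      _ = 1 := by rw [hYX, Matrix.one_mul]
  have h3 : X'.map (scaleVar j 0) * Y'.map (scaleVar j 0) = X₀ * Y₀ := by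
    rw [← Matrix.map_mul, h1, hXY]
  have h4 : Y'.map (scaleVar j 0) * X'.map (scaleVar j 0) = 1 := by
    rw [← Matrix.map_mul, h2, Matrix.map_one _ (map_zero _) (map_one _)]
  clear_value X' Y'
  have mρX : MatIn (monAlg R N) (X'.map (scaleVar j 0)) :=
    mX'.map fun x hx => scaleVar_mem j (zero_mem _) hx
  have mρY : MatIn (monAlg R N) (Y'.map (scaleVar j 0)) :=
    mY'.map fun x hx => scaleVar_mem j (zero_mem _) hx
  have g1 : Y₀ * X'.map (scaleVar j 0) * (Y'.map (scaleVar j 0) * X₀) = 1 := by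
    calc _ = Y₀ * (X'.map (scaleVar j 0) * Y'.map (scaleVar j 0)) * X₀ := by
          simp only [Matrix.mul_assoc]
      _ = (Y₀ * X₀) * (Y₀ * X₀) := by rw [h3]; simp only [Matrix.mul_assoc]
      _ = 1 := by rw [hYX, Matrix.one_mul]
  have g2 : (Y'.map (scaleVar j 0) * X₀) * (Y₀ * X'.map (scaleVar j 0)) = 1 := by
    calc _ = Y'.map (scaleVar j 0) * (X₀ * Y₀) * X'.map (scaleVar j 0) := by
          simp only [Matrix.mul_assoc]
      _ = (Y'.map (scaleVar j 0) * X'.map (scaleVar j 0)) *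
          (Y'.map (scaleVar j 0) * X'.map (scaleVar j 0)) := by
          rw [← h3]; simp only [Matrix.mul_assoc]
      _ = 1 := by rw [h4, Matrix.one_mul]
  refine ⟨X' * (Y'.map (scaleVar j 0) * X₀), Y₀ * X'.map (scaleVar j 0) * Y',
    MatIn.of_scaleVar hN hpos (mX'.mul (mρY.mul (hX₀.mono hle))) hX₀ ?_, MatIn.of_scaleVar hN hpos (((hY₀.mono hle).mul mρX).mul mY') hY₀ ?_,
    ?_, ?_⟩
  · rw [Matrix.map_mul, Matrix.map_mul, idem', fX, ← Matrix.mul_assoc, h3, Matrix.mul_assoc, hYX,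
      Matrix.mul_one]
  · rw [Matrix.map_mul, Matrix.map_mul, idem, fY, Matrix.mul_assoc, h3, ← Matrix.mul_assoc, hYX,
      Matrix.one_mul]
  · calc _ = X' * ((Y'.map (scaleVar j 0) * X₀) * (Y₀ * X'.map (scaleVar j 0))) * Y' := by
          simp only [Matrix.mul_assoc]
      _ = e := by rw [g2, Matrix.mul_one, h1]
  · calc _ = Y₀ * X'.map (scaleVar j 0) * (Y' * X') * (Y'.map (scaleVar j 0) * X₀) := by
          simp only [Matrix.mul_assoc]
      _ = 1 := by rw [h2, Matrix.mul_one, g1]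

end Milnor

section FieldTheorem

theorem exists_isFrame_of_isDomain {A : Type*} [CommRing A] [IsDomain A] {n : Type*} [Fintype n]
    [DecidableEq n] {e : Matrix n n A} (he : e * e = e) :
    ∃ g : A, g ≠ 0 ∧ ∃ (k : ℕ) (X : Matrix n (Fin k) A) (Y : Matrix (Fin k) n A),
      IsFrame e X Y g := by
  let L := FractionRing A
  have hL : Function.Injective (algebraMap A L) := IsFractionRing.injective A L
  obtain ⟨k, X, Y, hXY, hYX⟩ := exists_mul_eq_of_isIdempotent_of_pid (e.map (algebraMap A L))
    (by rw [← Matrix.map_mul, he])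
  obtain ⟨s, hs, X', hX'⟩ := exists_smul_eq_map (nonZeroDivisors A) X
  obtain ⟨t, ht, Y', hY'⟩ := exists_smul_eq_map (nonZeroDivisors A) Y
  have hst : s * t ≠ 0 := nonZeroDivisors.ne_zero (mul_mem hs ht)
  refine ⟨s * t, hst, k, X', Y', IsFrame.of_isDomain hst ?_ ?_⟩
  · apply Matrix.map_injective hL
    dsimp only
    rw [Matrix.map_mul, hX', hY', Matrix.map_smul_ringHom, Matrix.smul_mul, Matrix.mul_smul, hXY,
      map_mul, mul_smul]
  · apply Matrix.map_injective hL
    dsimp only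
    rw [Matrix.map_mul, hX', hY', Matrix.map_smul_ringHom, Matrix.smul_mul, Matrix.mul_smul, hYX,
      map_mul, mul_smul, Matrix.map_one _ (map_zero _) (map_one _), smul_comm]

variable {A A' : Type*} [CommRing A] [CommRing A'] {n : Type*} [Fintype n] [DecidableEq n]
  {ι : Type*} [Fintype ι] [DecidableEq ι]

omit [DecidableEq n] in
theorem IsFrame.map {e : Matrix n n A} {X : Matrix n ι A} {Y : Matrix ι n A} {g : A}
    (h : IsFrame e X Y g) (f : A →+* A') : IsFrame (e.map f) (X.map f) (Y.map f) (f g) where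
  mul_eq := by rw [← Matrix.map_mul, h.mul_eq, Matrix.map_smul_ringHom]
  mul_eq' := by
    rw [← Matrix.map_mul, h.mul_eq', Matrix.map_smul_ringHom,
      Matrix.map_one _ (map_zero _) (map_one _)]
  left := by rw [← Matrix.map_mul, h.left]
  right := by rw [← Matrix.map_mul, h.right]

omit [DecidableEq n] in
theorem IsFrame.of_map {e : Matrix n n A} {X : Matrix n ι A} {Y : Matrix ι n A} {g : A}
    {f : A →+* A'} (hf : Function.Injective f)
    (h : IsFrame (e.map f) (X.map f) (Y.map f) (f g)) : IsFrame e X Y g where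
  mul_eq := Matrix.map_injective hf <| by
    dsimp only; rw [Matrix.map_mul, h.mul_eq, Matrix.map_smul_ringHom]
  mul_eq' := Matrix.map_injective hf <| by
    dsimp only
    rw [Matrix.map_mul, h.mul_eq', Matrix.map_smul_ringHom,
      Matrix.map_one _ (map_zero _) (map_one _)]
  left := Matrix.map_injective hf <| by dsimp only; rw [Matrix.map_mul, h.left]
  right := Matrix.map_injective hf <| by dsimp only; rw [Matrix.map_mul, h.right]

omit [DecidableEq n] in
theorem IsFrame.smul {e : Matrix n n A} {X : Matrix n ι A} {Y : Matrix ι n A} {g : A}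
    (h : IsFrame e X Y g) (a : A) : IsFrame e (a • X) Y (a * g) where
  mul_eq := by rw [Matrix.smul_mul, h.mul_eq, mul_smul]
  mul_eq' := by rw [Matrix.mul_smul, h.mul_eq', mul_smul]
  left := by rw [Matrix.mul_smul, h.left]
  right := h.right

section Subalgebra

variable {R S : Type*} [CommRing R] [CommRing S] [Algebra R S] {B : Subalgebra R S}

omit [DecidableEq n] in
theorem IsFrame.lift {e : Matrix n n S} {X : Matrix n ι S} {Y : Matrix ι n S} {g : S}
    (h : IsFrame e X Y g) (he : MatIn B e) (hX : MatIn B X) (hY : MatIn B Y) (hg : g ∈ B) :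
    IsFrame he.lift hX.lift hY.lift ⟨g, hg⟩ :=
  IsFrame.of_map (f := B.val.toRingHom) Subtype.val_injective h

omit [DecidableEq n] in
theorem MatIn.lift_mul_self {e : Matrix n n S} (he : MatIn B e) (h : e * e = e) :
    he.lift * he.lift = he.lift :=
  Matrix.map_injective (f := B.val.toRingHom) Subtype.val_injective <| by
    dsimp only
    rw [Matrix.map_mul]
    exact h

theorem mul_map_val {l m : Type*} [Fintype m] {X : Matrix l m B} {Y : Matrix m l B} {b : B}
    {e : Matrix l l B} (h : X * Y = b • e) : X.map B.val * Y.map B.val = b.1 • e.map B.val := by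
  have := congrArg (fun Z => Z.map B.val.toRingHom) h
  rw [Matrix.map_mul, Matrix.map_smul_ringHom] at this
  exact this

theorem mul_map_val_one {l m : Type*} [Fintype m] [DecidableEq l] {X : Matrix l m B}
    {Y : Matrix m l B} {b : B} (h : X * Y = b • 1) : X.map B.val * Y.map B.val = b.1 • 1 := by
  rw [mul_map_val h, Matrix.map_one _ (map_zero _) (map_one _)]

end Subalgebra

variable {r : ℕ} {c : ℕ} {N : AddSubmonoid (Fin r →₀ ℕ)}

theorem eq_C_of_mem_monAlg_levelMon_zero {R : Type*} [CommRing R] {p : MvPolynomial (Fin r) R}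
    (hp : p ∈ monAlg R (levelMon N 0)) : p = C (constantCoeff p) := by
  ext x
  rw [coeff_C, constantCoeff_eq]
  split_ifs with h
  · rw [h]
  · by_contra h0
    exact h (Finsupp.ext fun i => ((hp x h0).2 i (Nat.zero_le _)).symm)

/-- The monoid obtained from level `j + 1` by cancelling `c e_j`. -/
def GoodMon.locLevel (hN : GoodMon c N) (j : Fin r) : AddSubmonoid (Fin r →₀ ℕ) where
  carrier := {x | x + Finsupp.single j c ∈ levelMon N (j.val + 1)}
  add_mem' {x y} hx hy := by
    refine hN.mem_of_add_level _ j ?_ (?_ : _ + Finsupp.single j c ∈ _)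
    · have := hN.pos
      simp only [Finsupp.add_apply, Finsupp.single_eq_same]; omega
    · have hx' : x + Finsupp.single j c ∈ levelMon N (j.val + 1) := hx
      have hy' : y + Finsupp.single j c ∈ levelMon N (j.val + 1) := hy
      have := add_mem hx' hy'
      rwa [show x + y + Finsupp.single j c + Finsupp.single j c =
        x + Finsupp.single j c + (y + Finsupp.single j c) by abel]
  zero_mem' := by
    change 0 + Finsupp.single j c ∈ levelMon N (j.val + 1)
    rw [zero_add]
    refine ⟨hN.single_mem j, fun i hi => ?_⟩
    rw [Finsupp.single_apply, if_neg]
    rintro rfl; omega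

theorem GoodMon.mem_locLevel (hN : GoodMon c N) {j : Fin r} {x : Fin r →₀ ℕ} :
    x ∈ hN.locLevel j ↔ x + Finsupp.single j c ∈ levelMon N (j.val + 1) := Iff.rfl

theorem GoodMon.single_mem_level (hN : GoodMon c N) {i : Fin r} {m : ℕ} (hi : i.val < m) :
    Finsupp.single i c ∈ levelMon N m := by
  refine ⟨hN.single_mem i, fun l hl => ?_⟩
  rw [Finsupp.single_apply, if_neg]
  rintro rfl; omega

theorem GoodMon.le_locLevel (hN : GoodMon c N) (j : Fin r) :
    levelMon N (j.val + 1) ≤ hN.locLevel j := fun _ hx =>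
  add_mem hx (hN.single_mem_level (Nat.lt_succ_self _))

theorem GoodMon.mem_of_locLevel (hN : GoodMon c N) (j : Fin r) (x : Fin r →₀ ℕ)
    (hx : x ∈ hN.locLevel j) (h : 0 < x j) : x ∈ levelMon N (j.val + 1) :=
  hN.mem_of_add_level x j h hx

theorem GoodMon.locMon_locLevel (hN : GoodMon c N) (j : Fin r) : LocMon c j (hN.locLevel j) where
  pos := hN.pos
  supp x hx i hi := by
    have := (mem_levelMon.1 (hN.mem_locLevel.1 hx)).2 i hi
    rw [Finsupp.add_apply] at this
    omega
  single_mem i hi := hN.le_locLevel j (hN.single_mem_level (Nat.lt_succ_of_le hi))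
  mem_of_add x i hi hx := by
    rw [hN.mem_locLevel] at hx ⊢
    rw [add_right_comm] at hx
    refine hN.mem_of_add_level _ i ?_ hx
    have := hN.pos
    rcases hi with hi | rfl
    · rw [Finsupp.add_apply]; omega
    · simp only [Finsupp.add_apply, Finsupp.single_eq_same]; omega

theorem GoodMon.exists_free_of_varMonic {K : Type*} [Field K] (hN : GoodMon c N) (j : Fin r)
    {k m : ℕ} {e : Matrix n n (MvPolynomial (Fin r) K)}
    (hm : MatIn (monAlg K (levelMon N (j.val + 1))) e) (he : e * e = e)
    {X : Matrix n (Fin k) (MvPolynomial (Fin r) K)} {Y : Matrix (Fin k) n (MvPolynomial (Fin r) K)}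
    {g : MvPolynomial (Fin r) K} (hX : MatIn (monAlg K (levelMon N (j.val + 1))) X)
    (hY : MatIn (monAlg K (levelMon N (j.val + 1))) Y)
    (hg : g ∈ monAlg K (levelMon N (j.val + 1))) (hf : IsFrame e X Y g) (hgm : VarMonic j (c * m) g)
    {k₀ : ℕ} {X₀ : Matrix n (Fin k₀) (MvPolynomial (Fin r) K)}
    {Y₀ : Matrix (Fin k₀) n (MvPolynomial (Fin r) K)}
    (hX₀ : MatIn (monAlg K (levelMon N j.val)) X₀) (hY₀ : MatIn (monAlg K (levelMon N j.val)) Y₀)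
    (hXY : X₀ * Y₀ = e.map (scaleVar j 0)) (hYX : Y₀ * X₀ = 1) :
    ∃ (X : Matrix n (Fin k₀) (MvPolynomial (Fin r) K))
      (Y : Matrix (Fin k₀) n (MvPolynomial (Fin r) K)),
      MatIn (monAlg K (levelMon N (j.val + 1))) X ∧ MatIn (monAlg K (levelMon N (j.val + 1))) Y ∧
        X * Y = e ∧ Y * X = 1 := by
  rw [levelMon_eq_faceMon] at hX₀ hY₀
  refine MatConj.exists_free (hN.le_locLevel j) (hN.mem_of_locLevel j) he ?_ hX₀ hY₀ hXY hYX
  have hle := monAlg_mono (R := K) (hN.le_locLevel j)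
  have hm' := hm.mono hle
  have hX' := hX.mono hle
  have hY' := hY.mono hle
  refine matConj_scaleVar_zero hm' he fun 𝔪 h𝔪 => ?_
  obtain ⟨b, hb, k', X', Y', h1, h2⟩ := (hN.locMon_locLevel j).exists_frame 𝔪
    (hm'.lift_mul_self he) hgm (hf.lift hm' hX' hY' (hle hg))
  have h3 := mul_map_val h1
  have h4 := mul_map_val_one h2
  rw [algebraMap_face_coe] at h3 h4
  exact ⟨b, hb, k', _, _, matIn_map_val X', matIn_map_val Y', h3, h4⟩

theorem scaleVar_zero_shear_matrix {R : Type*} [CommRing R] {j : Fin r} {w : Fin r → ℕ}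
    (hw : ∀ i, i < j → 0 < w i) (a : R) {l m : Type*} (X : Matrix l m (MvPolynomial (Fin r) R)) :
    Matrix.map (X.map (shear j w a)) (scaleVar j 0) = X.map (scaleVar j 0) :=
  Matrix.ext fun i k => scaleVar_zero_shear j w hw a (X i k)

theorem shear_shear_matrix {R : Type*} [CommRing R] {j : Fin r} (w : Fin r → ℕ) {a b : R}
    (hab : a + b = 0) {l m : Type*} (X : Matrix l m (MvPolynomial (Fin r) R)) :
    Matrix.map (X.map (shear j w a)) (shear j w b) = X :=
  Matrix.ext fun i k => shear_shear j w ((add_comm b a).trans hab) (X i k)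

theorem MatIn.shear {R : Type*} [CommRing R] {j : Fin r} {w : Fin r → ℕ} (h : TradeAt j w N) (a : R)
    {l m : Type*} {X : Matrix l m (MvPolynomial (Fin r) R)}
    (hX : MatIn (monAlg R (levelMon N (j.val + 1))) X) :
    MatIn (monAlg R (levelMon N (j.val + 1))) (X.map (_root_.shear j w a)) :=
  fun i k => h.shear_mem a (hX i k)

/-- Over a field, projective modules over the monoid algebras are free. -/
theorem GoodMon.exists_free {K : Type*} [Field K] (hN : GoodMon c N) {m : ℕ} (hmr : m ≤ r)
    {e : Matrix n n (MvPolynomial (Fin r) K)}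
    (hm : MatIn (monAlg K (levelMon N m)) e) (he : e * e = e) :
    ∃ (k : ℕ) (X : Matrix n (Fin k) (MvPolynomial (Fin r) K))
      (Y : Matrix (Fin k) n (MvPolynomial (Fin r) K)),
      MatIn (monAlg K (levelMon N m)) X ∧ MatIn (monAlg K (levelMon N m)) Y ∧
        X * Y = e ∧ Y * X = 1 := by
  induction m generalizing e with
  | zero =>
    have h0 : e = (e.map constantCoeff).map (C : K →+* MvPolynomial (Fin r) K) :=
      Matrix.ext fun i k => eq_C_of_mem_monAlg_levelMon_zero (hm i k)
    obtain ⟨k, X, Y, h1, h2⟩ := exists_mul_eq_of_isIdempotent_of_pid (e.map constantCoeff)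
      (by rw [← Matrix.map_mul, he])
    refine ⟨k, X.map C, Y.map C, fun i k => Subalgebra.algebraMap_mem _ _,
      fun i k => Subalgebra.algebraMap_mem _ _, ?_, ?_⟩
    · rw [← Matrix.map_mul, h1, ← h0]
    · rw [← Matrix.map_mul, h2, Matrix.map_one _ (map_zero _) (map_one _)]
  | succ m ih =>
    let j : Fin r := ⟨m, hmr⟩
    let ι := (monAlg K (levelMon N (m + 1))).val.toRingHom
    have he' := hm.lift_mul_self he
    obtain ⟨g, hg, k, X, Y, hf⟩ := exists_isFrame_of_isDomain he'
    have hfin := hN.finite_powVarAlg (R := K) hmr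
    obtain ⟨F, hF0, a, hF⟩ : ∃ F, F ≠ 0 ∧ ∃ a, powVarAlg K hN.single_mem hmr F = a * g := by
      let _ := (powVarAlg K hN.single_mem hmr).toRingHom.toAlgebra
      have h_int : Algebra.IsIntegral (MvPolynomial (Fin (m + 1)) K)
          (monAlg K (levelMon N (m + 1))) := ⟨hfin.to_isIntegral⟩
      have := Ideal.comap_ne_bot_of_integral_mem (R := MvPolynomial (Fin (m + 1)) K) hg
        (Ideal.mem_span_singleton_self g) (h_int.isIntegral g)
      obtain ⟨F, hF, hF0⟩ := Submodule.exists_mem_ne_zero_of_ne_bot this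
      obtain ⟨a, ha⟩ := Ideal.mem_span_singleton'.1 (Ideal.mem_comap.1 hF)
      exact ⟨F, hF0, a, ha.symm⟩
    obtain ⟨b, hb, hlex⟩ := exists_lexMonic_C_mul F hF0
    obtain ⟨w, d, hw, htr, hmon⟩ := hN.exists_varMonic_shear j hlex
    have hf2 := ((hf.smul (powVarAlg K hN.single_mem hmr (C b) * a)).map ι).map
      (shear j w (1 : K)).toRingHom
    have hval : ι (powVarAlg K hN.single_mem hmr (C b) * a * g) = powVar K c hmr (C b * F) := by
      rw [mul_assoc, ← hF, ← map_mul]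
      rfl
    rw [hval] at hf2
    have hρe : MatIn (monAlg K (levelMon N m)) (e.map (scaleVar j 0)) := by
      have := levelMon_eq_faceMon (N := N) j
      change levelMon N m = _ at this
      rw [this]
      exact hm.map fun x hx => scaleVar_zero_mem_face j hx
    have hρ2 : e.map (scaleVar j 0) * e.map (scaleVar j 0) = e.map (scaleVar j 0) := by
      rw [← Matrix.map_mul, he]
    have hη2 : e.map (shear j w 1) * e.map (shear j w 1) = e.map (shear j w 1) := by
      rw [← Matrix.map_mul, he]
    obtain ⟨k₀, X₀, Y₀, mX₀, mY₀, hXY, hYX⟩ := ih (by omega) hρe hρ2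
    obtain ⟨X₁, Y₁, mX₁, mY₁, h1, h2⟩ := hN.exists_free_of_varMonic j (hm.shear htr 1) hη2
      ((matIn_map_val _).shear htr 1) ((matIn_map_val _).shear htr 1)
      (htr.shear_mem 1 (powVar_mem hN.single_mem hmr _)) hf2 hmon mX₀ mY₀
      (by rw [scaleVar_zero_shear_matrix hw, hXY]) hYX
    refine ⟨k₀, X₁.map (shear j w (-1)), Y₁.map (shear j w (-1)), mX₁.shear htr _,
      mY₁.shear htr _, ?_, ?_⟩
    · rw [← Matrix.map_mul, h1, shear_shear_matrix w (by ring)]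
    · rw [← Matrix.map_mul, h2, Matrix.map_one _ (map_zero _) (map_one _)]

end FieldTheorem

section Core

/-- A form of Nakayama's lemma for quotients that are finite over a subring. -/
theorem exists_one_add_mul_mem {B A : Type*} [CommRing B] [CommRing A] [Algebra B A] (I : Ideal A)
    {T : Set A} (hT : T.Finite) (h : Submodule.span B T ⊔ I.restrictScalars B = ⊤) (s : B)
    (hs : I ⊔ Ideal.span {algebraMap B A s} = ⊤) : ∃ b : B, algebraMap B A (1 + s * b) ∈ I := by
  let Q := I.restrictScalars B
  have hfg : (⊤ : Submodule B (A ⧸ Q)).FG := by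
    have h1 : Submodule.map Q.mkQ (Submodule.span B T) = ⊤ := by
      have h2 := congrArg (Submodule.map Q.mkQ) h
      rw [Submodule.map_sup, Submodule.map_top, Submodule.range_mkQ] at h2
      rw [← h2]
      symm
      refine sup_eq_left.2 ?_
      rw [Submodule.map_le_iff_le_comap]
      intro x hx
      rw [Submodule.mem_comap, Submodule.mkQ_apply, (Submodule.Quotient.mk_eq_zero Q (x := x)).2 hx]
      exact Submodule.zero_mem _
    rw [← h1]
    exact (Submodule.fg_span hT).map _
  obtain ⟨x, hx, hx0⟩ := Submodule.exists_sub_one_mem_and_smul_eq_zero_of_fg_of_le_smul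
    (Ideal.span {s}) (⊤ : Submodule B (A ⧸ Q)) hfg (by
      intro m _
      obtain ⟨a, rfl⟩ := Submodule.mkQ_surjective Q m
      have ha : a ∈ I ⊔ Ideal.span {algebraMap B A s} := hs ▸ Submodule.mem_top
      obtain ⟨y, hy, z, hz, rfl⟩ := Submodule.mem_sup.1 ha
      obtain ⟨z', rfl⟩ := Ideal.mem_span_singleton'.1 hz
      rw [map_add, Submodule.mkQ_apply, (Submodule.Quotient.mk_eq_zero Q (x := y)).2 hy, zero_add,
        show z' * algebraMap B A s = s • z' by rw [Algebra.smul_def, mul_comm], map_smul]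
      exact Submodule.smul_mem_smul (Ideal.mem_span_singleton_self s) Submodule.mem_top)
  obtain ⟨b, hb⟩ := Ideal.mem_span_singleton'.1 hx
  refine ⟨b, ?_⟩
  have h1 := hx0 (Q.mkQ 1) Submodule.mem_top
  rw [← map_smul, Submodule.mkQ_apply, Submodule.Quotient.mk_eq_zero, Algebra.smul_def,
    mul_one] at h1
  rw [show 1 + s * b = x by rw [mul_comm, hb]; ring]
  exact h1

variable {A : Type*} [CommRing A] {n ι : Type*} [Fintype n] [DecidableEq n] [Fintype ι]
  [DecidableEq ι]

theorem mulVec_mem {ι n : Type*} [Fintype n] (I : Ideal A) {p : n → A} (M : Matrix ι n A)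
    (h : ∀ i, p i ∈ I) (i : ι) : (M.mulVec p) i ∈ I :=
  I.sum_mem fun x _ => I.mul_mem_left _ (h x)

theorem span_range_le_iff {n : Type*} {p : n → A} {I : Ideal A} :
    Ideal.span (Set.range p) ≤ I ↔ ∀ i, p i ∈ I := by
  rw [Ideal.span_le, Set.range_subset_iff]; rfl

omit [DecidableEq n] in
theorem exists_unimodular_of_frame {e : Matrix n n A} {X : Matrix n ι A} {Y : Matrix ι n A}
    {s b : A} (hf : IsFrame e X Y s) (δ ρ : A →+* A) (hδs : δ s = s) (hρs : ρ s = s)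
    (hδb : δ b = b) (hδ : ∀ a, ∃ a', ρ a' = 0 ∧ δ a = a + (s * s * -(b * b)) * a')
    (hδ0 : ∀ a, ∃ z, δ a = ρ a + (1 + s * b) * z) {p : n → A} (hp : e.mulVec p = p)
    (hub : 1 + s * b ∈ Ideal.span (Set.range p)) (hρp : Ideal.span (Set.range (ρ ∘ p)) = ⊤) :
    ∃ p' : n → A, e.mulVec p' = p' ∧ ρ ∘ p' = ρ ∘ p ∧ Ideal.span (Set.range p') = ⊤ := by
  let w := Y.mulVec p
  choose a ha0 ha using fun i => hδ (w i)
  have hXw : X.mulVec w = s • p := by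
    rw [Matrix.mulVec_mulVec, hf.mul_eq, Matrix.smul_mulVec, hp]
  let p' : n → A := p + (s * -(b * b)) • X.mulVec a
  have hYp' : Y.mulVec p' = δ ∘ w := by
    rw [Matrix.mulVec_add, Matrix.mulVec_smul, Matrix.mulVec_mulVec, hf.mul_eq', Matrix.smul_mulVec,
      Matrix.one_mulVec, smul_smul]
    ext i
    rw [Function.comp_apply, ha i]
    simp only [Pi.add_apply, Pi.smul_apply, smul_eq_mul]
    change w i + _ = _
    ring
  refine ⟨p', ?_, ?_, ?_⟩
  · rw [Matrix.mulVec_add, hp, Matrix.mulVec_smul, Matrix.mulVec_mulVec, hf.left]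
  · ext i
    have h0 : ρ ((X.mulVec a) i) = 0 := by
      rw [Matrix.mulVec, dotProduct, map_sum]
      exact Finset.sum_eq_zero fun x _ => by rw [map_mul, ha0, mul_zero]
    simp only [p', Function.comp_apply, Pi.add_apply, Pi.smul_apply, smul_eq_mul, map_add, map_mul,
      h0, mul_zero, add_zero]
  · by_contra hne
    obtain ⟨𝔪, h𝔪, hle⟩ := Ideal.exists_le_maximal _ hne
    rw [span_range_le_iff] at hle
    have hs : s ∉ 𝔪 := by
      intro hs
      have hp𝔪 : ∀ i, p i ∈ 𝔪 := fun i => by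
        have h1 := hle i
        simp only [p', Pi.add_apply, Pi.smul_apply, smul_eq_mul] at h1
        rw [mul_assoc] at h1
        exact (𝔪.add_mem_iff_left (𝔪.mul_mem_right _ hs)).1 h1
      have h2 := span_range_le_iff.2 hp𝔪 hub
      exact h𝔪.ne_top ((Ideal.eq_top_iff_one _).2
        ((𝔪.add_mem_iff_left (𝔪.mul_mem_right _ hs)).1 h2))
    have hδw : ∀ i, δ (w i) ∈ 𝔪 := fun i => by
      have := mulVec_mem 𝔪 Y hle i
      rwa [hYp'] at this
    have hsu : s * (1 + s * b) ∈ 𝔪 := by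
      have h1 : Ideal.span (Set.range p) ≤ (Ideal.comap δ 𝔪).colon {s} := by
        rw [span_range_le_iff]
        intro i
        rw [Submodule.mem_colon_singleton, smul_eq_mul, mul_comm, ← smul_eq_mul, ← Pi.smul_apply,
          ← hXw]
        exact mulVec_mem (Ideal.comap δ 𝔪) X (fun i => hδw i) i
      have h2 := h1 hub
      rw [Submodule.mem_colon_singleton, smul_eq_mul, Ideal.mem_comap, map_mul, map_add, map_mul,
        map_one, hδs, hδb] at h2
      rwa [mul_comm]
    rcases h𝔪.isPrime.mem_or_mem hsu with h | hu
    · exact hs h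
    · have hρw : ∀ i, w i ∈ Ideal.comap ρ 𝔪 := fun i => by
        obtain ⟨z, hz⟩ := hδ0 (w i)
        have := hδw i
        rw [hz] at this
        exact (𝔪.add_mem_iff_left (𝔪.mul_mem_right _ hu)).1 this
      apply hs
      have h1 : ∀ i, (ρ ∘ p) i ∈ 𝔪.colon {s} := fun i => by
        have h2 := mulVec_mem _ X hρw i
        rw [hXw, Ideal.mem_comap, Pi.smul_apply, smul_eq_mul, map_mul, hρs] at h2
        rw [Submodule.mem_colon_singleton, smul_eq_mul, mul_comm]
        exact h2
      have h3 := span_range_le_iff.2 h1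
      rw [hρp] at h3
      have h4 := Submodule.mem_colon_singleton.1 (h3 (Submodule.mem_top (x := (1 : A))))
      rwa [one_smul] at h4

end Core

section Division

variable {r : ℕ} {R : Type*} [CommRing R] {N : AddSubmonoid (Fin r →₀ ℕ)} {c : ℕ}

theorem monAlg_levelMon_le (R : Type*) [CommRing R] (N : AddSubmonoid (Fin r →₀ ℕ)) (m : ℕ) :
    monAlg R (levelMon N m) ≤ monAlg R (levelMon N (m + 1)) :=
  monAlg_mono fun _ hx => ⟨hx.1, fun i hi => hx.2 i (by omega)⟩

theorem GoodMon.mem_of_add_nsmul_level (hN : GoodMon c N) {m : ℕ} (q : ℕ) (x : Fin r →₀ ℕ)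
    (i : Fin r) (hx : 0 < x i) (h : x + q • Finsupp.single i c ∈ levelMon N m) :
    x ∈ levelMon N m := by
  induction q with
  | zero => simpa using h
  | succ q ih =>
    refine ih (hN.mem_of_add_level _ i ?_ ?_)
    · rw [Finsupp.add_apply]; omega
    · rwa [add_assoc, ← succ_nsmul]

/-- Division with remainder by an element that is monic in the variable `j`. -/
theorem GoodMon.exists_span_sup_eq_top (hN : GoodMon c N) (j : Fin r)
    {f : monAlg R (levelMon N (j.val + 1))} {d : ℕ} (hf : VarMonic j (c * d) f.1)
    {I : Ideal (monAlg R (levelMon N (j.val + 1)))} (hfI : f ∈ I)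
    [Algebra (monAlg R (levelMon N j.val)) (monAlg R (levelMon N (j.val + 1)))]
    (hcoe : ∀ b : monAlg R (levelMon N j.val),
      (algebraMap _ (monAlg R (levelMon N (j.val + 1))) b).1 = b.1) :
    ∃ T : Set (monAlg R (levelMon N (j.val + 1))), T.Finite ∧
      Submodule.span (monAlg R (levelMon N j.val)) T ⊔
        I.restrictScalars (monAlg R (levelMon N j.val)) = ⊤ := by
  have hc := hN.pos
  let E : Set (Fin r →₀ ℕ) := {z | ∀ i, z i ≤ c + c * d}
  have hE : E.Finite := finite_setOf_le fun _ => c + c * d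
  let T : Set (monAlg R (levelMon N (j.val + 1))) :=
    monElt R '' {z : levelMon N (j.val + 1) | z.1 ∈ E}
  have hT : T.Finite := (hE.preimage Subtype.val_injective.injOn).image _
  refine ⟨T, hT, ?_⟩
  set W := Submodule.span (monAlg R (levelMon N j.val)) T ⊔
    I.restrictScalars (monAlg R (levelMon N j.val)) with hW
  have key : ∀ D : ℕ, ∀ p, SuppIn {y | y ∈ levelMon N (j.val + 1) ∧ y j < D} p →
      ∃ hp : p ∈ monAlg R (levelMon N (j.val + 1)), (⟨p, hp⟩ : monAlg R _) ∈ W := by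
    intro D
    induction D with
    | zero =>
      intro p hp
      have : p = 0 := by
        ext x
        by_contra h
        exact absurd (hp x h).2 (Nat.not_lt_zero _)
      subst this
      exact ⟨zero_mem _, W.zero_mem⟩
    | succ D ih =>
      intro p hp
      refine SuppIn.induction (P := fun p => ∃ hp : p ∈ monAlg R (levelMon N (j.val + 1)),
        (⟨p, hp⟩ : monAlg R _) ∈ W) ?_ ⟨zero_mem _, W.zero_mem⟩ ?_ hp
      · rintro y ⟨hy, hyD⟩ a
        refine ⟨monomial_mem_monAlg hy a, ?_⟩
        by_cases hyj : y j ≤ c * d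
        · obtain ⟨z, hz, k, hz1, hk, hyz⟩ := exists_reduce hc (J := {i | i ≠ j})
            (fun x i _ hx h => hN.mem_of_add x i hx h) y hy.1
          have hkj : k j = 0 := hk j (by simp)
          have hzl : z ∈ levelMon N (j.val + 1) := ⟨hz, fun i hi => by
            have := hy.2 i hi
            rw [hyz, Finsupp.add_apply] at this; omega⟩
          have hkl : c • k ∈ levelMon N j.val := by
            refine nsmul_mem_levelMon hN.single_mem fun i hi => ?_
            rcases hi.eq_or_lt with h | h
            · rw [← Fin.ext h]; exact hkj
            · have := hy.2 i h
              rw [hyz, Finsupp.add_apply, Finsupp.smul_apply, smul_eq_mul] at this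
              have h0 : c * k i = 0 := by omega
              exact (Nat.mul_eq_zero.1 h0).resolve_left hc.ne'
          have e1 : (⟨monomial y a, monomial_mem_monAlg hy a⟩ : monAlg R (levelMon N (j.val + 1))) =
              (⟨monomial (c • k) a, monomial_mem_monAlg hkl a⟩ : monAlg R (levelMon N j.val)) •
                monElt R (⟨z, hzl⟩ : levelMon N (j.val + 1)) := by
            rw [Algebra.smul_def]
            apply Subtype.ext
            rw [MulMemClass.coe_mul, hcoe]
            change monomial y a = monomial (c • k) a * monomial z 1
            rw [monomial_mul, mul_one, add_comm, ← hyz]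
          rw [e1]
          refine W.smul_mem _ (Submodule.mem_sup_left (Submodule.subset_span ⟨_, ?_, rfl⟩))
          intro i
          change z i ≤ _
          by_cases hij : i = j
          · subst hij
            rw [hyz, Finsupp.add_apply] at hyj; omega
          · have := hz1 i hij; omega
        · push Not at hyj
          have hle : Finsupp.single j (c * d) ≤ y := by rw [Finsupp.single_le_iff]; omega
          let y' := y - Finsupp.single j (c * d)
          have hyy : y = y' + Finsupp.single j (c * d) := (tsub_add_cancel_of_le hle).symm
          have hy'j : y j = y' j + c * d := by
            conv_lhs => rw [hyy]
            simp
          have hy' : y' ∈ levelMon N (j.val + 1) := by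
            refine hN.mem_of_add_nsmul_level d y' j (by omega) ?_
            rw [Finsupp.smul_single, smul_eq_mul, mul_comm, ← hyy]
            exact hy
          let q : MvPolynomial (Fin r) R := monomial y' a * (X j ^ (c * d) - f.1)
          have hXj : (X j ^ (c * d) : MvPolynomial (Fin r) R) ∈ monAlg R (levelMon N (j.val + 1)) := by
            rw [X_pow_eq_monomial]
            refine monomial_mem_monAlg ?_ _
            have := (levelMon N (j.val + 1)).nsmul_mem
              (hN.single_mem_level (Nat.lt_succ_self j.val)) d
            rwa [Finsupp.smul_single, smul_eq_mul, mul_comm] at this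
          have hq : SuppIn {y | y ∈ levelMon N (j.val + 1) ∧ y j < D} q := by
            have h1 : SuppIn {x | x ∈ levelMon N (j.val + 1) ∧ x j < c * d}
                (X j ^ (c * d) - f.1) := by
              intro x hx
              refine ⟨sub_mem hXj f.2 x hx, hf x ?_⟩
              rwa [← neg_sub, coeff_neg, neg_ne_zero]
            refine SuppIn.mul (SuppIn.monomial (T := {y'}) rfl a) h1 ?_
            rintro _ rfl x hx
            refine ⟨add_mem hy' hx.1, ?_⟩
            have := hx.2
            rw [Finsupp.add_apply]
            omega
          obtain ⟨hqm, hqW⟩ := ih q hq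
          have e1 : (⟨monomial y a, monomial_mem_monAlg hy a⟩ : monAlg R (levelMon N (j.val + 1))) =
              ⟨q, hqm⟩ + ⟨monomial y' a, monomial_mem_monAlg hy' a⟩ * f := by
            apply Subtype.ext
            change monomial y a = monomial y' a * (X j ^ (c * d) - f.1) + monomial y' a * f.1
            rw [mul_sub, sub_add_cancel, X_pow_eq_monomial, monomial_mul, mul_one, ← hyy]
          rw [e1]
          exact W.add_mem hqW (Submodule.mem_sup_right (I.mul_mem_left _ hfI))
      · rintro p q - - ⟨hp, hpW⟩ ⟨hq, hqW⟩
        exact ⟨add_mem hp hq, W.add_mem hpW hqW⟩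
  rw [eq_top_iff]
  rintro ⟨p, hp⟩ -
  obtain ⟨D, hD⟩ : ∃ D : ℕ, ∀ x ∈ p.support, x j < D :=
    ⟨p.support.sup (fun x => x j) + 1, fun x hx =>
      Nat.lt_succ_of_le (Finset.le_sup (f := fun x : Fin r →₀ ℕ => x j) hx)⟩
  exact (key D p fun x hx => ⟨hp x hx, hD x (mem_support_iff.2 hx)⟩).2

theorem GoodMon.exists_one_add_mul_mem (hN : GoodMon c N) (j : Fin r)
    {f : monAlg R (levelMon N (j.val + 1))} {d : ℕ} (hf : VarMonic j (c * d) f.1)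
    {I : Ideal (monAlg R (levelMon N (j.val + 1)))} (hfI : f ∈ I) (s : R)
    (hs : I ⊔ Ideal.span {algebraMap R _ s} = ⊤) :
    ∃ b : monAlg R (levelMon N (j.val + 1)), b.1 ∈ monAlg R (levelMon N j.val) ∧
      1 + algebraMap R _ s * b ∈ I := by
  let φ := Subalgebra.inclusion (monAlg_levelMon_le R N j.val)
  let _ : Algebra (monAlg R (levelMon N j.val)) (monAlg R (levelMon N (j.val + 1))) :=
    φ.toRingHom.toAlgebra
  obtain ⟨T, hT, h⟩ := hN.exists_span_sup_eq_top j hf hfI fun _ => rfl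
  obtain ⟨b, hb⟩ := _root_.exists_one_add_mul_mem I hT h (algebraMap R _ s) hs
  refine ⟨φ b, b.2, ?_⟩
  have : φ (1 + algebraMap R _ s * b) ∈ I := hb
  rwa [map_add, map_mul, map_one, AlgHom.commutes] at this

end Division

section LexCore

theorem span_range_comp {A B n : Type*} [CommRing A] [CommRing B] (f : A →+* B) (p : n → A) :
    Ideal.span (Set.range (f ∘ p)) = (Ideal.span (Set.range p)).map f := by
  rw [Ideal.map_span, Set.range_comp]

theorem map_mulVec_comp {A B m n : Type*} [CommRing A] [CommRing B] [Fintype n] (f : A →+* B)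
    (M : Matrix m n A) (p : n → A) : (M.map f).mulVec (f ∘ p) = f ∘ M.mulVec p :=
  funext fun i => (RingHom.map_mulVec f M p i).symm

variable {r : ℕ} {R : Type*} [CommRing R] {N : AddSubmonoid (Fin r →₀ ℕ)} {c : ℕ}

/-- `scaleVar` as an endomorphism of the monoid algebra. -/
noncomputable def scaleHom (j : Fin r) (l : monAlg R N) : monAlg R N →ₐ[R] monAlg R N :=
  ((scaleVar j l.1).comp (monAlg R N).val).codRestrict _ fun p => scaleVar_mem j l.2 p.2

/-- `shear` as an endomorphism of the monoid algebra. -/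
noncomputable def shearHom {j : Fin r} {w : Fin r → ℕ} (h : TradeAt j w N) (a : R) :
    monAlg R (levelMon N (j.val + 1)) →ₐ[R] monAlg R (levelMon N (j.val + 1)) :=
  ((shear j w a).comp (monAlg R _).val).codRestrict _ fun p => h.shear_mem a p.2

variable {n ι : Type*} [Fintype n] [DecidableEq n] [Fintype ι] [DecidableEq ι]

omit [DecidableEq n] in
theorem GoodMon.exists_unimodular_of_varMonic (hN : GoodMon c N) (j : Fin r)
    {e : Matrix n n (monAlg R (levelMon N (j.val + 1)))}
    {X : Matrix n ι (monAlg R (levelMon N (j.val + 1)))}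
    {Y : Matrix ι n (monAlg R (levelMon N (j.val + 1)))} {s : R}
    (hf : IsFrame e X Y (algebraMap R _ s)) {p : n → monAlg R (levelMon N (j.val + 1))}
    (hp : e.mulVec p = p) (hs : Ideal.span (Set.range p) ⊔ Ideal.span {algebraMap R _ s} = ⊤)
    (hρ : Ideal.span (Set.range (scaleHom j 0 ∘ p)) = ⊤)
    {f : monAlg R (levelMon N (j.val + 1))} {d : ℕ} (hfm : VarMonic j (c * d) f.1)
    (hfp : f ∈ Ideal.span (Set.range p)) :
    ∃ p' : n → monAlg R (levelMon N (j.val + 1)), e.mulVec p' = p' ∧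
      scaleHom j 0 ∘ p' = scaleHom j 0 ∘ p ∧ Ideal.span (Set.range p') = ⊤ := by
  obtain ⟨b, hb, hbm⟩ := hN.exists_one_add_mul_mem j hfm hfp s hs
  set σ : monAlg R (levelMon N (j.val + 1)) := algebraMap R _ s with hσ
  let l := 1 + σ * σ * -(b * b)
  rw [levelMon_eq_faceMon] at hb
  refine exists_unimodular_of_frame hf (scaleHom j l).toRingHom (scaleHom j 0).toRingHom
    (AlgHom.commutes _ _) (AlgHom.commutes _ _) (Subtype.ext (scaleVar_of_mem_face j _ hb)) ?_ ?_
    hp hbm hρ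
  · intro a
    obtain ⟨z, hz, hz0, h⟩ := exists_scaleVar_sub_scaleVar j l.2 (one_mem _) a.2
    refine ⟨⟨z, hz⟩, Subtype.ext hz0, Subtype.ext ?_⟩
    rw [scaleVar_one] at h
    change scaleVar j l.1 a.1 = a.1 + (σ.1 * σ.1 * -(b.1 * b.1)) * z
    have hl : l.1 = 1 + σ.1 * σ.1 * -(b.1 * b.1) := rfl
    rw [AlgHom.coe_id, id_eq, sub_eq_iff_eq_add] at h
    rw [h, hl]
    ring
  · intro a
    obtain ⟨z, hz, hz0, h⟩ := exists_scaleVar_sub_scaleVar j l.2 (zero_mem _) a.2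
    refine ⟨(1 - σ * b) * ⟨z, hz⟩, Subtype.ext ?_⟩
    change scaleVar j l.1 a.1 = scaleVar j 0 a.1 + (1 + σ.1 * b.1) * ((1 - σ.1 * b.1) * z)
    have hl : l.1 = 1 + σ.1 * σ.1 * -(b.1 * b.1) := rfl
    rw [sub_eq_iff_eq_add] at h
    rw [h, hl]
    ring

omit [DecidableEq n] in
theorem GoodMon.exists_unimodular_of_lexMonic (hN : GoodMon c N) (j : Fin r)
    {e : Matrix n n (monAlg R (levelMon N (j.val + 1)))}
    {X : Matrix n ι (monAlg R (levelMon N (j.val + 1)))}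
    {Y : Matrix ι n (monAlg R (levelMon N (j.val + 1)))} {s : R}
    (hf : IsFrame e X Y (algebraMap R _ s)) {p : n → monAlg R (levelMon N (j.val + 1))}
    (hp : e.mulVec p = p) (hs : Ideal.span (Set.range p) ⊔ Ideal.span {algebraMap R _ s} = ⊤)
    (hρ : Ideal.span (Set.range (scaleHom j 0 ∘ p)) = ⊤)
    {F : MvPolynomial (Fin (j.val + 1)) R} (hF : LexMonic F)
    (hFp : powVarAlg R hN.single_mem j.2 F ∈ Ideal.span (Set.range p)) :
    ∃ p' : n → monAlg R (levelMon N (j.val + 1)), e.mulVec p' = p' ∧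
      scaleHom j 0 ∘ p' = scaleHom j 0 ∘ p ∧ Ideal.span (Set.range p') = ⊤ := by
  obtain ⟨w, d, hw, htr, hmon⟩ := hN.exists_varMonic_shear j hF
  let η := (shearHom htr (1 : R)).toRingHom
  let η' := (shearHom htr (-1 : R)).toRingHom
  have hη : ∀ x, η' (η x) = x := fun x => Subtype.ext (shear_shear j w (by ring) x.1)
  have hρη : ∀ x, scaleHom j 0 (η x) = scaleHom j 0 x := fun x =>
    Subtype.ext (scaleVar_zero_shear j w hw 1 x.1)
  have hρη' : ∀ x, scaleHom j 0 (η' x) = scaleHom j 0 x := fun x =>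
    Subtype.ext (scaleVar_zero_shear j w hw (-1) x.1)
  have hηs : η (algebraMap R _ s) = algebraMap R _ s := AlgHom.commutes _ _
  have hf2 := hf.map η
  rw [hηs] at hf2
  have hp2 : (e.map η).mulVec (η ∘ p) = η ∘ p := by rw [map_mulVec_comp, hp]
  have hs2 := congrArg (Ideal.map η) hs
  rw [Ideal.map_sup, ← span_range_comp, Ideal.map_span, Set.image_singleton, hηs,
    Ideal.map_top] at hs2
  have hρ2 : scaleHom j 0 ∘ (η ∘ p) = scaleHom j 0 ∘ p := funext fun i => hρη _
  have hfp2 : η (powVarAlg R hN.single_mem j.2 F) ∈ Ideal.span (Set.range (η ∘ p)) := by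
    rw [span_range_comp]
    exact Ideal.mem_map_of_mem _ hFp
  obtain ⟨p', h1, h2, h3⟩ := hN.exists_unimodular_of_varMonic j hf2 hp2 hs2 (by rw [hρ2, hρ])
    hmon hfp2
  refine ⟨η' ∘ p', ?_, ?_, ?_⟩
  · have he : e = (e.map η).map η' := Matrix.ext fun i k => (hη _).symm
    rw [he, map_mulVec_comp, h1]
  · rw [← hρ2, ← h2]
    exact funext fun i => hρη' _
  · rw [span_range_comp, h3, Ideal.map_top]

end LexCore

section BaseChange

variable {r : ℕ} {N : AddSubmonoid (Fin r →₀ ℕ)}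

/-- Change of coefficients for the monoid algebra. -/
noncomputable def monMap (N : AddSubmonoid (Fin r →₀ ℕ)) {R R' : Type*} [CommRing R] [CommRing R']
    (f : R →+* R') : monAlg R N →+* monAlg R' N :=
  ((MvPolynomial.map f).comp (monAlg R N).val.toRingHom).codRestrict (monAlg R' N) fun p x hx =>
    p.2 x fun h => hx (by
      change coeff x (MvPolynomial.map f p.1) = 0
      rw [coeff_map, h, map_zero])

variable {R R' : Type*} [CommRing R] [CommRing R'] (f : R →+* R')

theorem coe_monMap (p : monAlg R N) : (monMap N f p).1 = MvPolynomial.map f p.1 := rfl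

theorem monMap_algebraMap (a : R) : monMap N f (algebraMap R _ a) = algebraMap R' _ (f a) :=
  Subtype.ext (MvPolynomial.map_C f a)

theorem map_scaleVar_zero (j : Fin r) (p : MvPolynomial (Fin r) R) :
    MvPolynomial.map f (scaleVar j 0 p) = scaleVar j 0 (MvPolynomial.map f p) := by
  induction p using MvPolynomial.induction_on' with
  | monomial x a =>
    rw [scaleVar_monomial, map_monomial, scaleVar_monomial, map_mul, map_pow, map_zero,
      map_monomial]
  | add p q hp hq => simp only [map_add, hp, hq]

theorem monMap_scaleHom_zero (j : Fin r) (p : monAlg R N) :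
    monMap N f (scaleHom j 0 p) = scaleHom j 0 (monMap N f p) :=
  Subtype.ext (map_scaleVar_zero f j p.1)

theorem exists_map_eq_of_surjective (hf : Function.Surjective f) {p : MvPolynomial (Fin r) R'}
    (hp : p ∈ monAlg R' N) : ∃ p' ∈ monAlg R N, MvPolynomial.map f p' = p := by
  refine SuppIn.induction (P := fun p => ∃ p' ∈ monAlg R N, MvPolynomial.map f p' = p) ?_
    ⟨0, zero_mem _, map_zero _⟩ ?_ hp
  · intro x hx a
    obtain ⟨b, rfl⟩ := hf a
    exact ⟨_, monomial_mem_monAlg hx b, map_monomial _ _ _⟩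
  · rintro p q - - ⟨p', hp, rfl⟩ ⟨q', hq, rfl⟩
    exact ⟨_, add_mem hp hq, map_add _ _ _⟩

theorem monMap_surjective (hf : Function.Surjective f) : Function.Surjective (monMap N f) := by
  intro p
  obtain ⟨p', hp, h⟩ := exists_map_eq_of_surjective f hf p.2
  exact ⟨⟨p', hp⟩, Subtype.ext h⟩

theorem mem_map_of_coeff_mem {I : Ideal R} (p : monAlg R N) (hp : ∀ x, coeff x p.1 ∈ I) :
    p ∈ I.map (algebraMap R (monAlg R N)) := by
  have h : p = ∑ x ∈ p.1.support.attach, algebraMap R (monAlg R N) (coeff x.1 p.1) *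
      ⟨monomial x.1 1, monomial_mem_monAlg (p.2 x.1 (mem_support_iff.mp x.2)) 1⟩ := by
    apply Subtype.ext
    conv_lhs => rw [p.1.as_sum, ← Finset.sum_attach]
    refine Eq.trans ?_ (map_sum (monAlg R N).val _ _).symm
    refine Finset.sum_congr rfl fun x _ => ?_
    change _ = C _ * monomial x.1 (1 : R)
    rw [C_mul_monomial, mul_one]
  rw [h]
  exact Ideal.sum_mem _ fun x _ => Ideal.mul_mem_right _ _ (Ideal.mem_map_of_mem _ (hp _))

theorem monMap_eq_zero_iff {p : monAlg R N} : monMap N f p = 0 ↔ ∀ x, coeff x p.1 ∈ RingHom.ker f := by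
  rw [← Subtype.coe_inj, coe_monMap, ZeroMemClass.coe_zero, MvPolynomial.ext_iff]
  simp only [coeff_map, coeff_zero, RingHom.mem_ker]

theorem ker_monMap_le : RingHom.ker (monMap N f) ≤ (RingHom.ker f).map (algebraMap R (monAlg R N)) :=
  fun p hp => mem_map_of_coeff_mem p ((monMap_eq_zero_iff f).mp hp)

end BaseChange

section HasRank

variable {A A' : Type u} [CommRing A] [CommRing A'] {n : Type*} [Fintype n]

/-- The image of the matrix `e` has rank `k` at every point of the spectrum. -/
def HasRank (e : Matrix n n A) (k : ℕ) : Prop :=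
  ∀ (L : Type u) [Field L] (f : A →+* L), (e.map f).rank = k

theorem HasRank.map {e : Matrix n n A} {k : ℕ} (h : HasRank e k) (f : A →+* A') :
    HasRank (e.map f) k := fun L _ g => by
  have := h L (g.comp f)
  rwa [RingHom.coe_comp, ← Matrix.map_map] at this

theorem rank_of_mul_eq {L : Type*} [Field L] {k : ℕ} {e : Matrix n n L} {X : Matrix n (Fin k) L}
    {Y : Matrix (Fin k) n L} (h : X * Y = e) (h' : Y * X = 1) : e.rank = k := by
  apply le_antisymm
  · rw [← h]
    exact (Matrix.rank_mul_le_left X Y).trans ((Matrix.rank_le_card_width X).trans (by simp))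
  · have h1 : (1 : Matrix (Fin k) (Fin k) L) = Y * e * X := by
      rw [← h, ← Matrix.mul_assoc, h', Matrix.one_mul, h']
    have h2 : (1 : Matrix (Fin k) (Fin k) L).rank = k := by rw [Matrix.rank_one, Fintype.card_fin]
    rw [← h2, h1]
    exact (Matrix.rank_mul_le_left _ _).trans (Matrix.rank_mul_le_right _ _)

theorem HasRank.eq_of_mul_eq {e : Matrix n n A} {k k' : ℕ} (h : HasRank e k)
    {X : Matrix n (Fin k') A} {Y : Matrix (Fin k') n A} (h1 : X * Y = e) (h2 : Y * X = 1)
    {L : Type u} [Field L] (f : A →+* L) : k' = k := by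
  rw [← h L f]
  refine (rank_of_mul_eq (X := X.map f) (Y := Y.map f) ?_ ?_).symm
  · rw [← Matrix.map_mul, h1]
  · rw [← Matrix.map_mul, h2, Matrix.map_one _ (map_zero _) (map_one _)]

end HasRank

section Spread

variable {r : ℕ} {N : AddSubmonoid (Fin r →₀ ℕ)} {R K : Type u} [CommRing R] [Field K] {φ : R →+* K}

theorem exists_forall_of_forall_exists (φ : R →+* K) {ι : Type*} [Fintype ι] {Q : ι → R → Prop}
    (hQ : ∀ i s t, Q i s → Q i (t * s)) (h : ∀ i, ∃ s, φ s ≠ 0 ∧ Q i s) :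
    ∃ s, φ s ≠ 0 ∧ ∀ i, Q i s := by
  classical
  choose s hs hQs using h
  refine ⟨∏ i, s i, ?_, fun i => ?_⟩
  · rw [map_prod]
    exact Finset.prod_ne_zero_iff.mpr fun i _ => hs i
  · rw [← Finset.prod_erase_mul Finset.univ s (Finset.mem_univ i)]
    exact hQ _ _ _ (hQs i)

theorem exists_monMap_eq (hφ : ∀ x : K, ∃ s y, φ s ≠ 0 ∧ φ y = φ s * x) (p : monAlg K N) :
    ∃ s, φ s ≠ 0 ∧ ∃ p' : monAlg R N, monMap N φ p' = algebraMap K _ (φ s) * p := by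
  suffices h : ∃ s, φ s ≠ 0 ∧ ∃ p' ∈ monAlg R N, MvPolynomial.map φ p' = C (φ s) * p.1 by
    obtain ⟨s, hs, p', hp', h⟩ := h
    exact ⟨s, hs, ⟨p', hp'⟩, Subtype.ext h⟩
  refine SuppIn.induction (P := fun p => ∃ s, φ s ≠ 0 ∧ ∃ p' ∈ monAlg R N,
    MvPolynomial.map φ p' = C (φ s) * p) ?_ ⟨1, by simp, 0, zero_mem _, by simp⟩ ?_ p.2
  · intro x hx a
    obtain ⟨s, y, hs, hy⟩ := hφ a
    exact ⟨s, hs, monomial x y, monomial_mem_monAlg hx y, by rw [map_monomial, C_mul_monomial, hy]⟩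
  · rintro p q - - ⟨s, hs, p', hp, h⟩ ⟨t, ht, q', hq, h'⟩
    refine ⟨s * t, by simp [hs, ht], C t * p' + C s * q', add_mem (mul_mem ?_ hp) (mul_mem ?_ hq), ?_⟩
    · exact (monAlg R N).algebraMap_mem t
    · exact (monAlg R N).algebraMap_mem s
    · simp only [map_add, map_mul, map_C, h, h']
      ring

theorem exists_matrix_monMap_eq (hφ : ∀ x : K, ∃ s y, φ s ≠ 0 ∧ φ y = φ s * x) {m n : Type*}
    [Fintype m] [Fintype n] (Z : Matrix m n (monAlg K N)) :
    ∃ s, φ s ≠ 0 ∧ ∃ Z' : Matrix m n (monAlg R N),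
      Z'.map (monMap N φ) = monMap N φ (algebraMap R _ s) • Z := by
  obtain ⟨s, hs, h⟩ := exists_forall_of_forall_exists φ (ι := m × n)
    (Q := fun i s => ∃ p' : monAlg R N, monMap N φ p' = algebraMap K _ (φ s) * Z i.1 i.2)
    (fun i s t ⟨p, hp⟩ => ⟨algebraMap R _ t * p, by
      rw [map_mul, hp, monMap_algebraMap, map_mul, map_mul, mul_assoc]⟩)
    (fun i => exists_monMap_eq hφ _)
  choose p hp using h
  refine ⟨s, hs, Matrix.of fun i j => p (i, j), Matrix.ext fun i j => ?_⟩
  rw [monMap_algebraMap]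
  exact hp (i, j)

/-- A frame clearing denominators up to the kernel of a ring homomorphism. -/
theorem exists_frame_of_map {A B : Type*} [CommRing A] [CommRing B] (g : A →+* B) {n ι : Type*}
    [Fintype n] [DecidableEq n] [Fintype ι] [DecidableEq ι] {e : Matrix n n A} (he : e * e = e)
    {X : Matrix n ι B} {Y : Matrix ι n B} (h1 : X * Y = e.map g) (h2 : Y * X = 1)
    {X' : Matrix n ι A} {Y' : Matrix ι n A} {s t : A} (hX : X'.map g = g s • X)
    (hY : Y'.map g = g t • Y) :
    ∃ (X : Matrix n ι A) (Y : Matrix ι n A), e * X = X ∧ Y * e = Y ∧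
      (X * Y).map g = ((s * t) • e).map g ∧
      (Y * X).map g = ((s * t) • (1 : Matrix ι ι A)).map g := by
  have he' : e.map g * e.map g = e.map g := by rw [← Matrix.map_mul, he]
  refine ⟨e * X', Y' * e, ?_, ?_, ?_, ?_⟩
  · rw [← Matrix.mul_assoc, he]
  · rw [Matrix.mul_assoc, he]
  · rw [Matrix.map_mul, Matrix.map_mul, Matrix.map_mul, hX, hY, Matrix.map_smul_ringHom, map_mul]
    rw [Matrix.mul_smul, Matrix.smul_mul, Matrix.smul_mul, Matrix.mul_smul, smul_smul,
      ← Matrix.mul_assoc, Matrix.mul_assoc (e.map g) X Y, h1, he', he']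
  · rw [Matrix.map_mul, Matrix.map_mul, Matrix.map_mul, hX, hY, Matrix.map_smul_ringHom, map_mul,
      Matrix.map_one _ (map_zero _) (map_one _), Matrix.smul_mul, Matrix.smul_mul, Matrix.mul_smul,
      Matrix.mul_smul, ← Matrix.mul_assoc, Matrix.mul_assoc Y, he', Matrix.mul_assoc Y, ← h1,
      Matrix.mul_assoc X, h2, Matrix.mul_one, h2, smul_smul, mul_comm]

variable {c : ℕ} {n : Type*} [Fintype n] [DecidableEq n]

theorem GoodMon.exists_mul_eq (hN : GoodMon c N) {m : ℕ} (hmr : m ≤ r)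
    {e : Matrix n n (monAlg K (levelMon N m))} (he : e * e = e) {k : ℕ} (hk : HasRank e k) :
    ∃ (X : Matrix n (Fin k) (monAlg K (levelMon N m))) (Y : Matrix (Fin k) n (monAlg K (levelMon N m))),
      X * Y = e ∧ Y * X = 1 := by
  obtain ⟨k', X, Y, hX, hY, h1, h2⟩ := hN.exists_free hmr (matIn_map_val e)
    (Matrix.map_mul_self he (monAlg K (levelMon N m)).val.toRingHom)
  have h1' : hX.lift * hY.lift = e := Matrix.map_injective
    (f := (monAlg K (levelMon N m)).val.toRingHom) Subtype.val_injective <| by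
      dsimp only
      rw [Matrix.map_mul]
      exact h1
  have h2' : hY.lift * hX.lift = 1 := Matrix.map_injective
    (f := (monAlg K (levelMon N m)).val.toRingHom) Subtype.val_injective <| by
      dsimp only
      rw [Matrix.map_mul, Matrix.map_one _ (map_zero _) (map_one _)]
      exact h2
  obtain rfl := hk.eq_of_mul_eq h1' h2' (constantCoeff.comp (monAlg K (levelMon N m)).val.toRingHom)
  exact ⟨_, _, h1', h2'⟩

theorem GoodMon.exists_local_frame (hN : GoodMon c N) {m : ℕ} (hmr : m ≤ r)
    (hφ : ∀ x : K, ∃ s y, φ s ≠ 0 ∧ φ y = φ s * x)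
    {e : Matrix n n (monAlg R (levelMon N m))} (he : e * e = e) {k : ℕ} (hk : HasRank e k) :
    ∃ s, φ s ≠ 0 ∧ ∃ (X : Matrix n (Fin k) (monAlg R (levelMon N m)))
      (Y : Matrix (Fin k) n (monAlg R (levelMon N m))), e * X = X ∧ Y * e = Y ∧
      (X * Y).map (monMap _ φ) = (algebraMap R (monAlg R (levelMon N m)) s • e).map (monMap _ φ) ∧
      (Y * X).map (monMap _ φ) = (algebraMap R (monAlg R (levelMon N m)) s •
        (1 : Matrix (Fin k) (Fin k) (monAlg R (levelMon N m)))).map (monMap _ φ) := by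
  obtain ⟨X, Y, h1, h2⟩ := hN.exists_mul_eq hmr
    (Matrix.map_mul_self he (monMap (levelMon N m) φ)) (hk.map (monMap (levelMon N m) φ))
  obtain ⟨s, hs, X', hX⟩ := exists_matrix_monMap_eq hφ X
  obtain ⟨t, ht, Y', hY⟩ := exists_matrix_monMap_eq hφ Y
  have h := exists_frame_of_map (monMap (levelMon N m) φ) he h1 h2 hX hY
  rw [← map_mul] at h
  exact ⟨s * t, by simp [hs, ht], h⟩

end Spread

section Patch

theorem Matrix.map_sum_smul {A B Q m n : Type*} [CommRing A] [CommRing B] [Fintype Q] (g : A →+* B)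
    (t : Q → A) (Z : Q → Matrix m n A) (q₀ : Q) (h : ∀ q, q ≠ q₀ → g (t q) = 0) :
    (∑ q, t q • Z q).map g = g (t q₀) • (Z q₀).map g := by
  ext i j
  rw [Matrix.map_apply, Matrix.sum_apply, map_sum, Finset.sum_eq_single q₀]
  · exact map_mul _ _ _
  · intro q _ hq
    rw [Matrix.smul_apply, smul_eq_mul, map_mul, h q hq, zero_mul]
  · exact fun h => (h (Finset.mem_univ _)).elim

theorem Matrix.eq_of_forall_map_eq {A Q m n : Type*} [CommRing A] {B : Q → Type*}
    [∀ q, CommRing (B q)] (g : ∀ q, A →+* B q) (hg : ∀ a, (∀ q, g q a = 0) → a = 0)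
    {Z Z' : Matrix m n A} (h : ∀ q, Z.map (g q) = Z'.map (g q)) : Z = Z' := by
  ext i j
  refine sub_eq_zero.mp (hg _ fun q => ?_)
  rw [map_sub, sub_eq_zero]
  exact congrFun (congrFun (h q) i) j

/-- Frames modulo several ideals with zero intersection combine into a frame. -/
theorem isFrame_sum_smul {A Q n ι : Type*} [CommRing A] [Fintype Q] {B : Q → Type*}
    [∀ q, CommRing (B q)] [Fintype n] [DecidableEq n] [Fintype ι] [DecidableEq ι]
    (g : ∀ q, A →+* B q) (hg : ∀ a, (∀ q, g q a = 0) → a = 0) {t s : Q → A}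
    (ht : ∀ q q', q ≠ q' → g q' (t q) = 0) {e : Matrix n n A}
    {X : Q → Matrix n ι A} {Y : Q → Matrix ι n A} (hX : ∀ q, e * X q = X q)
    (hY : ∀ q, Y q * e = Y q) (hXY : ∀ q, (X q * Y q).map (g q) = (s q • e).map (g q))
    (hYX : ∀ q, (Y q * X q).map (g q) = (s q • (1 : Matrix ι ι A)).map (g q)) :
    IsFrame e (∑ q, t q • X q) (∑ q, t q • Y q) (∑ q, t q * (t q * s q)) := by
  have hs : ∀ q, g q (∑ q, t q * (t q * s q)) = g q (t q) * (g q (t q) * g q (s q)) := by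
    intro q
    rw [map_sum, Finset.sum_eq_single q]
    · rw [map_mul, map_mul]
    · intro q' _ hq
      rw [map_mul, ht q' q hq, zero_mul]
    · exact fun h => (h (Finset.mem_univ _)).elim
  refine ⟨?_, ?_, ?_, ?_⟩
  · refine Matrix.eq_of_forall_map_eq g hg fun q => ?_
    have h := hXY q
    rw [Matrix.map_mul, Matrix.map_smul_ringHom] at h
    rw [Matrix.map_mul, Matrix.map_sum_smul _ _ _ q fun q' h => ht q' q h,
      Matrix.map_sum_smul _ _ _ q fun q' h => ht q' q h, Matrix.map_smul_ringHom, hs,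
      Matrix.smul_mul, Matrix.mul_smul, h, smul_smul, smul_smul, mul_assoc]
  · refine Matrix.eq_of_forall_map_eq g hg fun q => ?_
    have h := hYX q
    rw [Matrix.map_mul, Matrix.map_smul_ringHom] at h
    rw [Matrix.map_mul, Matrix.map_sum_smul _ _ _ q fun q' h => ht q' q h,
      Matrix.map_sum_smul _ _ _ q fun q' h => ht q' q h, Matrix.map_smul_ringHom, hs,
      Matrix.smul_mul, Matrix.mul_smul, h, smul_smul, smul_smul, mul_assoc]
  · rw [Matrix.mul_sum]
    exact Finset.sum_congr rfl fun q _ => by rw [Matrix.mul_smul, hX]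
  · rw [Matrix.sum_mul]
    exact Finset.sum_congr rfl fun q _ => by rw [Matrix.smul_mul, hY]

theorem eq_zero_of_forall_mem_minimalPrimes {R : Type*} [CommRing R] [IsReduced R] {x : R}
    (h : ∀ q ∈ minimalPrimes R, x ∈ q) : x = 0 := by
  have h1 : x ∈ sInf (⊥ : Ideal R).minimalPrimes := Submodule.mem_sInf.mpr h
  rw [Ideal.sInf_minimalPrimes] at h1
  obtain ⟨k, hk⟩ := h1
  exact IsNilpotent.eq_zero ⟨k, hk⟩

end Patch

section Spread

variable {r : ℕ} {N : AddSubmonoid (Fin r →₀ ℕ)} {R : Type u} [CommRing R]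

theorem exists_notMem_forall_mem [IsNoetherianRing R] {q : Ideal R} (hq : q ∈ minimalPrimes R) :
    ∃ t ∉ q, ∀ q' ∈ minimalPrimes R, q' ≠ q → t ∈ q' := by
  classical
  have hfin := minimalPrimes.finite_of_isNoetherianRing R
  have := hq.1.1
  have h : ¬ (hfin.toFinset.erase q).inf id ≤ q := by
    rw [Ideal.IsPrime.inf_le' this]
    rintro ⟨q', hq', hle⟩
    rw [Finset.mem_erase, hfin.mem_toFinset] at hq'
    exact hq'.1 (le_antisymm hle (hq.2 hq'.2.1 hle))
  obtain ⟨t, ht, htq⟩ := SetLike.not_le_iff_exists.mp h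
  refine ⟨t, htq, fun q' hq' hne => ?_⟩
  exact Finset.inf_le (f := id) (Finset.mem_erase.mpr ⟨hne, hfin.mem_toFinset.mpr hq'⟩) ht

theorem exists_fractionRing_eq (q : Ideal R) [q.IsPrime]
    (x : FractionRing (R ⧸ q)) :
    ∃ s y : R, (algebraMap (R ⧸ q) (FractionRing (R ⧸ q))).comp (Ideal.Quotient.mk q) s ≠ 0 ∧
      (algebraMap (R ⧸ q) (FractionRing (R ⧸ q))).comp (Ideal.Quotient.mk q) y =
      (algebraMap (R ⧸ q) (FractionRing (R ⧸ q))).comp (Ideal.Quotient.mk q) s * x := by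
  obtain ⟨⟨y, s⟩, h⟩ := IsLocalization.surj (nonZeroDivisors (R ⧸ q)) x
  obtain ⟨y, rfl⟩ := Ideal.Quotient.mk_surjective y
  obtain ⟨s', hs'⟩ := Ideal.Quotient.mk_surjective s.1
  refine ⟨s', y, ?_, ?_⟩
  · rw [RingHom.comp_apply, hs', Ne, FaithfulSMul.algebraMap_eq_zero_iff]
    exact nonZeroDivisors.ne_zero s.2
  · rw [RingHom.comp_apply, RingHom.comp_apply, hs', mul_comm]
    exact h.symm

theorem comp_fractionRing_eq_zero_iff (q : Ideal R) [q.IsPrime] (x : R) :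
    (algebraMap (R ⧸ q) (FractionRing (R ⧸ q))).comp (Ideal.Quotient.mk q) x = 0 ↔ x ∈ q := by
  rw [RingHom.comp_apply, FaithfulSMul.algebraMap_eq_zero_iff, Ideal.Quotient.eq_zero_iff_mem]

variable {c : ℕ} {n : Type*} [Fintype n] [DecidableEq n]

theorem GoodMon.exists_frame [IsNoetherianRing R] [IsReduced R] (hN : GoodMon c N) {m : ℕ}
    (hmr : m ≤ r) {e : Matrix n n (monAlg R (levelMon N m))} (he : e * e = e) {k : ℕ}
    (hk : HasRank e k) :
    ∃ s ∈ nonZeroDivisors R, ∃ (X : Matrix n (Fin k) (monAlg R (levelMon N m)))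
      (Y : Matrix (Fin k) n (monAlg R (levelMon N m))), IsFrame e X Y (algebraMap R _ s) := by
  classical
  have _ : Fintype (minimalPrimes R) := (minimalPrimes.finite_of_isNoetherianRing R).fintype
  have hp : ∀ q : minimalPrimes R, q.1.IsPrime := fun q => q.2.1.1
  let φ : ∀ q : minimalPrimes R, R →+* FractionRing (R ⧸ q.1) := fun q =>
    (algebraMap (R ⧸ q.1) (FractionRing (R ⧸ q.1))).comp (Ideal.Quotient.mk q.1)
  have hφ : ∀ q x, φ q x = 0 ↔ x ∈ q.1 := fun q x => comp_fractionRing_eq_zero_iff q.1 x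
  choose s hs X Y hX hY hXY hYX using fun q : minimalPrimes R =>
    hN.exists_local_frame hmr (exists_fractionRing_eq q.1) he hk
  choose t htq ht using fun q : minimalPrimes R => exists_notMem_forall_mem q.2
  have hf := isFrame_sum_smul (fun q => monMap (levelMon N m) (φ q)) (fun a ha => ?_)
    (t := fun q => algebraMap R (monAlg R (levelMon N m)) (t q))
    (s := fun q => algebraMap R (monAlg R (levelMon N m)) (s q)) (fun q q' hq => ?_) hX hY hXY hYX
  · simp only [← map_mul, ← map_sum] at hf
    refine ⟨_, ?_, _, _, hf⟩
    rw [mem_nonZeroDivisors_iff_right]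
    intro x hx
    refine eq_zero_of_forall_mem_minimalPrimes fun q hq => ?_
    have hx' : x * ∑ q, t q * (t q * s q) ∈ q := hx ▸ zero_mem q
    refine ((hp ⟨q, hq⟩).mem_or_mem hx').resolve_right fun hmem => ?_
    rw [← hφ ⟨q, hq⟩, map_sum, Finset.sum_eq_single ⟨q, hq⟩, hφ] at hmem
    · rcases (hp ⟨q, hq⟩).mem_or_mem hmem with h | h
      · exact htq _ h
      · rcases (hp ⟨q, hq⟩).mem_or_mem h with h | h
        · exact htq _ h
        · exact hs _ ((hφ _ _).mpr h)
    · intro q' _ hne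
      rw [hφ]
      exact Ideal.mul_mem_right _ _ (ht q' q hq fun h => hne (Subtype.ext h.symm))
    · exact fun h => (h (Finset.mem_univ _)).elim
  · refine Subtype.ext (MvPolynomial.ext _ _ fun x => ?_)
    refine eq_zero_of_forall_mem_minimalPrimes fun q hq => ?_
    rw [← hφ ⟨q, hq⟩]
    exact (monMap_eq_zero_iff _).mp (ha ⟨q, hq⟩) x
  · rw [monMap_algebraMap, (hφ q' _).mpr (ht q q'.1 q'.2 fun h => hq (Subtype.ext h.symm)), map_zero]

end Spread

section Lift

variable {A B n : Type*} [CommRing A] [CommRing B] [Fintype n] [DecidableEq n]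

theorem sup_ker_eq_top {g : A →+* B} (hg : Function.Surjective g) {I : Ideal A} (h : I.map g = ⊤) :
    I ⊔ RingHom.ker g = ⊤ := by
  have := Ideal.comap_map_of_surjective g hg I
  rw [h, Ideal.comap_top] at this
  exact this.symm

theorem eq_top_of_sup_nilradical {I J : Ideal A} (h : I ⊔ J = ⊤) (hJ : J ≤ nilradical A) :
    I = ⊤ := by
  obtain ⟨x, hx, y, hy, hxy⟩ := Submodule.mem_sup.mp ((Ideal.eq_top_iff_one _).mp h)
  have hu : IsUnit x := by
    rw [eq_sub_of_add_eq hxy]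
    exact IsNilpotent.isUnit_one_sub (hJ hy)
  exact Ideal.eq_top_of_isUnit_mem _ hx hu

omit [DecidableEq n] in
/-- A section of the image of `e` over a quotient lifts compatibly with a retraction `ρ`. -/
theorem exists_lift_unimodular {g : A →+* B} (hg : Function.Surjective g) {ρ : A →+* A}
    {ρ' : B →+* B} (hρ : ∀ a, g (ρ a) = ρ' (g a)) (hρρ : ∀ a, ρ (ρ a) = ρ a)
    {e : Matrix n n A} (he : e * e = e) {p₀ : n → A} (h₀ : ρ ∘ p₀ = p₀)
    (he₀ : (e.map ρ).mulVec p₀ = p₀) {q : n → B} (hq : (e.map g).mulVec q = q)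
    (hρq : ρ' ∘ q = g ∘ p₀) (htop : Ideal.span (Set.range q) = ⊤) :
    ∃ p : n → A, e.mulVec p = p ∧ ρ ∘ p = p₀ ∧ Ideal.span (Set.range p) ⊔ RingHom.ker g = ⊤ := by
  choose a ha using fun i => hg (q i)
  have hgp : g ∘ e.mulVec (a - ρ ∘ a + p₀) = q := by
    rw [← map_mulVec_comp]
    conv_rhs => rw [← hq]
    congr 1
    funext i
    have h := congrFun hρq i
    simp only [Function.comp_apply, Pi.add_apply, Pi.sub_apply, map_add, map_sub, hρ, ha] at h ⊢
    rw [h]; ring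
  refine ⟨e.mulVec (a - ρ ∘ a + p₀), by rw [Matrix.mulVec_mulVec, he], ?_, ?_⟩
  · rw [← map_mulVec_comp]
    conv_rhs => rw [← he₀]
    congr 1
    funext i
    have h := congrFun h₀ i
    simp only [Function.comp_apply, Pi.add_apply, Pi.sub_apply, map_add, map_sub, hρρ] at h ⊢
    rw [h]; ring
  · apply sup_ker_eq_top hg
    rw [← span_range_comp, hgp, htop]

omit [DecidableEq n] in
/-- General position: a section unimodular modulo `s` can be moved by multiples of `s * W` so that
its zero locus outside that of `W` has large height. -/
theorem exists_add_smul_forall_le_height [IsNoetherianRing A] {k : ℕ} {e : Matrix n n A}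
    {X : Matrix n (Fin k) A} {Y : Matrix (Fin k) n A} {s : A} (hf : IsFrame e X Y s) {p : n → A}
    (hs : Ideal.span (Set.range p) ⊔ Ideal.span {s} = ⊤) (W : A)
    (hW : ∀ 𝔮 : Ideal A, 𝔮.IsPrime → W ∈ 𝔮 → ¬ Ideal.span (Set.range p) ≤ 𝔮) :
    ∃ v : n → A, e.mulVec v = v ∧ ∀ 𝔮 : Ideal A, 𝔮.IsPrime →
      Ideal.span (Set.range (p + (s * W) • v)) ≤ 𝔮 → (k : ℕ∞) ≤ 𝔮.height := by
  obtain ⟨a, ha⟩ := exists_forall_le_height_of_add_mul_mem (s * s * W) k (Y.mulVec p)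
  refine ⟨X.mulVec a, by rw [Matrix.mulVec_mulVec, hf.left], fun 𝔮 h𝔮 hle => ha 𝔮 h𝔮 ?_ ?_⟩
  · rw [span_range_le_iff] at hle
    have hdiv : ∀ x, x ∈ 𝔮 → x ∣ s * W → Ideal.span (Set.range p) ≤ 𝔮 := fun x hx hd => by
      rw [span_range_le_iff]
      intro i
      have h2 : s * W ∈ 𝔮 := 𝔮.mem_of_dvd hd hx
      exact (𝔮.add_mem_iff_left (𝔮.mul_mem_right _ h2)).mp (hle i)
    intro hmem
    have hsq : s ∈ 𝔮 → False := fun hsq => by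
      refine h𝔮.ne_top (top_le_iff.mp ?_)
      rw [← hs, sup_le_iff, Ideal.span_singleton_le_iff_mem]
      exact ⟨hdiv s hsq (dvd_mul_right _ _), hsq⟩
    rcases h𝔮.mem_or_mem hmem with h | h
    · rcases h𝔮.mem_or_mem h with h | h <;> exact hsq h
    · exact hW 𝔮 h𝔮 h (hdiv W h (dvd_mul_left _ _))
  · intro i
    have h := mulVec_mem 𝔮 Y (span_range_le_iff.mp hle) i
    rw [Matrix.mulVec_add, Matrix.mulVec_smul, Matrix.mulVec_mulVec, hf.mul_eq', Matrix.smul_mulVec,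
      Matrix.one_mulVec] at h
    simp only [Pi.add_apply, Pi.smul_apply, smul_eq_mul] at h
    rwa [show s * W * (s * a i) = s * s * W * a i by ring] at h

end Lift

section LevelLift

variable {r : ℕ} {N : AddSubmonoid (Fin r →₀ ℕ)} {c : ℕ} {R : Type u} [CommRing R]
  {n : Type*} [Fintype n] [DecidableEq n]

theorem GoodMon.sub_scaleHom_mem (hN : GoodMon c N) (j : Fin r)
    {𝔮 : Ideal (monAlg R (levelMon N (j.val + 1)))} (h𝔮 : 𝔮.IsPrime)
    (h : monElt R (⟨Finsupp.single j c, hN.single_mem_level (Nat.lt_succ_self _)⟩ :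
      levelMon N (j.val + 1)) ∈ 𝔮) (p : monAlg R (levelMon N (j.val + 1))) :
    p - scaleHom j 0 p ∈ 𝔮 := by
  suffices h : ∃ q ∈ 𝔮, q.1 = p.1 - scaleVar j 0 p.1 by
    obtain ⟨q, hq, hqp⟩ := h
    exact (Subtype.ext hqp : q = p - scaleHom j 0 p) ▸ hq
  refine SuppIn.induction (P := fun p => ∃ q ∈ 𝔮, q.1 = p - scaleVar j 0 p) ?_
    ⟨0, zero_mem _, by simp⟩ ?_ p.2
  · intro y hy a
    by_cases hyj : y j = 0
    · exact ⟨0, zero_mem _, by rw [scaleVar_of_mem_face (N := levelMon N (j.val + 1)) j 0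
        (p := monomial y a)
        (SuppIn.monomial (T := (faceMon j (levelMon N (j.val + 1)) : Set (Fin r →₀ ℕ)))
          (show y ∈ faceMon j _ from ⟨hy, hyj⟩) a), sub_self]; rfl⟩
    · have hc := hN.pos
      refine ⟨⟨monomial y a, monomial_mem_monAlg hy a⟩, ?_, ?_⟩
      · have hle : Finsupp.single j c ≤ (2 * c) • y := by
          rw [Finsupp.single_le_iff, Finsupp.smul_apply, smul_eq_mul]
          nlinarith [Nat.pos_of_ne_zero hyj]
        have hz : (2 * c) • y - Finsupp.single j c ∈ levelMon N (j.val + 1) := by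
          refine hN.mem_of_add_level _ j ?_ ?_
          · rw [Finsupp.tsub_apply, Finsupp.smul_apply, Finsupp.single_eq_same, smul_eq_mul]
            have := Nat.pos_of_ne_zero hyj
            have : c < 2 * c * y j := by nlinarith
            omega
          · rw [tsub_add_cancel_of_le hle]
            exact nsmul_mem hy _
        refine h𝔮.mem_of_pow_mem (2 * c) ?_
        have := 𝔮.mul_mem_right ⟨monomial _ (a ^ (2 * c)), monomial_mem_monAlg hz _⟩ h
        convert this using 1
        apply Subtype.ext
        change monomial y a ^ (2 * c) = monomial _ 1 * monomial _ _
        rw [monomial_pow, monomial_mul, one_mul]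
        change _ = monomial (Finsupp.single j c + _) _
        rw [add_tsub_cancel_of_le hle]
      · rw [scaleVar_monomial, zero_pow hyj, zero_mul, sub_zero]
  · rintro p q - - ⟨p', hp, h⟩ ⟨q', hq, h'⟩
    refine ⟨p' + q', add_mem hp hq, ?_⟩
    change p'.1 + q'.1 = _
    rw [h, h', map_add]; ring

omit [DecidableEq n] in
theorem GoodMon.exists_unimodular_of_sup_eq_top [IsNoetherianRing R] (hN : GoodMon c N) (j : Fin r)
    {k d : ℕ} (hd : ringKrullDim R < d) (hdk : d ≤ k)
    {e : Matrix n n (monAlg R (levelMon N (j.val + 1)))}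
    {X : Matrix n (Fin k) (monAlg R (levelMon N (j.val + 1)))}
    {Y : Matrix (Fin k) n (monAlg R (levelMon N (j.val + 1)))} {s : R}
    (hf : IsFrame e X Y (algebraMap R _ s)) {p : n → monAlg R (levelMon N (j.val + 1))}
    (hp : e.mulVec p = p) (hs : Ideal.span (Set.range p) ⊔ Ideal.span {algebraMap R _ s} = ⊤)
    (hρ : Ideal.span (Set.range (scaleHom j 0 ∘ p)) = ⊤) :
    ∃ p' : n → monAlg R (levelMon N (j.val + 1)), e.mulVec p' = p' ∧
      scaleHom j 0 ∘ p' = scaleHom j 0 ∘ p ∧ Ideal.span (Set.range p') = ⊤ := by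
  have _ := hN.isNoetherianRing (R := R) j.2
  obtain ⟨W, hW⟩ : ∃ W, W = monElt R (⟨Finsupp.single j c, hN.single_mem_level
    (Nat.lt_succ_self _)⟩ : levelMon N (j.val + 1)) := ⟨_, rfl⟩
  have hW0 : scaleHom j 0 W = 0 := by
    rw [hW]
    apply Subtype.ext
    change scaleVar j 0 (monomial (Finsupp.single j c) (1 : R)) = 0
    rw [scaleVar_monomial, Finsupp.single_eq_same, zero_pow hN.pos.ne', zero_mul]
  obtain ⟨v, hv, hht⟩ := exists_add_smul_forall_le_height hf hs W fun 𝔮 h𝔮 hWq hle => by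
    refine h𝔮.ne_top (top_le_iff.mp ?_)
    rw [← hρ, span_range_le_iff]
    rw [span_range_le_iff] at hle
    intro i
    rw [hW] at hWq
    have h1 := hN.sub_scaleHom_mem j h𝔮 hWq (p i)
    have h2 := 𝔮.sub_mem (hle i) h1
    rwa [sub_sub_cancel] at h2
  obtain ⟨σ, hσ⟩ : ∃ σ, σ = algebraMap R (monAlg R (levelMon N (j.val + 1))) s := ⟨_, rfl⟩
  rw [← hσ] at hht hs
  have hρ' : scaleHom j 0 ∘ (p + (σ * W) • v) = scaleHom j 0 ∘ p := by
    funext i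
    simp only [Function.comp_apply, Pi.add_apply, Pi.smul_apply, smul_eq_mul, map_add, map_mul, hW0]
    ring
  have hp1 : e.mulVec (p + (σ * W) • v) = p + (σ * W) • v := by
    rw [Matrix.mulVec_add, hp, Matrix.mulVec_smul, hv]
  have hs1 : Ideal.span (Set.range (p + (σ * W) • v)) ⊔ Ideal.span {σ} = ⊤ := by
    rw [← top_le_iff, ← hs, sup_le_iff, span_range_le_iff]
    refine ⟨fun i => ?_, le_sup_right⟩
    have h1 : p i = (p + (σ * W) • v) i + σ * -(W * v i) := by
      simp only [Pi.add_apply, Pi.smul_apply, smul_eq_mul]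
      ring
    rw [h1]
    exact add_mem (Ideal.mem_sup_left (Ideal.subset_span ⟨i, rfl⟩))
      (Ideal.mem_sup_right (Ideal.mul_mem_right _ _ (Ideal.mem_span_singleton_self σ)))
  obtain ⟨F, hF, hFp⟩ := hN.exists_lexMonic_mem (m := j.val + 1) j.2 hd _ fun 𝔮 h𝔮 hle =>
    le_trans (by exact_mod_cast hdk) (hht 𝔮 h𝔮 hle)
  rw [← hρ'] at hρ ⊢
  generalize p + (σ * W) • v = p₁ at *
  subst hσ
  exact hN.exists_unimodular_of_lexMonic j hf hp1 hs1 hρ hF hFp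

end LevelLift

section Induction

theorem subsingleton_of_ringKrullDim_lt_zero {R : Type*} [CommRing R]
    (h : ringKrullDim R < (0 : ℕ)) : Subsingleton R := by
  by_contra hR
  rw [not_subsingleton_iff_nontrivial] at hR
  exact absurd (ringKrullDim_nonneg_of_nontrivial (R := R)) (not_le.mpr h)

theorem ringKrullDim_quotient_lt_of_nonZeroDivisor {R : Type*} [CommRing R] {s : R}
    (hs : s ∈ nonZeroDivisors R) {d : ℕ} (h : ringKrullDim R < (d + 1 : ℕ)) :
    ringKrullDim (R ⧸ Ideal.span {s}) < d := by
  by_contra! hd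
  refine absurd h (not_lt.mpr (le_trans ?_ (ringKrullDim_quotient_succ_le_of_nonZeroDivisor hs)))
  rw [Nat.cast_add, Nat.cast_one]
  exact add_le_add_left hd 1

variable {r : ℕ} {N : AddSubmonoid (Fin r →₀ ℕ)}

theorem subsingleton_monAlg {R : Type*} [CommRing R] [Subsingleton R] :
    Subsingleton (monAlg R N) :=
  ⟨fun _ _ => Subtype.ext (MvPolynomial.ext _ _ fun _ => Subsingleton.elim _ _)⟩

theorem map_nilradical_le_nilradical {R A : Type*} [CommRing R] [CommRing A] (f : R →+* A) :
    (nilradical R).map f ≤ nilradical A :=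
  Ideal.map_le_iff_le_comap.mpr fun _ hx => IsNilpotent.map hx f

variable {c : ℕ} {n : Type*} [Fintype n] [DecidableEq n]

/-- Unimodular sections of projective modules of rank `k` over `R[N]` lift from the face where
the coordinate `j` vanishes. -/
def HasLifts (n : Type*) [Fintype n] (N : AddSubmonoid (Fin r →₀ ℕ)) (j : Fin r) (k : ℕ)
    (R : Type u) [CommRing R] : Prop :=
  ∀ (e : Matrix n n (monAlg R N)), e * e = e → HasRank e k → ∀ p₀ : n → monAlg R N,
    scaleHom j 0 ∘ p₀ = p₀ → (e.map (scaleHom j (0 : monAlg R N)).toRingHom).mulVec p₀ = p₀ →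
    Ideal.span (Set.range p₀) = ⊤ → ∃ p : n → monAlg R N, e.mulVec p = p ∧
      scaleHom j 0 ∘ p = p₀ ∧ Ideal.span (Set.range p) = ⊤

theorem scaleHom_zero_scaleHom_zero {R : Type*} [CommRing R] (j : Fin r) (p : monAlg R N) :
    scaleHom j 0 (scaleHom j 0 p) = scaleHom j 0 p :=
  Subtype.ext (scaleVar_zero_comp j 0 p.1)

omit [DecidableEq n] in
theorem HasLifts.of_subsingleton (j : Fin r) (k : ℕ) (R : Type u) [CommRing R] [Subsingleton R] :
    HasLifts n N j k R := fun _ _ _ p₀ _ _ _ => by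
  have _ := subsingleton_monAlg (R := R) (N := N)
  exact ⟨p₀, Subsingleton.elim _ _, Subsingleton.elim _ _, Subsingleton.elim _ _⟩

omit [DecidableEq n] in
theorem HasLifts.exists_sup_eq_top {R R' : Type u} [CommRing R] [CommRing R'] {f : R →+* R'}
    (hf : Function.Surjective f) {j : Fin r} {k : ℕ} (h : HasLifts n N j k R')
    {e : Matrix n n (monAlg R N)} (he : e * e = e) (hk : HasRank e k)
    {p₀ : n → monAlg R N} (h₀ : scaleHom j 0 ∘ p₀ = p₀)
    (he₀ : (e.map (scaleHom j (0 : monAlg R N)).toRingHom).mulVec p₀ = p₀)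
    (ht : Ideal.span (Set.range p₀) = ⊤) :
    ∃ p : n → monAlg R N, e.mulVec p = p ∧ scaleHom j 0 ∘ p = p₀ ∧
      Ideal.span (Set.range p) ⊔ (RingHom.ker f).map (algebraMap R (monAlg R N)) = ⊤ := by
  have hρ : ∀ a, monMap N f ((scaleHom j (0 : monAlg R N)).toRingHom a) =
    (scaleHom j (0 : monAlg R' N)).toRingHom (monMap N f a) := monMap_scaleHom_zero f j
  obtain ⟨q, hq, hρq, hq1⟩ := h (e.map (monMap N f)) (by rw [← Matrix.map_mul, he]) (hk.map _)
    (monMap N f ∘ p₀) (funext fun i => by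
      have := congrArg (monMap N f) (congrFun h₀ i)
      rw [Function.comp_apply, monMap_scaleHom_zero] at this
      exact this) (by
      conv_rhs => rw [← he₀, ← map_mulVec_comp]
      rw [Matrix.map_map, Matrix.map_map]
      congr 1
      exact Matrix.ext fun i i' => (hρ _).symm) (by rw [span_range_comp, ht, Ideal.map_top])
  obtain ⟨p, hp, hp0, hp1⟩ := exists_lift_unimodular (monMap_surjective f hf) hρ
    (scaleHom_zero_scaleHom_zero j) he h₀ he₀ hq hρq hq1
  refine ⟨p, hp, hp0, top_le_iff.mp (hp1 ▸ ?_)⟩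
  exact sup_le_sup_left (ker_monMap_le f) _

theorem GoodMon.hasLifts (hN : GoodMon c N) (j : Fin r) (d : ℕ) {k : ℕ} (hdk : d ≤ k) :
    ∀ (R : Type u) [CommRing R] [IsNoetherianRing R], ringKrullDim R < d →
      HasLifts n (levelMon N (j.val + 1)) j k R := by
  induction d with
  | zero =>
    intro R _ _ hd
    have _ := subsingleton_of_ringKrullDim_lt_zero hd
    exact HasLifts.of_subsingleton j k R
  | succ d ih =>
    have hred : ∀ (R : Type u) [CommRing R] [IsNoetherianRing R] [IsReduced R],
        ringKrullDim R < (d + 1 : ℕ) → HasLifts n (levelMon N (j.val + 1)) j k R := by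
      intro R _ _ _ hd e he hk p₀ h₀ he₀ ht
      obtain ⟨s, hs, X, Y, hf⟩ := hN.exists_frame j.2 he hk
      obtain ⟨p, hp, hp0, hp1⟩ := (ih (by omega) (R ⧸ Ideal.span {s})
        (ringKrullDim_quotient_lt_of_nonZeroDivisor hs hd)).exists_sup_eq_top
        Ideal.Quotient.mk_surjective he hk h₀ he₀ ht
      rw [Ideal.mk_ker, Ideal.map_span, Set.image_singleton] at hp1
      subst hp0
      exact hN.exists_unimodular_of_sup_eq_top j hd hdk hf hp hp1 ht
    intro R _ _ hd e he hk p₀ h₀ he₀ ht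
    have _ : IsReduced (R ⧸ nilradical R) :=
      (Ideal.isRadical_iff_quotient_reduced _).mp (Ideal.radical_isRadical ⊥)
    obtain ⟨p, hp, hp0, hp1⟩ := (hred (R ⧸ nilradical R)
      (lt_of_le_of_lt (ringKrullDim_quotient_le _) hd)).exists_sup_eq_top
      Ideal.Quotient.mk_surjective he hk h₀ he₀ ht
    rw [Ideal.mk_ker] at hp1
    exact ⟨p, hp, hp0, eq_top_of_sup_nilradical hp1 (map_nilradical_le_nilradical _)⟩

end Induction

section Serre

variable {r : ℕ} {N : AddSubmonoid (Fin r →₀ ℕ)} {c : ℕ} {n : Type*} [Fintype n] [DecidableEq n]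

/-- Projective modules of rank `k` over `R[N]` have unimodular sections. -/
def HasSections (n : Type*) [Fintype n] (N : AddSubmonoid (Fin r →₀ ℕ)) (k : ℕ)
    (R : Type u) [CommRing R] : Prop :=
  ∀ (e : Matrix n n (monAlg R N)), e * e = e → HasRank e k →
    ∃ p : n → monAlg R N, e.mulVec p = p ∧ Ideal.span (Set.range p) = ⊤

omit [DecidableEq n] in
theorem HasSections.exists_sup_eq_top {R R' : Type u} [CommRing R] [CommRing R'] {f : R →+* R'}
    (hf : Function.Surjective f) {k : ℕ} (h : HasSections n N k R')
    {e : Matrix n n (monAlg R N)} (he : e * e = e) (hk : HasRank e k) :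
    ∃ p : n → monAlg R N, e.mulVec p = p ∧
      Ideal.span (Set.range p) ⊔ (RingHom.ker f).map (algebraMap R (monAlg R N)) = ⊤ := by
  obtain ⟨q, hq, hq1⟩ := h (e.map (monMap N f)) (by rw [← Matrix.map_mul, he]) (hk.map _)
  choose a ha using fun i => monMap_surjective f hf (q i)
  have ha' : monMap N f ∘ a = q := funext ha
  refine ⟨e.mulVec a, by rw [Matrix.mulVec_mulVec, he], top_le_iff.mp ?_⟩
  have h1 := sup_ker_eq_top (monMap_surjective (N := N) f hf)
    (I := Ideal.span (Set.range (e.mulVec a)))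
    (by rw [← span_range_comp, ← map_mulVec_comp, ha', hq, hq1])
  rw [← h1]
  exact sup_le_sup_left (ker_monMap_le f) _

theorem GoodMon.hasSections_zero (hN : GoodMon c N) (d : ℕ) {k : ℕ} (hdk : d ≤ k) :
    ∀ (R : Type u) [CommRing R] [IsNoetherianRing R], ringKrullDim R < d →
      HasSections n (levelMon N 0) k R := by
  induction d with
  | zero =>
    intro R _ _ hd e _ _
    have _ := subsingleton_of_ringKrullDim_lt_zero hd
    have _ := subsingleton_monAlg (R := R) (N := levelMon N 0)
    exact ⟨0, Subsingleton.elim _ _, Subsingleton.elim _ _⟩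
  | succ d ih =>
    have hred : ∀ (R : Type u) [CommRing R] [IsNoetherianRing R] [IsReduced R],
        ringKrullDim R < (d + 1 : ℕ) → HasSections n (levelMon N 0) k R := by
      intro R _ _ _ hd e he hk
      obtain ⟨s, hs, X, Y, hf⟩ := hN.exists_frame (Nat.zero_le r) he hk
      obtain ⟨p, hp, hp1⟩ := (ih (by omega) (R ⧸ Ideal.span {s})
        (ringKrullDim_quotient_lt_of_nonZeroDivisor hs hd)).exists_sup_eq_top
        Ideal.Quotient.mk_surjective he hk
      rw [Ideal.mk_ker, Ideal.map_span, Set.image_singleton] at hp1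
      have _ := hN.isNoetherianRing (R := R) (Nat.zero_le r)
      obtain ⟨v, hv, hht⟩ := exists_add_smul_forall_le_height hf hp1 1 fun 𝔮 h𝔮 h1 _ =>
        h𝔮.ne_top ((Ideal.eq_top_iff_one _).mpr h1)
      obtain ⟨F, hF, hFp⟩ := hN.exists_lexMonic_mem (Nat.zero_le r) hd _ fun 𝔮 h𝔮 hle =>
        le_trans (by exact_mod_cast hdk) (hht 𝔮 h𝔮 hle)
      have hF1 : F = 1 := hF
      rw [hF1, map_one] at hFp
      refine ⟨_, ?_, (Ideal.eq_top_iff_one _).mpr hFp⟩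
      rw [Matrix.mulVec_add, hp, Matrix.mulVec_smul, hv]
    intro R _ _ hd e he hk
    have _ : IsReduced (R ⧸ nilradical R) :=
      (Ideal.isRadical_iff_quotient_reduced _).mp (Ideal.radical_isRadical ⊥)
    obtain ⟨p, hp, hp1⟩ := (hred (R ⧸ nilradical R)
      (lt_of_le_of_lt (ringKrullDim_quotient_le _) hd)).exists_sup_eq_top
      Ideal.Quotient.mk_surjective he hk
    rw [Ideal.mk_ker] at hp1
    exact ⟨p, hp, eq_top_of_sup_nilradical hp1 (map_nilradical_le_nilradical _)⟩

/-- The retraction of `R[N]` onto a face. -/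
noncomputable def levelProj {R : Type*} [CommRing R] (j : Fin r) :
    monAlg R (levelMon N (j.val + 1)) →+* monAlg R (levelMon N j.val) :=
  ((scaleVar j 0).toRingHom.comp (monAlg R (levelMon N (j.val + 1))).val.toRingHom).codRestrict
    (monAlg R (levelMon N j.val)) fun p => by
      rw [levelMon_eq_faceMon]
      exact scaleVar_zero_mem_face j p.2

theorem GoodMon.hasSections (hN : GoodMon c N) {d k : ℕ} (hdk : d ≤ k) (R : Type u) [CommRing R]
    [IsNoetherianRing R] (hd : ringKrullDim R < d) {m : ℕ} (hm : m ≤ r) :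
    HasSections n (levelMon N m) k R := by
  induction m with
  | zero => exact hN.hasSections_zero d hdk R hd
  | succ m ih =>
    intro e he hk
    let j : Fin r := ⟨m, hm⟩
    let ι : monAlg R (levelMon N j.val) →+* monAlg R (levelMon N (j.val + 1)) :=
      (Subalgebra.inclusion (monAlg_levelMon_le R N m)).toRingHom
    have hρι : ∀ a, scaleHom j 0 (ι a) = ι a := fun a => Subtype.ext <| by
      refine scaleVar_of_mem_face (N := levelMon N (j.val + 1)) j 0 ?_
      rw [← levelMon_eq_faceMon]
      exact a.2
    obtain ⟨p, hp, hp1⟩ := ih (by omega) (e.map (levelProj j)) (by rw [← Matrix.map_mul, he])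
      (hk.map _)
    obtain ⟨q, hq, -, hq1⟩ := hN.hasLifts j d hdk R hd e he hk (ι ∘ p)
      (funext fun i => hρι (p i)) (by
        conv_rhs => rw [← hp, ← map_mulVec_comp, Matrix.map_map]
        rfl) (by rw [span_range_comp, hp1, Ideal.map_top])
    exact ⟨q, hq, hq1⟩

end Serre

section Trade

variable {r : ℕ}

theorem exists_add_of_mem_tradeSet {j : Fin r} {w : Fin r → ℕ} {x x' y : Fin r →₀ ℕ}
    (h : y ∈ tradeSet j w (x + x')) :
    ∃ a ∈ tradeSet j w x, ∃ b ∈ tradeSet j w x', a + b = y := by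
  obtain ⟨h1, h2, h3⟩ := h
  let a : Fin r →₀ ℕ := Finsupp.equivFunOnFinite.symm fun i => if i < j then min (y i) (x i) else
    if i = j then x j + ∑ i ∈ Finset.Iio j, (x i - min (y i) (x i)) * w i else x i
  let b : Fin r →₀ ℕ := Finsupp.equivFunOnFinite.symm fun i =>
    if i < j then y i - min (y i) (x i) else
    if i = j then x' j + ∑ i ∈ Finset.Iio j, (x' i - (y i - min (y i) (x i))) * w i else x' i
  have ha1 : ∀ i, i < j → a i = min (y i) (x i) := fun i hi => by simp [a, hi]
  have hb1 : ∀ i, i < j → b i = y i - min (y i) (x i) := fun i hi => by simp [b, hi]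
  have ha2 : ∀ i, j < i → a i = x i := fun i hi => by simp [a, hi.not_gt, hi.ne']
  have hb2 : ∀ i, j < i → b i = x' i := fun i hi => by simp [b, hi.not_gt, hi.ne']
  have ha3 : a j = x j + ∑ i ∈ Finset.Iio j, (x i - min (y i) (x i)) * w i := by simp [a]
  have hb3 : b j = x' j + ∑ i ∈ Finset.Iio j, (x' i - (y i - min (y i) (x i))) * w i := by
    simp [b]
  refine ⟨a, ⟨fun i hi => by rw [ha1 i hi]; exact min_le_right _ _, ha2, ?_⟩, b,
    ⟨fun i hi => ?_, hb2, ?_⟩, ?_⟩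
  · rw [ha3]
    congr 1
    exact Finset.sum_congr rfl fun i hi => by rw [ha1 i (Finset.mem_Iio.mp hi)]
  · have := h1 i hi
    rw [Finsupp.add_apply] at this
    rw [hb1 i hi]
    omega
  · rw [hb3]
    congr 1
    exact Finset.sum_congr rfl fun i hi => by rw [hb1 i (Finset.mem_Iio.mp hi)]
  · ext i
    rw [Finsupp.add_apply]
    rcases lt_trichotomy i j with h | rfl | h
    · rw [ha1 i h, hb1 i h]; omega
    · rw [ha3, hb3, h3, Finsupp.add_apply, add_add_add_comm, ← Finset.sum_add_distrib]
      congr 1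
      refine Finset.sum_congr rfl fun l hl => ?_
      have := h1 l (Finset.mem_Iio.mp hl)
      rw [Finsupp.add_apply] at this
      rw [← add_mul, Finsupp.add_apply]
      congr 1
      omega
    · rw [ha2 i h, hb2 i h, h2 i h, Finsupp.add_apply]

/-- `p` has nonnegative coefficients, and positive ones at the exponents in `T`. -/
def PosOn (T : Set (Fin r →₀ ℕ)) (p : MvPolynomial (Fin r) ℤ) : Prop :=
  ∀ y, 0 ≤ coeff y p ∧ (y ∈ T → 0 < coeff y p)

theorem PosOn.mul {T T' T'' : Set (Fin r →₀ ℕ)} {p q : MvPolynomial (Fin r) ℤ} (hp : PosOn T p)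
    (hq : PosOn T' q) (h : ∀ y ∈ T'', ∃ a ∈ T, ∃ b ∈ T', a + b = y) : PosOn T'' (p * q) := by
  classical
  intro y
  rw [coeff_mul]
  refine ⟨Finset.sum_nonneg fun z _ => mul_nonneg (hp _).1 (hq _).1, fun hy => ?_⟩
  obtain ⟨a, ha, b, hb, hab⟩ := h y hy
  exact Finset.sum_pos' (fun z _ => mul_nonneg (hp _).1 (hq _).1)
    ⟨(a, b), Finset.HasAntidiagonal.mem_antidiagonal.mpr hab, mul_pos ((hp _).2 ha) ((hq _).2 hb)⟩

theorem posOn_monomial (x : Fin r →₀ ℕ) : PosOn {x} (monomial x (1 : ℤ)) := by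
  classical
  intro y
  rw [coeff_monomial]
  constructor
  · split_ifs <;> simp
  · rintro rfl
    simp

theorem PosOn.add {T T' : Set (Fin r →₀ ℕ)} {p q : MvPolynomial (Fin r) ℤ} (hp : PosOn T p)
    (hq : PosOn T' q) : PosOn (T ∪ T') (p + q) := by
  intro y
  rw [coeff_add]
  have := hp y
  have := hq y
  refine ⟨by omega, ?_⟩
  rintro (h | h)
  · have := (hp y).2 h; omega
  · have := (hq y).2 h; omega

theorem PosOn.mono {T T' : Set (Fin r →₀ ℕ)} {p : MvPolynomial (Fin r) ℤ} (hp : PosOn T p)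
    (h : T' ⊆ T) : PosOn T' p := fun y => ⟨(hp y).1, fun hy => (hp y).2 (h hy)⟩

theorem eq_of_mem_tradeSet {j : Fin r} {w : Fin r → ℕ} {x y : Fin r →₀ ℕ}
    (hy : y ∈ tradeSet j w x) (h : ∀ i, i < j → y i = x i) : y = x := by
  ext i
  rcases lt_trichotomy i j with hi | rfl | hi
  · exact h i hi
  · rw [hy.2.2, Finset.sum_eq_zero, add_zero]
    intro l hl
    rw [h l (Finset.mem_Iio.mp hl), Nat.sub_self, zero_mul]
  · exact hy.2.1 i hi

theorem tradeSet_single_of_not_lt {j i : Fin r} (w : Fin r → ℕ) (hi : ¬ i < j) :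
    tradeSet j w (Finsupp.single i 1) ⊆ {Finsupp.single i 1} := by
  intro y hy
  refine eq_of_mem_tradeSet hy fun l hl => ?_
  have := hy.1 l hl
  have hne : i ≠ l := fun h => hi (h ▸ hl)
  rw [Finsupp.single_eq_of_ne' hne] at this ⊢
  omega

theorem tradeSet_single_of_lt {j i : Fin r} (w : Fin r → ℕ) (hi : i < j) :
    tradeSet j w (Finsupp.single i 1) ⊆ {Finsupp.single i 1} ∪ {Finsupp.single j (w i)} := by
  intro y hy
  have h0 : ∀ l, l < j → l ≠ i → y l = 0 := fun l hl hli => by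
    have := hy.1 l hl
    rw [Finsupp.single_eq_of_ne hli] at this
    omega
  have h1 := hy.1 i hi
  rw [Finsupp.single_eq_same] at h1
  rcases Nat.le_one_iff_eq_zero_or_eq_one.mp h1 with h | h
  · right
    ext l
    rcases lt_trichotomy l j with hl | rfl | hl
    · rw [Finsupp.single_eq_of_ne hl.ne]
      by_cases hli : l = i
      · rw [hli, h]
      · exact h0 l hl hli
    · rw [hy.2.2, Finsupp.single_eq_same, Finsupp.single_eq_of_ne hi.ne', zero_add,
        Finset.sum_eq_single i]
      · rw [h, Finsupp.single_eq_same]; simp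
      · intro b _ hb; simp [Finsupp.single_eq_of_ne hb]
      · intro h; exact absurd (Finset.mem_Iio.mpr hi) h
    · rw [hy.2.1 l hl, Finsupp.single_eq_of_ne hl.ne', Finsupp.single_eq_of_ne (hi.trans hl).ne']
  · left
    refine eq_of_mem_tradeSet hy fun l hl => ?_
    by_cases hli : l = i
    · rw [hli, h, Finsupp.single_eq_same]
    · rw [h0 l hl hli, Finsupp.single_eq_of_ne hli]

/-- Every exponent of `tradeSet j w x` occurs in the image of the monomial `x`. -/
theorem posOn_shear_monomial (j : Fin r) (w : Fin r → ℕ) (x : Fin r →₀ ℕ) :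
    PosOn (tradeSet j w x) (shear j w (1 : ℤ) (monomial x 1)) := by
  refine exp_induction (P := fun x => PosOn (tradeSet j w x) (shear j w (1 : ℤ) (monomial x 1)))
    ?_ ?_ ?_ x
  · rw [show (monomial (0 : Fin r →₀ ℕ) (1 : ℤ)) = 1 from rfl, map_one]
    refine (posOn_monomial 0).mono fun y hy => eq_of_mem_tradeSet hy fun l hl => ?_
    have := hy.1 l hl
    simpa using this
  · intro i
    change PosOn _ (shear j w 1 (X i))
    by_cases h : i < j
    · rw [shear_X_of_lt w 1 h, C_mul_X_pow_eq_monomial]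
      exact ((posOn_monomial _).add (posOn_monomial _)).mono (tradeSet_single_of_lt w h)
    · rw [shear_X_of_not_lt w 1 h]
      exact (posOn_monomial _).mono (tradeSet_single_of_not_lt w h)
  · intro x y hx hy
    have : monomial (x + y) (1 : ℤ) = monomial x 1 * monomial y 1 := by simp
    rw [this, map_mul]
    exact hx.mul hy fun _ h => exists_add_of_mem_tradeSet h

end Trade

section GoodMon

variable {r : ℕ} {M : AddSubmonoid (Fin r → ℕ)}

/-- A submonoid of `ℕ^r` in terms of finitely supported functions. -/
noncomputable def finsuppMon (M : AddSubmonoid (Fin r → ℕ)) : AddSubmonoid (Fin r →₀ ℕ) :=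
  M.comap (Finsupp.coeFnAddHom : (Fin r →₀ ℕ) →+ (Fin r → ℕ))

theorem mem_finsuppMon {x : Fin r →₀ ℕ} : x ∈ finsuppMon M ↔ ⇑x ∈ M := Iff.rfl

theorem natCast_injective (r : ℕ) : Function.Injective (natCast r) := by
  intro x y h
  ext i
  exact Nat.cast_injective (R := ℤ) (congrFun h i)

theorem mem_map_natCast {x : Fin r → ℕ} : natCast r x ∈ M.map (natCast r) ↔ x ∈ M :=
  AddSubmonoid.mem_map_iff_mem (natCast_injective r)

/-- A seminormal monoid contains the elements of its group all of whose large multiples it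
contains. -/
theorem MonoidSeminormal.mem_of_nsmul_mem (hM : MonoidSeminormal M) {x : Fin r → ℕ}
    (hx : natCast r x ∈ AddSubgroup.closure (M.map (natCast r) : Set (Fin r → ℤ))) (K : ℕ)
    (hK : ∀ n, K ≤ n → 0 < n → n • x ∈ M) : x ∈ M := by
  induction K with
  | zero => simpa using hK 1 (by omega) one_pos
  | succ K ih =>
    refine ih fun n hn hn0 => ?_
    rcases Nat.lt_or_ge K n with h | h
    · exact hK n h hn0
    · have hnK : n = K := by omega
      subst hnK
      rw [← mem_map_natCast]
      refine hM _ ?_ ?_ ?_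
      · rw [map_nsmul]; exact AddSubgroup.nsmul_mem _ hx _
      · rw [← map_nsmul, mem_map_natCast, ← mul_nsmul']
        exact hK _ (by omega) (by omega)
      · rw [← map_nsmul, mem_map_natCast, ← mul_nsmul']
        exact hK _ (by omega) (by omega)

theorem PhiSimplicial.exists_single_mem (hM : PhiSimplicial M) :
    ∃ c, 0 < c ∧ ∀ i, Finsupp.single i c ∈ finsuppMon M := by
  choose n hn hnM using fun i : Fin r => hM.2 (Pi.single i 1)
  refine ⟨∏ i, n i, Finset.prod_pos fun i _ => hn i, fun i => ?_⟩
  obtain ⟨t, ht⟩ := Finset.dvd_prod_of_mem n (Finset.mem_univ i)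
  rw [mem_finsuppMon, ht, mul_comm, Finsupp.single_eq_pi_single]
  have : Pi.single i (t * n i) = t • (n i • (Pi.single i 1 : Fin r → ℕ)) := by
    rw [← mul_nsmul', ← Pi.single_smul]
    simp
  rw [this]
  exact M.nsmul_mem (hnM i) t

theorem nsmul_mem_of_single_mem {N : AddSubmonoid (Fin r →₀ ℕ)} {c : ℕ}
    (h : ∀ i, Finsupp.single i c ∈ N) (x : Fin r →₀ ℕ) : c • x ∈ N := by
  refine exp_induction (P := fun x => c • x ∈ N) ?_ ?_ ?_ x
  · rw [smul_zero]; exact N.zero_mem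
  · intro i; simpa using h i
  · intro x y hx hy; rw [smul_add]; exact N.add_mem hx hy

theorem MonoidSeminormal.mem_of_add (hM : MonoidSeminormal M) {c : ℕ} (hc : 0 < c)
    (hs : ∀ i, Finsupp.single i c ∈ finsuppMon M) {x : Fin r →₀ ℕ} {i : Fin r} (hi : 0 < x i)
    (hx : x + Finsupp.single i c ∈ finsuppMon M) : x ∈ finsuppMon M := by
  refine hM.mem_of_nsmul_mem ?_ (c * c) fun n hn _ => ?_
  · have : natCast r x = natCast r (⇑(x + Finsupp.single i c)) -
        natCast r (⇑(Finsupp.single i c)) := by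
      rw [Finsupp.coe_add, map_add, add_sub_cancel_right]
    change natCast r x ∈ _
    rw [this]
    exact AddSubgroup.sub_mem _ (AddSubgroup.subset_closure (mem_map_natCast.mpr hx))
      (AddSubgroup.subset_closure (mem_map_natCast.mpr (hs i)))
  · change n • x ∈ finsuppMon M
    have hq : c ≤ n / c := (Nat.le_div_iff_mul_le hc).mpr hn
    have hle : Finsupp.single i (n % c) ≤ (n / c) • x := by
      rw [Finsupp.single_le_iff, Finsupp.smul_apply, smul_eq_mul]
      have := Nat.mod_lt n hc
      nlinarith
    have key : n • x = (n % c) • (x + Finsupp.single i c) +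
        c • ((n / c) • x - Finsupp.single i (n % c)) := by
      have h1 : c • ((n / c) • x - Finsupp.single i (n % c)) + c • Finsupp.single i (n % c) =
          c • (n / c) • x := by rw [← smul_add, tsub_add_cancel_of_le hle]
      have h2 : c • Finsupp.single i (n % c) = (n % c) • Finsupp.single i c := by
        simp [mul_comm]
      rw [smul_add, add_assoc, ← h2, add_comm (c • Finsupp.single i (n % c)), h1, smul_smul,
        ← add_smul, Nat.mod_add_div]
    rw [key]
    exact AddSubmonoid.add_mem _ (AddSubmonoid.nsmul_mem _ hx _) (nsmul_mem_of_single_mem hs _)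

theorem subst_eq_shear (j : Fin r) (w : Fin r → ℕ) (R : Type*) [CommRing R] :
    subst j w R = shear j w 1 := by
  simp [subst, shear]

theorem truncAlgebra_le (j : Fin r) (R : Type*) [CommRing R] :
    truncAlgebra M j R ≤ monAlg R (finsuppMon M) := by
  refine Algebra.adjoin_le ?_
  rintro _ ⟨x, hx, rfl⟩
  exact monomial_mem_monAlg hx.1 1

theorem InClassCPhi.goodMon (hM : PhiSimplicial M) (hMC : InClassCPhi M) :
    ∃ c, GoodMon c (finsuppMon M) := by
  obtain ⟨c, hc, hs⟩ := hM.exists_single_mem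
  refine ⟨c, hc, hs, fun x i hi hx => hMC.1.mem_of_add hc hs hi hx, fun j => ?_⟩
  obtain ⟨w, hw, hmap⟩ := hMC.2 j 0
  refine ⟨w, hw, fun x hx hxj y hy => ?_⟩
  have h1 : monomial x (1 : ℤ) ∈ truncAlgebra M j ℤ :=
    Algebra.subset_adjoin ⟨x, ⟨hx, hxj⟩, by simp [monomialOf]⟩
  have h2 : shear j w (1 : ℤ) (monomial x 1) ∈ truncAlgebra M j ℤ := by
    rw [← hmap ℤ inferInstance, ← subst_eq_shear]
    exact ⟨_, h1, rfl⟩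
  exact truncAlgebra_le j ℤ h2 y (((posOn_shear_monomial j w x) y).2 hy).ne'

end GoodMon

section Projective

open TensorProduct

variable {A : Type u} [CommRing A] {P : Type*} [AddCommGroup P] [Module A P]

/-- The idempotent matrix of a projective module of constant rank has constant rank. -/
theorem hasRank_of_rankAtStalk [Module.Finite A P] [Module.Projective A P] {k q : ℕ}
    (hk : ∀ 𝔭, Module.rankAtStalk (R := A) P 𝔭 = k) {π : (Fin q → A) →ₗ[A] P}
    {s : P →ₗ[A] Fin q → A} (h : π ∘ₗ s = LinearMap.id) :
    HasRank (LinearMap.toMatrix' (s ∘ₗ π)) k := by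
  intro L _ f
  let _ := f.toAlgebra
  have hfr : Module.finrank L (L ⊗[A] P) = k := by
    have h1 := Module.rankAtStalk_baseChange (R := A) (M := P) (S := L) ⊥
    rw [hk, Module.rankAtStalk_eq_finrank_of_free] at h1
    simpa using h1
  let b : Module.Basis (Fin k) L (L ⊗[A] P) := Module.finBasisOfFinrankEq L _ hfr
  let S (i : Fin q) : L ⊗[A] P →ₗ[L] L :=
    (AlgebraTensorModule.rid A L L).toLinearMap ∘ₗ (LinearMap.proj i ∘ₗ s).baseChange L
  have hS : ∀ i a p, S i (a ⊗ₜ p) = f (s p i) * a := by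
    intro i a p
    simp [S, Algebra.smul_def, RingHom.algebraMap_toAlgebra]
  let g (i : Fin q) : P := π (Pi.single i 1)
  have hg : ∀ p, ∑ i, s p i • g i = p := fun p => by
    have h1 : p = π (s p) := (LinearMap.congr_fun h p).symm
    conv_rhs => rw [h1, pi_eq_sum_univ' (s p), map_sum]
    refine Finset.sum_congr rfl fun i _ => ?_
    rw [map_smul]
  have hsum : ∀ z : L ⊗[A] P, ∑ i, S i z • ((1 : L) ⊗ₜ[A] g i) = z := by
    intro z
    induction z with
    | zero => simp
    | add x y hx hy => simp only [map_add, add_smul, Finset.sum_add_distrib, hx, hy]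
    | tmul a p =>
      conv_rhs => rw [← hg p, tmul_sum]
      refine Finset.sum_congr rfl fun i _ => ?_
      rw [hS, smul_tmul', smul_eq_mul, mul_one, ← smul_tmul, Algebra.smul_def,
        RingHom.algebraMap_toAlgebra]
  refine rank_of_mul_eq (X := Matrix.of fun i l => S i (b l))
    (Y := Matrix.of fun l i => b.repr (1 ⊗ₜ g i) l) ?_ ?_
  · ext i j
    rw [Matrix.mul_apply]
    have h1 : S i (1 ⊗ₜ g j) = ∑ l, b.repr (1 ⊗ₜ g j) l * S i (b l) := by
      conv_lhs => rw [← b.sum_repr (1 ⊗ₜ g j), map_sum]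
      simp
    simp only [Matrix.of_apply, Matrix.map_apply, LinearMap.toMatrix'_apply]
    simp only [mul_comm (S i _)]
    rw [← h1, hS, mul_one]
    simp [g]
  · ext l l'
    rw [Matrix.mul_apply]
    have h1 := congrArg (fun z => b.repr z l) (hsum (b l'))
    simp only [map_sum, map_smul, Finsupp.coe_finsetSum, Finset.sum_apply, Finsupp.smul_apply,
      smul_eq_mul, b.repr_self] at h1
    simp only [Matrix.of_apply, mul_comm (b.repr _ l)]
    rw [h1, Matrix.one_apply, Finsupp.single_apply]
    simp [eq_comm]

theorem exists_isUnimodular_of_mulVec {q : ℕ} {π : (Fin q → A) →ₗ[A] P}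
    {s : P →ₗ[A] Fin q → A} {p : Fin q → A}
    (hp : (LinearMap.toMatrix' (s ∘ₗ π)).mulVec p = p) (hp1 : Ideal.span (Set.range p) = ⊤) :
    IsUnimodular (R := A) (π p) := by
  obtain ⟨a, ha⟩ := Ideal.mem_span_range_iff_exists_fun.mp ((Ideal.eq_top_iff_one _).mp hp1)
  refine ⟨(Fintype.linearCombination A a) ∘ₗ s, ?_⟩
  rw [← Matrix.toLin'_apply, Matrix.toLin'_toMatrix'] at hp
  change Fintype.linearCombination A a (s (π p)) = 1
  rw [LinearMap.comp_apply] at hp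
  rw [hp, Fintype.linearCombination_apply, ← ha]
  simp [mul_comm]

end Projective

section Transport

variable {A B : Type u} [CommRing A] [CommRing B]

theorem exists_mulVec_of_ringEquiv (φ : A ≃+* B) {n : Type*} [Fintype n] {k : ℕ}
    (hB : ∀ e : Matrix n n B, e * e = e → HasRank e k →
      ∃ p : n → B, e.mulVec p = p ∧ Ideal.span (Set.range p) = ⊤)
    {e : Matrix n n A} (he : e * e = e) (hk : HasRank e k) :
    ∃ p : n → A, e.mulVec p = p ∧ Ideal.span (Set.range p) = ⊤ := by
  obtain ⟨p, hp, hp1⟩ := hB (e.map φ.toRingHom) (by rw [← Matrix.map_mul, he]) (hk.map _)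
  have hφ : (e.map φ.toRingHom).map φ.symm.toRingHom = e := by
    ext i j
    simp
  refine ⟨φ.symm.toRingHom ∘ p, ?_, ?_⟩
  · conv_rhs => rw [← hp, ← map_mulVec_comp, hφ]
  · rw [span_range_comp, hp1, Ideal.map_top]

variable {r : ℕ} (M : AddSubmonoid (Fin r → ℕ)) (R : Type*) [CommRing R]

/-- The additive equivalence between a submonoid of `ℕ^r` and its version with finitely
supported functions. -/
noncomputable def finsuppMonEquiv : M ≃+ finsuppMon M where
  toFun x := ⟨Finsupp.equivFunOnFinite.symm x.1, by
    rw [mem_finsuppMon, Finsupp.coe_equivFunOnFinite_symm]; exact x.2⟩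
  invFun x := ⟨⇑x.1, x.2⟩
  left_inv x := rfl
  right_inv x := Subtype.ext (Finsupp.ext fun _ => rfl)
  map_add' x y := Subtype.ext (Finsupp.ext fun _ => rfl)

/-- The monoid algebra of `M` inside the polynomial ring. -/
noncomputable def addMonoidAlgebraEquiv : AddMonoidAlgebra R M ≃ₐ[R] monAlg R (finsuppMon M) :=
  (AddMonoidAlgebra.domCongr R R (finsuppMonEquiv M)).trans (monAlgEquiv R)

end Transport

/-- Keshari–Sarwar: let `R` be a commutative Noetherian ring of dimension `n` and
`M` a `Φ`-simplicial monoid in the class `C(Φ)`.  Then every finitely generated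
projective `R[M]`-module of constant rank `> n` contains a unimodular element. -/
theorem unimodular_of_rank_gt_dim_monoid_algebra
    (R : Type) [CommRing R] [IsNoetherianRing R] (n : ℕ) (hdim : ringKrullDim R = n)
    (r : ℕ) (M : AddSubmonoid (Fin r → ℕ))
    (hM : PhiSimplicial M) (hMC : InClassCPhi M)
    (P : Type) [AddCommGroup P] [Module (AddMonoidAlgebra R M) P]
    [Module.Finite (AddMonoidAlgebra R M) P]
    [Module.Projective (AddMonoidAlgebra R M) P]
    (k : ℕ) (hk : n < k)
    (hrank : ∀ (𝔭 : Ideal (AddMonoidAlgebra R M)) [𝔭.IsPrime],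
      Module.finrank (Localization.AtPrime 𝔭) (LocalizedModule 𝔭.primeCompl P) = k) :
    ∃ p : P, IsUnimodular (R := AddMonoidAlgebra R M) p := by
  obtain ⟨c, hN⟩ := hMC.goodMon hM
  obtain ⟨q, π, s, -, -, hπs⟩ := Module.Finite.exists_comp_eq_id_of_projective
    (AddMonoidAlgebra R M) P
  have hs := hN.hasSections (n := Fin q) (d := n + 1) hk R
    (by rw [hdim]; exact_mod_cast Nat.lt_succ_self n) le_rfl
  rw [levelMon_self] at hs
  obtain ⟨p, hp, hp1⟩ := exists_mulVec_of_ringEquiv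
    (addMonoidAlgebraEquiv M R).toRingEquiv hs
    (e := LinearMap.toMatrix' (s ∘ₗ π)) (by
      rw [← LinearMap.toMatrix'_comp, LinearMap.comp_assoc, ← LinearMap.comp_assoc π, hπs,
        LinearMap.id_comp])
    (hasRank_of_rankAtStalk (fun 𝔭 => hrank 𝔭.asIdeal) hπs)
  exact ⟨_, exists_isUnimodular_of_mulVec hp hp1⟩
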